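/- arXiv:2306.11178 — 2 statements merged into one kernel-verified Lean document; each statement's English description precedes it below -/
import Mathlib

section
/- (Strauss–Wu, mass-controlled local curve) Let 6/5 < γ < 2 with γ ≠ 4/3, let ρ₀ be a compactly supported nonnegative continuous radial Lane–Emden solution (i.e., ρ₀^{γ−1} − (1/|·| * ρ₀) is constant on {ρ₀ > 0}), and let ω₀ : [0,∞) → ℝ be a given smooth function. Then there exists κ̄ > 0 such that for each κ with |κ| < κ̄, there is a nonnegative, compactly supported, continuous function ρ_κ : ℝ³ → ℝ solving ρ_κ^{γ−1}(x) − (1/|·| * ρ_κ)(x) − ∫₀^{r(x)} κ²ω₀²(s) s ds = constant on {ρ_κ > 0}, satisfying the mass constraint ∫_{ℝ³} ρ_κ(x) dx = ∫_{ℝ³} ρ₀(x) dx, with ρ_0 = ρ₀ and the map κ ↦ ρ_κ continuous into the continuous functions on ℝ³ with the supremum norm. -/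
open MeasureTheory Real

/-- The Newtonian potential `(1/|·| * ρ)(x) = ∫ ρ(y)/|x−y| dy` on `ℝ³`. -/
noncomputable def pot (ρ : EuclideanSpace ℝ (Fin 3) → ℝ) (x : EuclideanSpace ℝ (Fin 3)) : ℝ :=
  ∫ y, ρ y / ‖x - y‖

/-- The cylindrical radius `r(x) = √(x₁² + x₂²)`. -/
noncomputable def cylRad (x : EuclideanSpace ℝ (Fin 3)) : ℝ :=
  Real.sqrt ((x 0)^2 + (x 1)^2)

section AbstractKernel

variable {K : Type*} [MetricSpace K] [CompactSpace K]

/-- Composition with a `C¹` function is strictly differentiable on `C(K, ℝ)`. -/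
lemma hasStrictFDerivAt_continuousMap_comp {g g' : ℝ → ℝ} (hg : ∀ t, HasDerivAt g (g' t) t)
    (G G' : C(ℝ, ℝ)) (hG : ⇑G = g) (hG' : ⇑G' = g') (u₀ : C(K, ℝ)) :
    HasStrictFDerivAt (fun u : C(K, ℝ) => G.comp u)
      (ContinuousLinearMap.mul ℝ C(K, ℝ) (G'.comp u₀)) u₀ := by
  subst hG hG'
  rw [hasStrictFDerivAt_iff_isLittleO, Asymptotics.isLittleO_iff]
  intro c hc
  have hcont : Continuous fun s : ℝ => G'.comp (u₀ + ContinuousMap.const K s) :=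
    (ContinuousMap.continuous_postcomp G').comp
      (continuous_const.add (by exact ContinuousMap.continuous_const'))
  obtain ⟨δ, hδ, h⟩ := Metric.continuous_iff.1 hcont 0 c hc
  have hder : ∀ x t, |t - u₀ x| < δ → |G' t - G' (u₀ x)| ≤ c := by
    intro x t ht
    have h1 := h (t - u₀ x) (by simpa [Real.dist_eq] using ht)
    have h2 := (ContinuousMap.dist_apply_le_dist x).trans h1.le
    simpa [Real.dist_eq] using h2
  have hn : ∀ᶠ p : C(K, ℝ) × C(K, ℝ) in nhds (u₀, u₀), dist p.1 u₀ < δ ∧ dist p.2 u₀ < δ := by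
    exact prod_mem_nhds (Metric.ball_mem_nhds u₀ hδ) (Metric.ball_mem_nhds u₀ hδ)
  filter_upwards [hn] with p hp
  refine (ContinuousMap.norm_le _ (by positivity)).2 fun x => ?_
  have hmv := Convex.norm_image_sub_le_of_norm_hasDerivWithin_le (𝕜 := ℝ)
    (f := fun t => G t - G' (u₀ x) * t) (f' := fun t => G' t - G' (u₀ x) * 1) (C := c)
    (s := Metric.ball (u₀ x) δ) (x := p.2 x) (y := p.1 x)
    (fun t _ => ((hg t).sub ((hasDerivAt_id t).const_mul _)).hasDerivWithinAt)
    (fun t ht => by simpa using hder x t (by simpa [Real.dist_eq] using ht))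
    (convex_ball _ _)
    ((ContinuousMap.dist_apply_le_dist x).trans_lt hp.2)
    ((ContinuousMap.dist_apply_le_dist x).trans_lt hp.1)
  have e : (G.comp p.1 - G.comp p.2 -
        (ContinuousLinearMap.mul ℝ C(K, ℝ) (G'.comp u₀)) (p.1 - p.2)) x
      = (G (p.1 x) - G' (u₀ x) * p.1 x) - (G (p.2 x) - G' (u₀ x) * p.2 x) := by
    simp; ring
  rw [e]
  refine hmv.trans (mul_le_mul_of_nonneg_left ?_ hc.le)
  exact (p.1 - p.2).norm_coe_le_norm x

variable [MeasurableSpace K]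

/-- An integral kernel on a compact space that is Lipschitz as a map into `L¹`. -/
structure LipschitzKernel (μ : Measure K) (k : K → K → ℝ) : Prop where
  integrable : ∀ x, Integrable (k x) μ
  lipschitz : ∃ C, 0 ≤ C ∧ ∀ x x', ∫ y, |k x y - k x' y| ∂μ ≤ C * dist x x'
  bounded : ∃ D, 0 ≤ D ∧ ∀ x, ∫ y, |k x y| ∂μ ≤ D

namespace LipschitzKernel

variable {μ : Measure K} {k : K → K → ℝ}

lemma abs_integral_le (hk : LipschitzKernel μ k) (x : K) (f : C(K, ℝ)) :
    |∫ y, k x y * f y ∂μ| ≤ (∫ y, |k x y| ∂μ) * ‖f‖ := by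
  rw [← integral_mul_const]
  rw [← Real.norm_eq_abs]
  refine norm_integral_le_of_norm_le ((hk.integrable x).abs.mul_const _) ?_
  refine Filter.Eventually.of_forall fun y => ?_
  rw [norm_mul]
  exact mul_le_mul_of_nonneg_left (f.norm_coe_le_norm y) (norm_nonneg _)

variable [BorelSpace K]

lemma integrable_mul (hk : LipschitzKernel μ k) (x : K) (f : C(K, ℝ)) :
    Integrable (fun y => k x y * f y) μ := by
  refine (hk.integrable x).mul_bdd (c := ‖f‖) f.continuous.aestronglyMeasurable ?_
  exact Filter.Eventually.of_forall fun y => f.norm_coe_le_norm y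

lemma abs_integral_sub_le (hk : LipschitzKernel μ k) (x x' : K) (f : C(K, ℝ)) :
    |∫ y, k x y * f y ∂μ - ∫ y, k x' y * f y ∂μ| ≤ (∫ y, |k x y - k x' y| ∂μ) * ‖f‖ := by
  rw [← integral_sub (hk.integrable_mul x f) (hk.integrable_mul x' f), ← integral_mul_const]
  rw [← Real.norm_eq_abs]
  refine norm_integral_le_of_norm_le
    (((hk.integrable x).sub (hk.integrable x')).abs.mul_const _) ?_
  refine Filter.Eventually.of_forall fun y => ?_
  rw [← sub_mul, norm_mul]
  exact mul_le_mul_of_nonneg_left (f.norm_coe_le_norm y) (norm_nonneg _)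

/-- The integral operator of a Lipschitz kernel, acting on continuous functions. -/
noncomputable def op (hk : LipschitzKernel μ k) : C(K, ℝ) →L[ℝ] C(K, ℝ) :=
  LinearMap.mkContinuous
    { toFun := fun f => ⟨fun x => ∫ y, k x y * f y ∂μ, by
        obtain ⟨C, hC, h⟩ := hk.lipschitz
        refine (LipschitzWith.of_dist_le_mul (K := (C * ‖f‖).toNNReal) fun x x' => ?_).continuous
        rw [Real.coe_toNNReal _ (by positivity), Real.dist_eq, mul_right_comm]
        exact (hk.abs_integral_sub_le x x' f).trans
          (mul_le_mul_of_nonneg_right (h x x') (norm_nonneg _))⟩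
      map_add' := fun f g => by
        ext x
        simp only [ContinuousMap.add_apply, ContinuousMap.coe_mk, mul_add]
        exact integral_add (hk.integrable_mul x f) (hk.integrable_mul x g)
      map_smul' := fun c f => by
        ext x
        simp only [ContinuousMap.smul_apply, ContinuousMap.coe_mk, smul_eq_mul, RingHom.id_apply,
          mul_left_comm _ c]
        exact integral_const_mul _ _ }
    hk.bounded.choose
    (fun f => by
      have hD := hk.bounded.choose_spec
      refine (ContinuousMap.norm_le _ (mul_nonneg hD.1 (norm_nonneg _))).2 fun x => ?_
      exact (hk.abs_integral_le x f).trans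
          (mul_le_mul_of_nonneg_right (hD.2 x) (norm_nonneg _)))

@[simp] lemma op_apply (hk : LipschitzKernel μ k) (f : C(K, ℝ)) (x : K) :
    hk.op f x = ∫ y, k x y * f y ∂μ := rfl

lemma isCompactOperator_op (hk : LipschitzKernel μ k) : IsCompactOperator hk.op := by
  obtain ⟨C, hC, hCl⟩ := hk.lipschitz
  obtain ⟨D, hD, hDb⟩ := hk.bounded
  let S : Set (BoundedContinuousFunction K ℝ) :=
    {f | (∀ x, f x ∈ Set.Icc (-D) D) ∧ ∀ x x', |f x - f x'| ≤ C * dist x x'}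
  have hSc : IsClosed S := by
    have e : S = (⋂ x, {f | f x ∈ Set.Icc (-D) D}) ∩
        ⋂ x, ⋂ x', {f | |f x - f x'| ≤ C * dist x x'} := by
      ext f; simp [S, Set.mem_iInter]
    rw [e]
    refine (isClosed_iInter fun x => ?_).inter (isClosed_iInter fun x => isClosed_iInter fun x' => ?_)
    · exact isClosed_Icc.preimage (continuous_eval_const x)
    · exact isClosed_le (((continuous_eval_const x).sub
        (continuous_eval_const x')).abs) continuous_const
  have hS : IsCompact S := by
    refine BoundedContinuousFunction.arzela_ascoli₂ (Set.Icc (-D) D) isCompact_Icc S hSc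
      (fun f x hf => hf.1 x) ?_
    refine Metric.equicontinuous_of_continuity_modulus (fun t => C * t) ?_ _ fun x x' f => ?_
    · have : Continuous fun t : ℝ => C * t := by fun_prop
      simpa using this.tendsto 0
    · rw [Real.dist_eq]; exact f.2.2 x x'
  refine ⟨(ContinuousMap.equivBoundedOfCompact K ℝ) ⁻¹' S, ?_, ?_⟩
  · exact (ContinuousMap.isometryEquivBoundedOfCompact K ℝ).toHomeomorph.isCompact_preimage.2 hS
  · refine Filter.mem_of_superset (Metric.closedBall_mem_nhds (0 : C(K, ℝ)) one_pos) fun f hf => ?_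
    have hf' : ‖f‖ ≤ 1 := by simpa using hf
    refine ⟨fun x => abs_le.1 ?_, fun x x' => ?_⟩
    · exact (hk.abs_integral_le x f).trans ((mul_le_of_le_one_right
        (integral_nonneg fun _ => abs_nonneg _) hf').trans (hDb x))
    · exact (hk.abs_integral_sub_le x x' f).trans ((mul_le_of_le_one_right
        (integral_nonneg fun _ => abs_nonneg _) hf').trans (hCl x x'))

end LipschitzKernel

end AbstractKernel

section LocalCurve

variable {K : Type*} [MetricSpace K] [CompactSpace K] [MeasurableSpace K] [BorelSpace K]

/-- Integration against a finite measure as a continuous functional on `C(K, ℝ)`. -/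
noncomputable def integralFunctional (μ : Measure K) [IsFiniteMeasure μ] : C(K, ℝ) →L[ℝ] ℝ :=
  LinearMap.mkContinuous
    { toFun := fun f => ∫ y, f y ∂μ
      map_add' := fun f g =>
        integral_add
          (f.continuous.integrable_of_hasCompactSupport (HasCompactSupport.of_compactSpace f))
          (g.continuous.integrable_of_hasCompactSupport (HasCompactSupport.of_compactSpace g))
      map_smul' := fun c f => integral_const_mul _ _ }
    (μ.real Set.univ)
    (fun f => by
      have := norm_integral_le_of_norm_le_const (μ := μ) (f := f) (C := ‖f‖)
        (Filter.Eventually.of_forall fun y => f.norm_coe_le_norm y)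
      simpa [mul_comm] using this)

@[simp] lemma integralFunctional_apply (μ : Measure K) [IsFiniteMeasure μ] (f : C(K, ℝ)) :
    integralFunctional μ f = ∫ y, f y ∂μ := rfl

/-- If the linearisation at `u₀` of `u = ∫ k g(u) + c`, subject to a fixed value of `∫ g(u)`, is
nondegenerate, then the solution `u₀` persists under the perturbation `κ² J`. -/
theorem LipschitzKernel.exists_curve {μ : Measure K} [IsFiniteMeasure μ] {k : K → K → ℝ}
    (hk : LipschitzKernel μ k) (o : K) {g g' : ℝ → ℝ} (hg : ∀ t, HasDerivAt g (g' t) t)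
    (hg' : Continuous g') (u₀ : C(K, ℝ)) (c₀ : ℝ)
    (hu₀ : ∀ x, u₀ x = ∫ y, k x y * g (u₀ y) ∂μ + c₀)
    (hker : ∀ (v : C(K, ℝ)) (d : ℝ), (∀ x, v x = ∫ y, k x y * (g' (u₀ y) * v y) ∂μ + d) →
      ∫ y, g' (u₀ y) * v y ∂μ = 0 → v = 0)
    (J : C(K, ℝ)) (hJ : J o = 0) :
    ∃ κmax : ℝ, 0 < κmax ∧ ∃ u : ℝ → C(K, ℝ), u 0 = u₀ ∧
      ContinuousOn u {κ | |κ| < κmax} ∧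
      ∀ κ, |κ| < κmax →
        (∃ c, ∀ x, u κ x = ∫ y, k x y * g (u κ y) ∂μ + c + κ ^ 2 * J x) ∧
        ∫ y, g (u κ y) ∂μ = ∫ y, g (u₀ y) ∂μ := by
  let G : C(ℝ, ℝ) := ⟨g, continuous_iff_continuousAt.2 fun t => (hg t).continuousAt⟩
  let G' : C(ℝ, ℝ) := ⟨g', hg'⟩
  let M : C(K, ℝ) →L[ℝ] C(K, ℝ) := ContinuousLinearMap.mul ℝ C(K, ℝ) (G'.comp u₀)
  have hN : HasStrictFDerivAt (fun u : C(K, ℝ) => G.comp u) M u₀ :=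
    hasStrictFDerivAt_continuousMap_comp hg G G' rfl rfl u₀
  let A := hk.op
  let ev : C(K, ℝ) →L[ℝ] ℝ := ContinuousMap.evalCLM ℝ o
  let ι : ℝ →L[ℝ] C(K, ℝ) := ContinuousLinearMap.toSpanSingleton ℝ (1 : C(K, ℝ))
  let ℓ := integralFunctional μ
  let Q : C(K, ℝ) →L[ℝ] C(K, ℝ) := ι.comp ℓ - (A - (ι.comp ev).comp A)
  let F : C(K, ℝ) → C(K, ℝ) := fun u => (u - ι (ev u)) + Q (G.comp u)
  have hι : ∀ f : C(K, ℝ) →L[ℝ] ℝ, IsCompactOperator (ι.comp f) := fun f =>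
    (isCompactOperator_of_locallyCompactSpace_dom f).clm_comp ι
  have hA : IsCompactOperator A := hk.isCompactOperator_op
  let T : C(K, ℝ) →L[ℝ] C(K, ℝ) := ι.comp ev - Q.comp M
  have hT : IsCompactOperator T := by
    have hQ : IsCompactOperator Q := (hι ℓ).sub (hA.sub (hA.clm_comp (ι.comp ev)))
    exact (hι ev).sub (hQ.comp_clm M)
  have hF : HasStrictFDerivAt F (1 - T) u₀ := by
    have h1 : HasStrictFDerivAt F ((ContinuousLinearMap.id ℝ C(K, ℝ) - ι.comp ev) + Q.comp M) u₀ :=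
      ((hasStrictFDerivAt_id u₀).sub (ι.comp ev).hasStrictFDerivAt).add
        (Q.hasStrictFDerivAt.comp u₀ hN)
    convert h1 using 1
    ext v x
    simp [T]
    ring
  have hFapp : ∀ u x, F u x =
      u x - u o + (∫ y, g (u y) ∂μ) - (A (G.comp u) x - A (G.comp u) o) := by
    intro u x
    simp only [F, Q, ι, ev, ℓ, ContinuousMap.add_apply, ContinuousMap.sub_apply,
      _root_.sub_apply, ContinuousLinearMap.comp_apply,
      ContinuousLinearMap.toSpanSingleton_apply, ContinuousMap.smul_apply, smul_eq_mul,
      ContinuousMap.one_apply, mul_one, integralFunctional_apply, ContinuousMap.evalCLM_apply]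
    have : ∀ y, (G.comp u) y = g (u y) := fun y => rfl
    simp only [this]
    ring
  have hunit : IsUnit (1 - T) := by
    rcases hT.hasEigenvalue_or_mem_resolventSet (one_ne_zero (α := ℝ)) with h | h
    · exfalso
      obtain ⟨v, hv⟩ := h.exists_hasEigenvector
      have hTv : T v = v := by simpa using hv.apply_eq_smul
      have hx : ∀ x, v o - (∫ y, g' (u₀ y) * v y ∂μ) + (A (M v) x - A (M v) o) = v x := by
        intro x
        have := congrArg (fun f : C(K, ℝ) => f x) hTv
        simp only [T, Q, ι, ev, ℓ, ContinuousMap.sub_apply,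
          _root_.sub_apply, ContinuousLinearMap.comp_apply,
          ContinuousLinearMap.toSpanSingleton_apply, ContinuousMap.smul_apply, smul_eq_mul,
          ContinuousMap.one_apply, mul_one, integralFunctional_apply,
          ContinuousMap.evalCLM_apply] at this
        have hM : ∀ y, (M v) y = g' (u₀ y) * v y := fun y => rfl
        simp only [hM] at this
        linarith
      have h0 : ∫ y, g' (u₀ y) * v y ∂μ = 0 := by have := hx o; linarith
      refine hv.2 (hker v (v o - A (M v) o) (fun x => ?_) h0)
      have h1 := hx x
      have h2 : A (M v) x = ∫ y, k x y * (g' (u₀ y) * v y) ∂μ := rfl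
      linarith
    · simpa [spectrum.mem_resolventSet_iff] using h
  obtain ⟨e, he⟩ := hunit
  let Φ : C(K, ℝ) ≃L[ℝ] C(K, ℝ) := ContinuousLinearEquiv.unitsEquiv ℝ _ e
  have hΦ : (Φ : C(K, ℝ) →L[ℝ] C(K, ℝ)) = 1 - T := he
  rw [← hΦ] at hF
  let H := hF.toOpenPartialHomeomorph F
  let p : ℝ → C(K, ℝ) := fun κ => F u₀ + κ ^ 2 • J
  have hp : Continuous p := by fun_prop
  have hp0 : p 0 = F u₀ := by simp [p]
  have hnhds : p ⁻¹' H.target ∈ nhds (0 : ℝ) := by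
    refine hp.continuousAt.preimage_mem_nhds (H.open_target.mem_nhds ?_)
    rw [hp0]
    exact hF.image_mem_toOpenPartialHomeomorph_target
  obtain ⟨δ, hδ, hδs⟩ := Metric.mem_nhds_iff.1 hnhds
  have hmem : ∀ κ : ℝ, |κ| < δ → p κ ∈ H.target := fun κ hκ => hδs (by simpa using hκ)
  refine ⟨δ, hδ, fun κ => H.symm (p κ), ?_, ?_, fun κ hκ => ?_⟩
  · change H.symm (p 0) = u₀
    rw [hp0]
    exact H.left_inv hF.mem_toOpenPartialHomeomorph_source
  · exact H.continuousOn_symm.comp hp.continuousOn fun κ hκ => hmem κ hκ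
  · have hr : F (H.symm (p κ)) = p κ := H.right_inv (hmem κ hκ)
    beta_reduce
    generalize H.symm (p κ) = u at hr
    have hF0 : ∀ x, F u₀ x = ∫ y, g (u₀ y) ∂μ := by
      intro x
      have h1 : ∀ x, u₀ x = A (G.comp u₀) x + c₀ := hu₀
      rw [hFapp, h1 x, h1 o]
      ring
    have hx : ∀ x, u x - u o + (∫ y, g (u y) ∂μ) - (A (G.comp u) x - A (G.comp u) o)
        = (∫ y, g (u₀ y) ∂μ) + κ ^ 2 * J x := by
      intro x
      rw [← hFapp, hr, ← hF0 x]
      rfl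
    have hm : ∫ y, g (u y) ∂μ = ∫ y, g (u₀ y) ∂μ := by
      have := hx o
      rw [hJ] at this
      linarith
    refine ⟨⟨u o - A (G.comp u) o, fun x => ?_⟩, hm⟩
    have h1 := hx x
    have h2 : A (G.comp u) x = ∫ y, k x y * g (u y) ∂μ := rfl
    linarith

end LocalCurve

section Newton

/-- Three-dimensional Euclidean space. -/
abbrev Space : Type := EuclideanSpace ℝ (Fin 3)

lemma lintegral_plane_radial {f : ℝ → ENNReal} (hf : Measurable f) :
    ∫⁻ p : Fin 2 → ℝ, f (p 0 ^ 2 + p 1 ^ 2)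
      = volume (Set.Ioo (-π) π) * ∫⁻ t in Set.Ioi (0 : ℝ), ENNReal.ofReal t * f (t ^ 2) := by
  have h1 : ∫⁻ p : Fin 2 → ℝ, f (p 0 ^ 2 + p 1 ^ 2) = ∫⁻ q : ℝ × ℝ, f (q.1 ^ 2 + q.2 ^ 2) :=
    (volume_preserving_finTwoArrow ℝ).lintegral_comp_emb
      (MeasurableEquiv.measurableEmbedding _) (fun q : ℝ × ℝ => f (q.1 ^ 2 + q.2 ^ 2))
  have hm : Measurable fun q : ℝ × ℝ => ENNReal.ofReal q.1 * f (q.1 ^ 2) := by fun_prop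
  rw [h1, ← lintegral_comp_polarCoord_symm, polarCoord_target]
  have h2 : ∀ q : ℝ × ℝ, ENNReal.ofReal q.1 •
      f ((polarCoord.symm q).1 ^ 2 + (polarCoord.symm q).2 ^ 2) =
      ENNReal.ofReal q.1 * f (q.1 ^ 2) := by
    intro q
    rw [polarCoord_symm_apply, smul_eq_mul]
    congr 2
    linear_combination q.1 ^ 2 * Real.sin_sq_add_cos_sq q.2
  simp_rw [h2]
  rw [Measure.volume_eq_prod, ← Measure.prod_restrict, lintegral_prod _ hm.aemeasurable]
  simp only [lintegral_const, Measure.restrict_apply_univ]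
  rw [lintegral_mul_const _ (by fun_prop), mul_comm]

lemma lintegral_shift_radius {f : ℝ → ENNReal} (z : ℝ) :
    ∫⁻ t in Set.Ioi (0 : ℝ), ENNReal.ofReal t * f (√(t ^ 2 + z ^ 2))
      = ∫⁻ s in Set.Ioi |z|, ENNReal.ofReal s * f s := by
  have himg : (fun t : ℝ => √(t ^ 2 + z ^ 2)) '' Set.Ioi 0 = Set.Ioi |z| := by
    ext s
    simp only [Set.mem_image, Set.mem_Ioi]
    constructor
    · rintro ⟨t, ht, rfl⟩
      rw [← Real.sqrt_sq_eq_abs]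
      exact Real.sqrt_lt_sqrt (sq_nonneg _) (by nlinarith)
    · intro hs
      have hs0 : 0 < s := (abs_nonneg z).trans_lt hs
      have hlt : z ^ 2 < s ^ 2 := by
        rw [← sq_abs z]; exact pow_lt_pow_left₀ hs (abs_nonneg _) two_ne_zero
      refine ⟨√(s ^ 2 - z ^ 2), Real.sqrt_pos.2 (by linarith), ?_⟩
      rw [Real.sq_sqrt (by linarith), sub_add_cancel, Real.sqrt_sq hs0.le]
  rw [← himg, lintegral_image_eq_lintegral_abs_deriv_mul (f' := fun t => t / √(t ^ 2 + z ^ 2))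
    measurableSet_Ioi]
  · refine setLIntegral_congr_fun measurableSet_Ioi fun t ht => ?_
    have ht' : 0 < t := ht
    have hp : 0 < √(t ^ 2 + z ^ 2) := Real.sqrt_pos.2 (by positivity)
    rw [← mul_assoc, ← ENNReal.ofReal_mul (abs_nonneg _), abs_of_pos (by positivity),
      div_mul_cancel₀ _ hp.ne']
  · intro t ht
    have ht' : 0 < t := ht
    have h := (((hasDerivAt_id t).pow 2).add_const (z ^ 2)).sqrt (by simp; positivity)
    refine (h.congr_deriv ?_).hasDerivWithinAt
    simp
    field_simp
  · intro a ha b hb hab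
    have ha' : 0 < a := ha
    have hb' : 0 < b := hb
    have h := (Real.sqrt_inj (by positivity) (by positivity)).1 hab
    exact (sq_eq_sq₀ ha'.le hb'.le).1 (by linarith)

/-- Integration of functions of the radius and of one coordinate on `ℝ³`. -/
lemma lintegral_norm_coord {F : ℝ → ℝ → ENNReal} (hF : Measurable (Function.uncurry F)) :
    ∫⁻ y : Space, F ‖y‖ (y 0) = volume (Set.Ioo (-π) π) *
      ∫⁻ s in Set.Ioi (0 : ℝ), ENNReal.ofReal s * ∫⁻ z in Set.Ioo (-s) s, F s z := by
  have hFm : ∀ z, Measurable fun s => F s z := fun z =>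
    hF.comp (measurable_id.prodMk measurable_const)
  have h1 : ∫⁻ y : Space, F ‖y‖ (y 0) =
      ∫⁻ y : Fin 3 → ℝ, F (√(y 0 ^ 2 + (y 1 ^ 2 + y 2 ^ 2))) (y 0) := by
    rw [← (PiLp.volume_preserving_ofLp (Fin 3)).lintegral_comp_emb
      (MeasurableEquiv.toLp 2 (Fin 3 → ℝ)).symm.measurableEmbedding]
    refine lintegral_congr fun y => ?_
    rw [EuclideanSpace.norm_eq, Fin.sum_univ_three]
    simp [add_assoc]
  have h2 : ∫⁻ y : Fin 3 → ℝ, F (√(y 0 ^ 2 + (y 1 ^ 2 + y 2 ^ 2))) (y 0) =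
      ∫⁻ q : ℝ × (Fin 2 → ℝ), F (√(q.1 ^ 2 + (q.2 0 ^ 2 + q.2 1 ^ 2))) q.1 :=
    (volume_preserving_piFinSuccAbove (fun _ : Fin 3 => ℝ) 0).lintegral_comp_emb
      (MeasurableEquiv.measurableEmbedding _)
      (fun q : ℝ × (Fin 2 → ℝ) => F (√(q.1 ^ 2 + (q.2 0 ^ 2 + q.2 1 ^ 2))) q.1)
  have hm : Measurable fun q : ℝ × (Fin 2 → ℝ) =>
      F (√(q.1 ^ 2 + (q.2 0 ^ 2 + q.2 1 ^ 2))) q.1 :=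
    hF.comp (by fun_prop : Measurable fun q : ℝ × (Fin 2 → ℝ) =>
      (√(q.1 ^ 2 + (q.2 0 ^ 2 + q.2 1 ^ 2)), q.1))
  rw [h1, h2, Measure.volume_eq_prod, lintegral_prod _ hm.aemeasurable]
  have h3 : ∀ z : ℝ, ∫⁻ p : Fin 2 → ℝ, F (√(z ^ 2 + (p 0 ^ 2 + p 1 ^ 2))) z =
      volume (Set.Ioo (-π) π) * ∫⁻ s in Set.Ioi |z|, ENNReal.ofReal s * F s z := by
    intro z
    rw [lintegral_plane_radial (f := fun t => F (√(z ^ 2 + t)) z)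
      ((hFm z).comp (by fun_prop : Measurable fun t : ℝ => √(z ^ 2 + t))),
      ← lintegral_shift_radius (f := fun s => F s z) z]
    simp only [add_comm (z ^ 2)]
  simp_rw [h3]
  have hm2 : Measurable (Function.uncurry fun z s : ℝ =>
      (Set.Ioi |z|).indicator (fun s => ENNReal.ofReal s * F s z) s) := by
    have : (Function.uncurry fun z s : ℝ =>
      (Set.Ioi |z|).indicator (fun s => ENNReal.ofReal s * F s z) s) =
      {q : ℝ × ℝ | |q.1| < q.2}.indicator (fun q => ENNReal.ofReal q.2 * F q.2 q.1) := by
      ext q; simp [Function.uncurry, Set.indicator]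
    rw [this]
    refine Measurable.indicator ?_ (measurableSet_lt (by fun_prop) (by fun_prop))
    exact (by fun_prop : Measurable fun q : ℝ × ℝ => ENNReal.ofReal q.2).mul
      (hF.comp (by fun_prop : Measurable fun q : ℝ × ℝ => (q.2, q.1)))
  simp_rw [← lintegral_indicator measurableSet_Ioi]
  rw [lintegral_const_mul _ hm2.lintegral_prod_right, lintegral_lintegral_swap hm2.aemeasurable]
  congr 1
  refine lintegral_congr fun s => ?_
  by_cases hs : 0 < s
  · have hFs : Measurable fun z => F s z := hF.comp (measurable_const.prodMk measurable_id)
    rw [Set.indicator_of_mem (Set.mem_Ioi.2 hs), ← lintegral_const_mul _ hFs,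
      ← lintegral_indicator measurableSet_Ioo]
    refine lintegral_congr fun z => ?_
    simp only [Set.indicator, Set.mem_Ioi, Set.mem_Ioo, abs_lt]
  · rw [Set.indicator_of_notMem (by simpa using hs)]
    rw [← lintegral_zero (μ := (volume : Measure ℝ))]
    refine lintegral_congr fun z => Set.indicator_of_notMem ?_ _
    simp only [Set.mem_Ioi, not_lt]
    exact (not_lt.1 hs).trans (abs_nonneg z)

end Newton

section NewtonShell

lemma lintegral_shell {r s : ℝ} (hr : 0 ≤ r) (hs : 0 < s) :
    ∫⁻ z in Set.Ioo (-s) s, ENNReal.ofReal (√(r ^ 2 + s ^ 2 - 2 * r * z))⁻¹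
      = ∫⁻ _ in Set.Ioo (-s) s, ENNReal.ofReal (max r s)⁻¹ := by
  have hR : ∫⁻ _ in Set.Ioo (-s) s, ENNReal.ofReal (max r s)⁻¹
      = ENNReal.ofReal (2 * s / max r s) := by
    rw [setLIntegral_const, Real.volume_Ioo, ← ENNReal.ofReal_mul (by positivity)]
    congr 1
    ring
  rcases hr.eq_or_lt with rfl | hr
  · simp [Real.sqrt_sq hs.le, max_eq_right hs.le]
  rw [hR]
  have hpos : ∀ z ∈ Set.Ioo (-s) s, 0 < r ^ 2 + s ^ 2 - 2 * r * z := fun _ hz => by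
    nlinarith [sq_nonneg (r - s), mul_lt_mul_of_pos_left hz.2 hr]
  have hcont : ContinuousOn (fun z => -(√(r ^ 2 + s ^ 2 - 2 * r * z) / r)) (Set.Icc (-s) s) := by
    fun_prop
  have hder : ∀ z ∈ Set.Ioo (-s) s, HasDerivAt (fun z => -(√(r ^ 2 + s ^ 2 - 2 * r * z) / r))
      (√(r ^ 2 + s ^ 2 - 2 * r * z))⁻¹ z := by
    intro z hz
    have hp := hpos z hz
    have h := (((hasDerivAt_id z).const_mul (2 * r)).const_sub (r ^ 2 + s ^ 2)).sqrt hp.ne'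
    refine ((h.div_const r).neg).congr_deriv ?_
    have := (Real.sqrt_pos.2 hp).ne'
    simp only [id]
    field_simp
  have hle : -s ≤ s := by linarith
  have hint := intervalIntegral.integrableOn_deriv_of_nonneg hcont hder
    (fun z _ => inv_nonneg.2 (Real.sqrt_nonneg _))
  have hI := intervalIntegral.integral_eq_sub_of_hasDerivAt_of_le hle hcont hder
    ((intervalIntegrable_iff_integrableOn_Ioc_of_le hle).2 hint)
  rw [intervalIntegral.integral_of_le hle, integral_Ioc_eq_integral_Ioo] at hI
  rw [← ofReal_integral_eq_lintegral_ofReal (hint.mono_set Set.Ioo_subset_Ioc_self)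
    (Filter.Eventually.of_forall fun z => inv_nonneg.2 (Real.sqrt_nonneg _)), hI]
  congr 1
  rw [show r ^ 2 + s ^ 2 - 2 * r * s = (r - s) ^ 2 by ring,
    show r ^ 2 + s ^ 2 - 2 * r * -s = (r + s) ^ 2 by ring, Real.sqrt_sq_eq_abs,
    Real.sqrt_sq (by positivity)]
  rcases le_total r s with h | h
  · rw [abs_of_nonpos (by linarith), max_eq_right h]
    field_simp
    ring
  · rw [abs_of_nonneg (by linarith), max_eq_left h]
    field_simp
    ring

lemma exists_isometry_map_eq {x y : Space} (h : ‖x‖ = ‖y‖) :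
    ∃ A : Space ≃ₗᵢ[ℝ] Space, A x = y :=
  ⟨(Submodule.span ℝ {x - y})ᗮ.reflection, Submodule.reflection_sub h⟩

/-- **Newton's shell theorem** for nonnegative radial densities. -/
theorem lintegral_radial_div_dist {H : ℝ → ENNReal} (hH : Measurable H) (x : Space) :
    ∫⁻ y : Space, H ‖y‖ * ENNReal.ofReal ‖x - y‖⁻¹
      = ∫⁻ y : Space, H ‖y‖ * ENNReal.ofReal (max ‖x‖ ‖y‖)⁻¹ := by
  obtain ⟨A, hA⟩ := exists_isometry_map_eq (x := x) (y := EuclideanSpace.single 0 ‖x‖)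
    (by simp)
  set r := ‖x‖ with hr
  have hr0 : 0 ≤ r := norm_nonneg x
  have h1 : ∫⁻ y : Space, H ‖y‖ * ENNReal.ofReal ‖x - y‖⁻¹ =
      ∫⁻ y : Space, (fun s z => H s * ENNReal.ofReal (√(r ^ 2 + s ^ 2 - 2 * r * z))⁻¹) ‖y‖ (y 0) := by
    rw [← A.measurePreserving.lintegral_comp_emb A.toHomeomorph.measurableEmbedding
      (fun y : Space => (fun s z => H s * ENNReal.ofReal (√(r ^ 2 + s ^ 2 - 2 * r * z))⁻¹)
        ‖y‖ (y 0))]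
    refine lintegral_congr fun y => ?_
    have hn : ‖x - y‖ = √(r ^ 2 + ‖A y‖ ^ 2 - 2 * r * (A y) 0) := by
      rw [← A.norm_map (x - y), map_sub, hA, ← Real.sqrt_sq (norm_nonneg _),
        norm_sub_sq_real]
      congr 1
      simp [EuclideanSpace.inner_single_left]
      ring
    simp only [hn, A.norm_map]
  rw [h1, lintegral_norm_coord
    (F := fun s z => H s * ENNReal.ofReal (√(r ^ 2 + s ^ 2 - 2 * r * z))⁻¹), lintegral_norm_coord
    (F := fun s _ => H s * ENNReal.ofReal (max r s)⁻¹)]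
  · congr 1
    refine setLIntegral_congr_fun measurableSet_Ioi fun s hs => ?_
    rw [lintegral_const_mul _ (by fun_prop), lintegral_const_mul _ (by fun_prop),
      lintegral_shell hr0 hs]
  · fun_prop
  · fun_prop

/-- **Newton's shell theorem** for radial densities. -/
theorem integral_radial_div_dist {h : ℝ → ℝ} (hh : Measurable h) (x : Space) :
    ∫ y : Space, h ‖y‖ / ‖x - y‖ = ∫ y : Space, h ‖y‖ / max ‖x‖ ‖y‖ := by
  have key : ∀ D : Space → ℝ, Measurable D → (∀ y, 0 ≤ D y) →
      ∫ y : Space, h ‖y‖ / D y =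
      ∫ s, h s ∂((volume.withDensity fun y => ENNReal.ofReal (D y)⁻¹).map norm) := by
    intro D hD hD0
    rw [integral_map (by fun_prop) hh.aestronglyMeasurable,
      integral_withDensity_eq_integral_toReal_smul (by fun_prop) (by simp)]
    refine integral_congr_ae (Filter.Eventually.of_forall fun y => ?_)
    simp only [smul_eq_mul]
    rw [ENNReal.toReal_ofReal (inv_nonneg.2 (hD0 y)), div_eq_inv_mul]
  rw [key _ (by fun_prop) (fun y => norm_nonneg _), key (fun y => max ‖x‖ ‖y‖) (by fun_prop)
    (fun y => by positivity)]
  congr 1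
  refine Measure.ext fun S hS => ?_
  rw [← lintegral_indicator_one hS, ← lintegral_indicator_one hS,
    lintegral_map (by fun_prop (disch := assumption)) (by fun_prop),
    lintegral_map (by fun_prop (disch := assumption)) (by fun_prop),
    lintegral_withDensity_eq_lintegral_mul _ (by fun_prop) (by fun_prop (disch := assumption)),
    lintegral_withDensity_eq_lintegral_mul _ (by fun_prop) (by fun_prop (disch := assumption))]
  simp only [Pi.mul_apply, mul_comm (ENNReal.ofReal _)]
  exact lintegral_radial_div_dist (measurable_one.indicator hS) x

end NewtonShell

section Radial

/-- The area of the unit sphere of `ℝ³`. -/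
noncomputable def sphereArea : ℝ := 3 * volume.real (Metric.ball (0 : Space) 1)

lemma sphereArea_pos : 0 < sphereArea := by
  have : 0 < volume.real (Metric.ball (0 : Space) 1) :=
    ENNReal.toReal_pos (Metric.measure_ball_pos _ _ one_pos).ne' measure_ball_lt_top.ne
  unfold sphereArea
  positivity

lemma integral_norm_eq (f : ℝ → ℝ) :
    ∫ y : Space, f ‖y‖ = sphereArea * ∫ s in Set.Ioi (0 : ℝ), s ^ 2 * f s := by
  have h := integral_fun_norm_addHaar (volume : Measure Space) f
  simp only [finrank_euclideanSpace, Fintype.card_fin, smul_eq_mul, nsmul_eq_mul] at h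
  rw [h, sphereArea]
  push_cast
  ring

/-- The nonconstant part of the potential of the radial density `f`, up to the factor
`sphereArea`. -/
noncomputable def shellPot (f : ℝ → ℝ) (r : ℝ) : ℝ :=
  r ^ 2 * ∫ t in (0 : ℝ)..1, f (r * t) * (t ^ 2 - t)

/-- The gravitational force of the radial density `f`, up to the factor `sphereArea`. -/
noncomputable def shellForce (f : ℝ → ℝ) (r : ℝ) : ℝ :=
  r * ∫ t in (0 : ℝ)..1, t ^ 2 * f (r * t)

variable {f : ℝ → ℝ}

lemma continuous_shellPot (hf : Continuous f) : Continuous (shellPot f) := by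
  unfold shellPot
  refine (continuous_pow 2).mul ?_
  exact intervalIntegral.continuous_parametric_intervalIntegral_of_continuous'
    (f := fun r t => f (r * t) * (t ^ 2 - t)) (by fun_prop) 0 1

lemma continuous_shellForce_div (hf : Continuous f) :
    Continuous fun r : ℝ => ∫ t in (0 : ℝ)..1, t ^ 2 * f (r * t) :=
  intervalIntegral.continuous_parametric_intervalIntegral_of_continuous'
    (f := fun r t => t ^ 2 * f (r * t)) (by fun_prop) 0 1

lemma continuous_shellForce (hf : Continuous f) : Continuous (shellForce f) :=
  continuous_id.mul (continuous_shellForce_div hf)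

@[simp] lemma shellPot_zero : shellPot f 0 = 0 := by simp [shellPot]

@[simp] lemma shellForce_zero : shellForce f 0 = 0 := by simp [shellForce]

lemma sq_mul_shellForce (r : ℝ) : r ^ 2 * shellForce f r = ∫ s in (0 : ℝ)..r, s ^ 2 * f s := by
  rcases eq_or_ne r 0 with rfl | hr
  · simp
  have h := intervalIntegral.integral_comp_mul_left (a := 0) (b := 1)
    (fun s => s ^ 2 * f s) hr
  rw [mul_zero, mul_one, smul_eq_mul] at h
  rw [← mul_inv_cancel_left₀ hr (∫ s in (0 : ℝ)..r, s ^ 2 * f s), ← h, shellForce]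
  simp only [mul_pow, mul_assoc]
  rw [intervalIntegral.integral_const_mul]
  ring

lemma shellPot_eq (hf : Continuous f) {r : ℝ} (hr : r ≠ 0) :
    shellPot f r = (∫ s in (0 : ℝ)..r, s ^ 2 * f s) / r - ∫ s in (0 : ℝ)..r, s * f s := by
  have h := intervalIntegral.integral_comp_mul_left (a := 0) (b := 1)
    (fun s => s * f s) hr
  rw [mul_zero, mul_one, smul_eq_mul] at h
  rw [← sq_mul_shellForce, ← mul_inv_cancel_left₀ hr (∫ s in (0 : ℝ)..r, s * f s), ← h, shellForce,
    shellPot]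
  have h2 : ∫ t in (0 : ℝ)..1, f (r * t) * (t ^ 2 - t) =
      (∫ t in (0 : ℝ)..1, t ^ 2 * f (r * t)) - ∫ t in (0 : ℝ)..1, t * f (r * t) := by
    rw [← intervalIntegral.integral_sub (Continuous.intervalIntegrable (by fun_prop) _ _)
      (Continuous.intervalIntegrable (by fun_prop) _ _)]
    congr 1
    ext t
    ring
  simp only [mul_assoc]
  rw [h2, intervalIntegral.integral_const_mul]
  field_simp

lemma hasDerivAt_shellPot (hf : Continuous f) {r : ℝ} (hr : r ≠ 0) :
    HasDerivAt (shellPot f) (-shellForce f r) r := by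
  have h1 : HasDerivAt (fun r => ∫ s in (0 : ℝ)..r, s ^ 2 * f s) (r ^ 2 * f r) r :=
    ((by fun_prop : Continuous fun s => s ^ 2 * f s)).integral_hasStrictDerivAt 0 r |>.hasDerivAt
  have h2 : HasDerivAt (fun r => ∫ s in (0 : ℝ)..r, s * f s) (r * f r) r :=
    ((by fun_prop : Continuous fun s => s * f s)).integral_hasStrictDerivAt 0 r |>.hasDerivAt
  have h3 := (h1.div (hasDerivAt_id r) hr).sub h2
  refine (h3.congr_of_eventuallyEq ?_).congr_deriv ?_
  · filter_upwards [eventually_ne_nhds hr] with z hz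
    exact shellPot_eq hf hz
  · rw [← sq_mul_shellForce]
    simp only [id]
    field_simp
    ring

lemma hasDerivAt_shellForce (hf : Continuous f) {r : ℝ} (hr : r ≠ 0) :
    HasDerivAt (shellForce f) (f r - 2 * shellForce f r / r) r := by
  have h1 : HasDerivAt (fun r => ∫ s in (0 : ℝ)..r, s ^ 2 * f s) (r ^ 2 * f r) r :=
    ((by fun_prop : Continuous fun s => s ^ 2 * f s)).integral_hasStrictDerivAt 0 r |>.hasDerivAt
  have h3 := h1.div ((hasDerivAt_id r).pow 2) (pow_ne_zero 2 hr)
  refine (h3.congr_of_eventuallyEq ?_).congr_deriv ?_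
  · filter_upwards [eventually_ne_nhds hr] with z hz
    simp only [Pi.div_apply, Pi.pow_apply, id, ← sq_mul_shellForce]
    field_simp
  · rw [← sq_mul_shellForce]
    simp only [id, Pi.pow_apply]
    field_simp
    simp
    ring

lemma setIntegral_Ioi_eq {F : ℝ → ℝ} {R : ℝ} (hR : 0 ≤ R) (hF : ∀ s, R < s → F s = 0) :
    ∫ s in Set.Ioi (0 : ℝ), F s = ∫ s in (0 : ℝ)..R, F s := by
  rw [intervalIntegral.integral_of_le hR]
  refine setIntegral_eq_of_subset_of_forall_sdiff_eq_zero measurableSet_Ioi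
    Set.Ioc_subset_Ioi_self fun s hs => hF s ?_
  by_contra hc
  exact hs.2 ⟨hs.1, not_lt.1 hc⟩

lemma integral_norm_eq_interval {R : ℝ} (hR : 0 ≤ R) (hfR : ∀ s, R < s → f s = 0) :
    ∫ y : Space, f ‖y‖ = sphereArea * ∫ s in (0 : ℝ)..R, s ^ 2 * f s := by
  rw [integral_norm_eq, setIntegral_Ioi_eq hR fun s hs => by rw [hfR s hs, mul_zero]]

/-- The Newtonian potential of a radial density. -/
theorem integral_radial_div_dist_eq (hf : Continuous f) {R : ℝ} (hR : 0 ≤ R)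
    (hfR : ∀ s, R < s → f s = 0) (x : Space) :
    ∫ y : Space, f ‖y‖ / ‖x - y‖ =
      sphereArea * ((∫ s in (0 : ℝ)..R, s * f s) + shellPot f ‖x‖) := by
  set r := ‖x‖ with hr
  have hr0 : 0 ≤ r := norm_nonneg x
  rw [integral_radial_div_dist hf.measurable, ← hr,
    integral_norm_eq (fun s => f s / max r s)]
  congr 1
  have hM : R ≤ max R r := le_max_left _ _
  have hM' : r ≤ max R r := le_max_right _ _
  set M := max R r
  rw [setIntegral_Ioi_eq (hR.trans hM)
    fun s hs => by rw [hfR s (hM.trans_lt hs), zero_div, mul_zero]]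
  have e1 : ∫ s in (0 : ℝ)..R, s * f s = ∫ s in (0 : ℝ)..M, s * f s := by
    rw [← setIntegral_Ioi_eq hR fun s hs => by rw [hfR s hs, mul_zero],
      ← setIntegral_Ioi_eq (hR.trans hM) fun s hs => by rw [hfR s (hM.trans_lt hs), mul_zero]]
  have hc : ∀ a b : ℝ, IntervalIntegrable (fun s => s * f s) volume a b := fun a b =>
    Continuous.intervalIntegrable (by fun_prop) _ _
  have hR2 : ∫ s in r..M, s ^ 2 * (f s / max r s) = ∫ s in r..M, s * f s := by
    refine intervalIntegral.integral_congr fun s hs => ?_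
    rw [Set.uIcc_of_le hM'] at hs
    simp only [max_eq_right hs.1]
    rcases eq_or_ne s 0 with rfl | h0
    · simp
    · field_simp
  have hI2 : IntervalIntegrable (fun s => s ^ 2 * (f s / max r s)) volume r M := by
    refine (hc r M).congr ?_
    refine fun s hs => ?_
    rw [Set.uIoc_of_le hM'] at hs
    simp only [max_eq_right hs.1.le]
    have : s ≠ 0 := (hr0.trans_lt hs.1).ne'
    field_simp
  rw [e1, ← intervalIntegral.integral_add_adjacent_intervals (hc 0 r) (hc r M)]
  rcases hr0.eq_or_lt with h0 | hpos
  · rw [← h0] at hR2 ⊢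
    simp [hR2]
  have hI1 : IntervalIntegrable (fun s => s ^ 2 * (f s / max r s)) volume 0 r := by
    refine ContinuousOn.intervalIntegrable (ContinuousOn.mul (by fun_prop)
      (hf.continuousOn.div (by fun_prop) fun s _ => ?_))
    exact (hpos.trans_le (le_max_left _ _)).ne'
  have hR1 : ∫ s in (0 : ℝ)..r, s ^ 2 * (f s / max r s) =
      (∫ s in (0 : ℝ)..r, s ^ 2 * f s) / r := by
    rw [← intervalIntegral.integral_div]
    refine intervalIntegral.integral_congr fun s hs => ?_
    rw [Set.uIcc_of_le hr0] at hs
    simp only [max_eq_left hs.2]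
    ring
  rw [← intervalIntegral.integral_add_adjacent_intervals hI1 hI2, hR1, hR2,
    shellPot_eq hf hpos.ne']
  ring

end Radial

section KernelEstimates

lemma integrable_invSq_indicator (R : ℝ) : Integrable fun z : Space =>
    (Set.Iic (2 * R)).indicator (fun s : ℝ => (s ^ 2)⁻¹) ‖z‖ := by
  rw [integrable_fun_norm_addHaar]
  simp only [finrank_euclideanSpace, Fintype.card_fin, smul_eq_mul]
  have h : IntegrableOn ((Set.Ioc 0 (2 * R)).indicator fun _ : ℝ => (1 : ℝ)) (Set.Ioi 0) :=
    ((integrable_indicator_iff measurableSet_Ioc).2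
      (integrableOn_const measure_Ioc_lt_top.ne)).integrableOn
  refine h.congr_fun (fun s hs => ?_) measurableSet_Ioi
  have hs' : (0 : ℝ) < s := hs
  by_cases h2 : s ≤ 2 * R
  · simp [Set.indicator, hs', h2]
    field_simp
  · simp [Set.indicator, h2]

lemma exists_integral_invSq_le (R : ℝ) : ∃ C : ℝ, 0 ≤ C ∧
    ∀ x ∈ Metric.closedBall (0 : Space) R,
      IntegrableOn (fun y : Space => (‖x - y‖ ^ 2)⁻¹) (Metric.closedBall 0 R) ∧
      ∫ y in Metric.closedBall (0 : Space) R, (‖x - y‖ ^ 2)⁻¹ ≤ C := by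
  have hint := integrable_invSq_indicator R
  have hnn : ∀ z : Space, 0 ≤ (Set.Iic (2 * R)).indicator (fun s : ℝ => (s ^ 2)⁻¹) ‖z‖ :=
    fun z => Set.indicator_nonneg (fun s _ => by positivity) _
  refine ⟨∫ z : Space, (Set.Iic (2 * R)).indicator (fun s : ℝ => (s ^ 2)⁻¹) ‖z‖,
    integral_nonneg hnn, fun x hx => ?_⟩
  have hx' : ‖x‖ ≤ R := by simpa using hx
  have hcongr : Set.EqOn (fun y : Space =>
      (Set.Iic (2 * R)).indicator (fun s : ℝ => (s ^ 2)⁻¹) ‖x - y‖)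
      (fun y : Space => (‖x - y‖ ^ 2)⁻¹) (Metric.closedBall 0 R) := by
    intro y hy
    have hy' : ‖y‖ ≤ R := by simpa using hy
    have : ‖x - y‖ ≤ 2 * R := (norm_sub_le x y).trans (by linarith)
    simp [Set.indicator, this]
  have hint2 := hint.comp_sub_left x
  refine ⟨hint2.integrableOn.congr_fun hcongr Metric.isClosed_closedBall.measurableSet, ?_⟩
  rw [← setIntegral_congr_fun Metric.isClosed_closedBall.measurableSet hcongr]
  refine (setIntegral_le_integral hint2 (Filter.Eventually.of_forall fun y => hnn _)).trans ?_
  exact (integral_sub_left_eq_self (fun z : Space =>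
    (Set.Iic (2 * R)).indicator (fun s : ℝ => (s ^ 2)⁻¹) ‖z‖) volume x).le

lemma inv_le_one_add_inv_sq (a : ℝ) : a⁻¹ ≤ 1 + (a ^ 2)⁻¹ := by
  rw [← inv_pow]
  nlinarith [sq_nonneg (a⁻¹ - 1), sq_nonneg a⁻¹]

lemma integrableOn_invDist {R : ℝ} {x : Space} (hx : x ∈ Metric.closedBall (0 : Space) R) :
    IntegrableOn (fun y : Space => ‖x - y‖⁻¹) (Metric.closedBall 0 R) := by
  obtain ⟨C, -, hC⟩ := exists_integral_invSq_le R
  have h1 : IntegrableOn (fun y : Space => 1 + (‖x - y‖ ^ 2)⁻¹) (Metric.closedBall 0 R) :=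
    (integrableOn_const (measure_closedBall_lt_top.ne)).add (hC x hx).1
  refine h1.mono' (by fun_prop) (Filter.Eventually.of_forall fun y => ?_)
  rw [Real.norm_of_nonneg (by positivity)]
  exact inv_le_one_add_inv_sq _

lemma abs_inv_sub_inv_le {a b d : ℝ} (ha : 0 ≤ a) (hb : 0 ≤ b) (hd : |a - b| ≤ d) :
    |a⁻¹ - b⁻¹| ≤ d * ((a ^ 2)⁻¹ + (b ^ 2)⁻¹) := by
  have hd0 := (abs_nonneg _).trans hd
  have hd' := abs_le.1 hd
  have hpq : |a⁻¹ - b⁻¹| = |a - b| * (a⁻¹ * b⁻¹) ∨ |a⁻¹ - b⁻¹| ≤ d * (a⁻¹ ^ 2 + b⁻¹ ^ 2) := by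
    rcases ha.eq_or_lt with rfl | ha
    · right
      rcases hb.eq_or_lt with rfl | hb
      · simp
      · rw [inv_zero, zero_sub, abs_neg, abs_of_pos (inv_pos.2 hb)]
        calc b⁻¹ = b * b⁻¹ ^ 2 := by field_simp
          _ ≤ d * (0 ^ 2 + b⁻¹ ^ 2) := by
            rw [zero_pow two_ne_zero, zero_add]
            gcongr
            linarith
    · rcases hb.eq_or_lt with rfl | hb
      · right
        rw [inv_zero, sub_zero, abs_of_pos (inv_pos.2 ha)]
        calc a⁻¹ = a * a⁻¹ ^ 2 := by field_simp
          _ ≤ d * (a⁻¹ ^ 2 + 0 ^ 2) := by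
            rw [zero_pow two_ne_zero, add_zero]
            gcongr
            linarith
      · left
        rw [inv_sub_inv ha.ne' hb.ne', abs_div, abs_of_pos (mul_pos ha hb), abs_sub_comm,
          div_eq_mul_inv, mul_inv]
  rw [← inv_pow, ← inv_pow]
  rcases hpq with h | h
  · rw [h]
    have h0 : 0 ≤ a⁻¹ * b⁻¹ := by positivity
    refine mul_le_mul hd ?_ h0 hd0
    nlinarith [sq_nonneg (a⁻¹ - b⁻¹)]
  · exact h

lemma exists_integral_invDist_le (R : ℝ) : ∃ C : ℝ, 0 ≤ C ∧
    (∀ x ∈ Metric.closedBall (0 : Space) R,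
      ∫ y in Metric.closedBall (0 : Space) R, ‖x - y‖⁻¹ ≤ C) ∧
    ∀ x ∈ Metric.closedBall (0 : Space) R, ∀ x' ∈ Metric.closedBall (0 : Space) R,
      ∫ y in Metric.closedBall (0 : Space) R, |‖x - y‖⁻¹ - ‖x' - y‖⁻¹| ≤ C * ‖x - x'‖ := by
  obtain ⟨C, hC0, hC⟩ := exists_integral_invSq_le R
  have hone : IntegrableOn (fun _ : Space => (1 : ℝ)) (Metric.closedBall 0 R) :=
    integrableOn_const measure_closedBall_lt_top.ne
  refine ⟨(∫ y in Metric.closedBall (0 : Space) R, (1 : ℝ)) + 2 * C, ?_, fun x hx => ?_,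
    fun x hx x' hx' => ?_⟩
  · have : 0 ≤ ∫ y in Metric.closedBall (0 : Space) R, (1 : ℝ) := integral_nonneg fun _ => zero_le_one
    positivity
  · calc ∫ y in Metric.closedBall (0 : Space) R, ‖x - y‖⁻¹
        ≤ ∫ y in Metric.closedBall (0 : Space) R, (1 + (‖x - y‖ ^ 2)⁻¹) :=
          integral_mono (integrableOn_invDist hx) (hone.add (hC x hx).1)
            fun y => inv_le_one_add_inv_sq _
      _ = (∫ y in Metric.closedBall (0 : Space) R, (1 : ℝ)) +
          ∫ y in Metric.closedBall (0 : Space) R, (‖x - y‖ ^ 2)⁻¹ :=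
          integral_add hone (hC x hx).1
      _ ≤ _ := by linarith [(hC x hx).2]
  · have h1 : 0 ≤ ∫ y in Metric.closedBall (0 : Space) R, (1 : ℝ) :=
      integral_nonneg fun _ => zero_le_one
    calc ∫ y in Metric.closedBall (0 : Space) R, |‖x - y‖⁻¹ - ‖x' - y‖⁻¹|
        ≤ ∫ y in Metric.closedBall (0 : Space) R,
            ‖x - x'‖ * ((‖x - y‖ ^ 2)⁻¹ + (‖x' - y‖ ^ 2)⁻¹) := by
          refine integral_mono ((integrableOn_invDist hx).sub (integrableOn_invDist hx')).abs
            (((hC x hx).1.add (hC x' hx').1).const_mul _) fun y => ?_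
          refine abs_inv_sub_inv_le (norm_nonneg _) (norm_nonneg _) ?_
          refine (abs_norm_sub_norm_le _ _).trans ?_
          rw [sub_sub_sub_cancel_right]
      _ = ‖x - x'‖ * ((∫ y in Metric.closedBall (0 : Space) R, (‖x - y‖ ^ 2)⁻¹) +
            ∫ y in Metric.closedBall (0 : Space) R, (‖x' - y‖ ^ 2)⁻¹) := by
          rw [integral_const_mul, integral_add (hC x hx).1 (hC x' hx').1]
      _ ≤ ‖x - x'‖ * (C + C) := by
          gcongr
          exacts [(hC x hx).2, (hC x' hx').2]
      _ ≤ _ := by nlinarith [norm_nonneg (x - x')]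

/-- The Newtonian kernel, symmetrised under `y ↦ -y`. -/
noncomputable def evenKernel (x y : Space) : ℝ := (‖x - y‖⁻¹ + ‖x + y‖⁻¹) / 2

lemma lipschitzKernel_evenKernel (R : ℝ) :
    LipschitzKernel
      ((volume : Measure Space).comap (Subtype.val : Metric.closedBall (0 : Space) R → Space))
      fun x y => evenKernel x y := by
  set B := Metric.closedBall (0 : Space) R
  have hB : MeasurableSet B := Metric.isClosed_closedBall.measurableSet
  have hneg : ∀ x : B, -(x : Space) ∈ B := fun x => by
    simpa only [B, mem_closedBall_zero_iff, norm_neg] using x.2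
  have hplus : ∀ x y : Space, ‖x + y‖ = ‖-x - y‖ := fun x y => by
    rw [← norm_neg, neg_add, sub_eq_add_neg]
  obtain ⟨C, hC0, hC1, hC2⟩ := exists_integral_invDist_le R
  have hi : ∀ x : B, IntegrableOn (fun y => ‖(x : Space) - y‖⁻¹) B := fun x =>
    integrableOn_invDist x.2
  have hi' : ∀ x : B, IntegrableOn (fun y => ‖(x : Space) + y‖⁻¹) B := fun x => by
    simp only [hplus]
    exact integrableOn_invDist (hneg x)
  have hK : ∀ x : B, IntegrableOn (fun y => evenKernel x y) B := fun x =>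
    ((hi x).add (hi' x)).div_const 2
  refine ⟨fun x => ?_, ⟨C, hC0, fun x x' => ?_⟩, ⟨C, hC0, fun x => ?_⟩⟩
  · exact ((measurePreserving_subtype_coe hB).integrable_comp_emb
      (MeasurableEmbedding.subtype_coe hB)).2 (hK x)
  · rw [integral_subtype_comap hB (fun y => |evenKernel x y - evenKernel x' y|)]
    have h2 := hC2 x x.2 x' x'.2
    have h3 := hC2 (-x) (hneg x) (-x') (hneg x')
    simp only [← hplus] at h3
    have hd : ‖(x : Space) + -x'‖ = ‖(x : Space) - x'‖ := by
      rw [sub_eq_add_neg]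
    rw [hd] at h3
    calc ∫ y in B, |evenKernel x y - evenKernel x' y|
        ≤ ∫ y in B, (|‖(x : Space) - y‖⁻¹ - ‖(x' : Space) - y‖⁻¹| +
            |‖(x : Space) + y‖⁻¹ - ‖(x' : Space) + y‖⁻¹|) / 2 := by
          refine integral_mono ((hK x).sub (hK x')).abs
            ((((hi x).sub (hi x')).abs.add ((hi' x).sub (hi' x')).abs).div_const 2) fun y => ?_
          simp only [evenKernel]
          rw [← sub_div, abs_div, abs_two, add_sub_add_comm]
          gcongr
          exact abs_add_le _ _
      _ = ((∫ y in B, |‖(x : Space) - y‖⁻¹ - ‖(x' : Space) - y‖⁻¹|) +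
            ∫ y in B, |‖(x : Space) + y‖⁻¹ - ‖(x' : Space) + y‖⁻¹|) / 2 := by
          rw [integral_div]
          congr 1
          exact integral_add ((hi x).sub (hi x')).abs ((hi' x).sub (hi' x')).abs
      _ ≤ C * dist x x' := by
          rw [Subtype.dist_eq, dist_eq_norm]
          linarith
  · rw [integral_subtype_comap hB (fun y => |evenKernel x y|)]
    have h2 := hC1 x x.2
    have h3 := hC1 (-x) (hneg x)
    simp only [← hplus] at h3
    have habs : ∀ y, |evenKernel x y| = (‖(x : Space) - y‖⁻¹ + ‖(x : Space) + y‖⁻¹) / 2 :=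
      fun y => abs_of_nonneg (by unfold evenKernel; positivity)
    simp only [habs]
    rw [integral_div, integral_add (hi x) (hi' x)]
    linarith

end KernelEstimates

section Profile

/-- The truncated power `t ↦ t₊ ^ q`. -/
noncomputable def posPow (q t : ℝ) : ℝ := max t 0 ^ q

lemma posPow_nonneg (q t : ℝ) : 0 ≤ posPow q t := Real.rpow_nonneg (le_max_right _ _) _

lemma posPow_of_nonpos {q t : ℝ} (hq : 0 < q) (ht : t ≤ 0) : posPow q t = 0 := by
  rw [posPow, max_eq_right ht, Real.zero_rpow hq.ne']

lemma posPow_of_nonneg {q t : ℝ} (ht : 0 ≤ t) : posPow q t = t ^ q := by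
  rw [posPow, max_eq_left ht]

lemma posPow_pos {q t : ℝ} (ht : 0 < t) : 0 < posPow q t := by
  rw [posPow_of_nonneg ht.le]
  exact Real.rpow_pos_of_pos ht _

lemma continuous_posPow {q : ℝ} (hq : 0 ≤ q) : Continuous (posPow q) :=
  (continuous_id.max continuous_const).rpow_const fun _ => Or.inr hq

lemma hasDerivAt_posPow {q : ℝ} (hq : 1 < q) (t : ℝ) :
    HasDerivAt (posPow q) (q * posPow (q - 1) t) t := by
  refine hasDerivAt_of_hasDerivAt_of_ne' (g := fun t => q * posPow (q - 1) t) (x := 0)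
    (fun t ht => ?_) (continuous_posPow (by linarith)).continuousAt
    (continuous_const.mul (continuous_posPow (by linarith))).continuousAt t
  rcases ht.lt_or_gt with ht | ht
  · rw [posPow_of_nonpos (by linarith) ht.le, mul_zero]
    refine (hasDerivAt_const t (0 : ℝ)).congr_of_eventuallyEq ?_
    filter_upwards [gt_mem_nhds ht] with s hs
    exact posPow_of_nonpos (by linarith) (le_of_lt hs)
  · rw [posPow_of_nonneg ht.le]
    refine (Real.hasDerivAt_rpow_const (Or.inl ht.ne')).congr_of_eventuallyEq ?_
    filter_upwards [lt_mem_nhds ht] with s hs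
    exact posPow_of_nonneg (le_of_lt hs)

variable {h : ℝ → ℝ}

lemma shellForce_nonneg (hnn : ∀ s, 0 ≤ h s) {r : ℝ} (hr : 0 ≤ r) : 0 ≤ shellForce h r :=
  mul_nonneg hr (intervalIntegral.integral_nonneg zero_le_one fun t _ =>
    mul_nonneg (sq_nonneg t) (hnn _))

lemma shellForce_div_pos (hh : Continuous h) (hnn : ∀ s, 0 ≤ h s) (h0 : 0 < h 0) {r : ℝ}
    (hr : 0 ≤ r) : 0 < ∫ t in (0 : ℝ)..1, t ^ 2 * h (r * t) := by
  obtain ⟨δ, hδ, hδh⟩ := Metric.eventually_nhds_iff.1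
    ((hh.tendsto 0).eventually (lt_mem_nhds h0))
  set c := δ / (δ + 1 + r)
  have hc : 0 < c := by positivity
  have hc1 : c < 1 := by rw [div_lt_one (by positivity)]; linarith
  have hcr : r * c < δ := by
    rw [mul_div_assoc', div_lt_iff₀ (by positivity)]
    nlinarith
  refine intervalIntegral.integral_pos zero_lt_one (by fun_prop) (fun t _ =>
    mul_nonneg (sq_nonneg t) (hnn _)) ⟨c, ⟨hc.le, hc1.le⟩, mul_pos (by positivity) (hδh ?_)⟩
  rw [Real.dist_eq, sub_zero, abs_of_nonneg (by positivity)]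
  exact hcr

/-- A compactly supported radial solution of the Lane–Emden equation is positive exactly on a
ball, and is globally a function of its potential. -/
theorem exists_radius_of_laneEmden {γ : ℝ} (hγ : 1 < γ) (hh : Continuous h) (hnn : ∀ s, 0 ≤ h s)
    {S : ℝ} (hS : ∀ s, S < s → h s = 0) (hne : ∃ s, 0 ≤ s ∧ 0 < h s) {a b : ℝ} (ha : 0 < a)
    (hLE : ∀ s, 0 ≤ s → 0 < h s → h s ^ (γ - 1) = a * shellPot h s + b) :
    ∃ R₀, 0 < R₀ ∧ (∀ s, 0 ≤ s → s < R₀ → 0 < h s) ∧ (∀ s, R₀ ≤ s → h s = 0) ∧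
      (∀ s, R₀ < s → a * shellPot h s + b < 0) ∧
      ∀ s, 0 ≤ s → h s = posPow (1 / (γ - 1)) (a * shellPot h s + b) := by
  set u : ℝ → ℝ := fun s => a * shellPot h s + b with hu
  have huc : Continuous u := by
    have := continuous_shellPot hh
    fun_prop
  have hud : ∀ r, 0 < r → HasDerivAt u (a * -shellForce h r) r := fun r hr =>
    ((hasDerivAt_shellPot hh hr.ne').const_mul a).add_const b
  have hγ' : 0 < γ - 1 := by linarith
  have hanti : AntitoneOn u (Set.Ici 0) := by
    refine antitoneOn_of_deriv_nonpos (convex_Ici 0) huc.continuousOn ?_ ?_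
    · rw [interior_Ici]
      exact fun r hr => (hud r hr).differentiableAt.differentiableWithinAt
    · rw [interior_Ici]
      intro r hr
      rw [(hud r hr).deriv, mul_neg, neg_nonpos]
      exact mul_nonneg ha.le (shellForce_nonneg hnn (le_of_lt hr))
  have hpc : Continuous fun s => h s ^ (γ - 1) := hh.rpow_const fun _ => Or.inr hγ'.le
  have hfree : ∀ t s₁, 0 ≤ t → t < s₁ → h t = 0 → (∀ s, t < s → s ≤ s₁ → 0 < h s) → u t = 0 := by
    intro t s₁ ht hts h0 hp
    have h1 : Filter.Tendsto u (nhdsWithin t (Set.Ioi t)) (nhds (u t)) :=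
      huc.continuousWithinAt
    have h2 : Filter.Tendsto (fun s => h s ^ (γ - 1)) (nhdsWithin t (Set.Ioi t))
      (nhds (h t ^ (γ - 1))) := hpc.continuousWithinAt
    rw [h0, Real.zero_rpow hγ'.ne'] at h2
    refine tendsto_nhds_unique h1 (h2.congr' ?_)
    filter_upwards [Ioc_mem_nhdsGT hts] with s hs
    exact hLE s (ht.trans hs.1.le) (hp s hs.1 hs.2)
  set P : Set ℝ := {s | 0 ≤ s ∧ 0 < h s}
  have hPb : BddAbove P := ⟨S, fun s hs => by
    by_contra hc
    exact hs.2.ne' (hS s (not_le.1 hc))⟩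
  have hPn : P.Nonempty := hne
  have hright : ∀ s ∈ P, ∃ s' ∈ P, s < s' := by
    intro s hs
    have h1 : ∀ᶠ s' in nhdsWithin s (Set.Ioi s), 0 < h s' :=
      (hh.continuousWithinAt (s := Set.Ioi s) (x := s)).eventually (lt_mem_nhds hs.2)
    obtain ⟨s', h3, h4⟩ := (h1.and self_mem_nhdsWithin).exists
    exact ⟨s', ⟨hs.1.trans (le_of_lt h4), h3⟩, h4⟩
  set R₀ := sSup P
  have hlt : ∀ s ∈ P, s < R₀ := fun s hs => by
    obtain ⟨s', hs', h⟩ := hright s hs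
    exact h.trans_le (le_csSup hPb hs')
  have hR₀ : 0 < R₀ := by
    obtain ⟨s, hs⟩ := hPn
    exact hs.1.trans_lt (hlt s hs)
  have hpos : ∀ s, 0 ≤ s → s < R₀ → 0 < h s := by
    intro s₀ hs₀ hsR
    by_contra hc
    have hz : h s₀ = 0 := le_antisymm (not_lt.1 hc) (hnn _)
    obtain ⟨s₁, hs₁, h01⟩ := exists_lt_of_lt_csSup hPn hsR
    set Z : Set ℝ := Set.Icc s₀ s₁ ∩ h ⁻¹' {0}
    have hZc : IsCompact Z := isCompact_Icc.inter_right (isClosed_singleton.preimage hh)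
    have hZn : Z.Nonempty := ⟨s₀, ⟨le_rfl, h01.le⟩, hz⟩
    obtain ⟨ht1, ht2⟩ := hZc.sSup_mem hZn
    set t := sSup Z
    have hts : t < s₁ := lt_of_le_of_ne ht1.2 fun h => hs₁.2.ne' (h ▸ ht2)
    have ht0 : 0 ≤ t := hs₀.trans ht1.1
    have hut := hfree t s₁ ht0 hts ht2 fun s h1 h2 => by
      refine lt_of_le_of_ne (hnn s) fun h3 => ?_
      exact absurd (le_csSup hZc.bddAbove ⟨⟨ht1.1.trans h1.le, h2⟩, h3.symm⟩) (not_le.2 h1)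
    have h1 := hanti ht0 hs₁.1 hts.le
    have h2 : h s₁ ^ (γ - 1) = u s₁ := hLE s₁ hs₁.1 hs₁.2
    have h3 := Real.rpow_pos_of_pos hs₁.2 (γ - 1)
    linarith
  have hzero : ∀ s, R₀ ≤ s → h s = 0 := by
    intro s hs
    by_contra hc
    exact absurd (hlt s ⟨hR₀.le.trans hs, lt_of_le_of_ne (hnn s) (Ne.symm hc)⟩) (not_lt.2 hs)
  have hforce : ∀ r, 0 < r → 0 < shellForce h r := fun r hr =>
    mul_pos hr (shellForce_div_pos hh hnn (hpos 0 le_rfl hR₀) hr.le)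
  have hstrict : StrictAntiOn u (Set.Ici 0) := by
    refine strictAntiOn_of_deriv_neg (convex_Ici 0) huc.continuousOn ?_
    rw [interior_Ici]
    intro r hr
    rw [(hud r hr).deriv, mul_neg, neg_lt_zero]
    exact mul_pos ha (hforce r hr)
  have huR : u R₀ = 0 := by
    have h1 : Filter.Tendsto u (nhdsWithin R₀ (Set.Iio R₀)) (nhds (u R₀)) :=
      huc.continuousWithinAt
    have h2 : Filter.Tendsto (fun s => h s ^ (γ - 1)) (nhdsWithin R₀ (Set.Iio R₀))
      (nhds (h R₀ ^ (γ - 1))) := hpc.continuousWithinAt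
    rw [hzero R₀ le_rfl, Real.zero_rpow hγ'.ne'] at h2
    refine tendsto_nhds_unique h1 (h2.congr' ?_)
    filter_upwards [Ico_mem_nhdsLT hR₀] with s hs
    exact hLE s hs.1 (hpos s hs.1 hs.2)
  refine ⟨R₀, hR₀, hpos, hzero, fun s hs => ?_, fun s hs => ?_⟩
  · rw [← huR]
    exact hstrict hR₀.le (hR₀.le.trans hs.le) hs
  · rcases lt_or_ge s R₀ with h1 | h1
    · have h2 := hpos s hs h1
      rw [← hLE s hs h2, posPow_of_nonneg (Real.rpow_nonneg h2.le _), ← Real.rpow_mul h2.le,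
        mul_one_div_cancel hγ'.ne', Real.rpow_one]
    · rw [hzero s h1, posPow_of_nonpos (by positivity)]
      exact huR ▸ hanti hR₀.le hs h1

end Profile

section RadialKernel

lemma eq_of_hasDerivAt_eq_of_eq_zero {f g f' : ℝ → ℝ} (hf : Continuous f) (hg : Continuous g)
    (h0 : f 0 = g 0) (hf' : ∀ r, 0 < r → HasDerivAt f (f' r) r)
    (hg' : ∀ r, 0 < r → HasDerivAt g (f' r) r) {r : ℝ} (hr : 0 ≤ r) : f r = g r := by
  rcases hr.eq_or_lt with rfl | hr
  · exact h0
  obtain ⟨c, -, hc⟩ := exists_hasDerivAt_eq_slope (f - g) (fun r => f' r - f' r) hr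
    (hf.sub hg).continuousOn (fun x hx => (hf' x hx.1).sub (hg' x hx.1))
  rw [sub_self, eq_comm, div_eq_zero_iff] at hc
  rcases hc with hc | hc
  · simp only [Pi.sub_apply] at hc
    linarith
  · linarith

lemma shellPot_sub_const_mul {f g : ℝ → ℝ} (hf : Continuous f) (hg : Continuous g) (c r : ℝ) :
    shellPot (fun s => f s - c * g s) r = shellPot f r - c * shellPot g r := by
  unfold shellPot
  rw [mul_left_comm, ← mul_sub, ← intervalIntegral.integral_const_mul c,
    ← intervalIntegral.integral_sub (Continuous.intervalIntegrable (by fun_prop) _ _)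
      (Continuous.intervalIntegrable (by fun_prop) _ _)]
  congr 2
  ext t
  ring

lemma abs_shellPot_le {f : ℝ → ℝ} (hf : Continuous f) {r : ℝ} (hr : 0 ≤ r) :
    |shellPot f r| ≤ r * ∫ s in (0 : ℝ)..r, |f s| := by
  rcases hr.eq_or_lt with rfl | hr'
  · simp
  have h := intervalIntegral.integral_comp_mul_left (a := 0) (b := 1) (fun s => |f s|) hr'.ne'
  rw [mul_zero, mul_one, smul_eq_mul] at h
  rw [← mul_inv_cancel_left₀ hr'.ne' (∫ s in (0 : ℝ)..r, |f s|), ← h, shellPot, abs_mul,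
    abs_of_nonneg (sq_nonneg r), sq, mul_assoc]
  refine mul_le_mul_of_nonneg_left (mul_le_mul_of_nonneg_left ?_ hr) hr
  refine (intervalIntegral.abs_integral_le_integral_abs zero_le_one).trans ?_
  refine intervalIntegral.integral_mono_on zero_le_one
    (Continuous.intervalIntegrable (by fun_prop) _ _)
    (Continuous.intervalIntegrable (by fun_prop) _ _) fun t ht => ?_
  rw [abs_mul]
  refine mul_le_of_le_one_right (abs_nonneg _) ?_
  rw [abs_le]
  constructor <;> nlinarith [ht.1, ht.2]

/-- A Volterra equation with the shell kernel has only the trivial solution. -/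
lemma eq_zero_of_eq_shellPot {w V : ℝ → ℝ} (hw : Continuous w) (hV : Continuous V) {a R : ℝ}
    (hVeq : ∀ r ∈ Set.Icc 0 R, V r = a * shellPot (fun s => w s * V s) r) :
    ∀ r ∈ Set.Icc 0 R, V r = 0 := by
  obtain ⟨W, hW⟩ := isCompact_Icc.exists_bound_of_continuousOn (s := Set.Icc 0 R) hw.continuousOn
  set I : ℝ → ℝ := fun r => ∫ s in (0 : ℝ)..r, |w s * V s| with hI
  have hId : ∀ r, HasDerivAt I |w r * V r| r := fun r =>
    ((by fun_prop : Continuous fun s => |w s * V s|)).integral_hasStrictDerivAt 0 r |>.hasDerivAt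
  have hI0 : ∀ r, 0 ≤ r → 0 ≤ I r := fun r hr =>
    intervalIntegral.integral_nonneg hr fun s _ => abs_nonneg _
  have hVI : ∀ r ∈ Set.Icc 0 R, |V r| ≤ |a| * (R * I r) := by
    intro r hr
    rw [hVeq r hr, abs_mul]
    have h1 := abs_shellPot_le (f := fun s => w s * V s) (by fun_prop) hr.1
    refine mul_le_mul_of_nonneg_left (h1.trans ?_) (abs_nonneg a)
    exact mul_le_mul_of_nonneg_right hr.2 (hI0 r hr.1)
  have hIz : ∀ r ∈ Set.Icc 0 R, I r = 0 := by
    refine eq_zero_of_abs_deriv_le_mul_abs_self_of_eq_zero_right (K := W * (|a| * R))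
      (fun r _ => (hId r).continuousAt.continuousWithinAt)
      (fun r _ => (hId r).hasDerivWithinAt) (by simp [hI])
      fun r hr => ?_
    have hr' := Set.Ico_subset_Icc_self hr
    have h1 := hVI r hr'
    have h2 := hW r hr'
    rw [Real.norm_eq_abs] at h2
    rw [Real.norm_eq_abs, Real.norm_eq_abs, abs_abs, abs_mul, abs_of_nonneg (hI0 r hr.1)]
    calc |w r| * |V r| ≤ W * (|a| * (R * I r)) :=
          mul_le_mul h2 h1 (abs_nonneg _) ((abs_nonneg _).trans h2)
      _ = W * (|a| * R) * I r := by ring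
  intro r hr
  have := hVI r hr
  rw [hIz r hr, mul_zero, mul_zero] at this
  exact abs_nonpos_iff.1 this

/-- The radial part of the linearised Lane–Emden equation with mass constraint has trivial
kernel. -/
theorem radial_kernel_trivial {q : ℝ} (hq : 1 < q) (hq3 : q ≠ 3) {h : ℝ → ℝ} (hh : Continuous h)
    (hnn : ∀ s, 0 ≤ h s) {a b : ℝ} (hb : 0 < b)
    (hhu : ∀ s, 0 ≤ s → h s = posPow q (a * shellPot h s + b)) {R : ℝ} (hR : 0 < R)
    (hhR : h R = 0) {η : ℝ → ℝ} (hηc : Continuous η)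
    (hη : ∀ r ∈ Set.Icc 0 R, η r = η 0 + a * shellPot
      (fun s => q * posPow (q - 1) (a * shellPot h s + b) * η s) r)
    (hmass : ∫ s in (0 : ℝ)..R, s ^ 2 *
      (q * posPow (q - 1) (a * shellPot h s + b) * η s) = 0) :
    ∀ r ∈ Set.Icc 0 R, η r = 0 := by
  have hSc := continuous_shellPot hh
  have hFc := continuous_shellForce hh
  have hpc : Continuous (posPow (q - 1)) := continuous_posPow (by linarith)
  set u : ℝ → ℝ := fun s => a * shellPot h s + b with hu
  have huc : Continuous u := by fun_prop
  set w : ℝ → ℝ := fun s => q * posPow (q - 1) (u s) with hw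
  have hwc : Continuous w := by fun_prop
  have hud : ∀ r, 0 < r → HasDerivAt u (a * -shellForce h r) r := fun r hr =>
    ((hasDerivAt_shellPot hh hr.ne').const_mul a).add_const b
  have hhd : ∀ r, 0 < r → HasDerivAt h (w r * (a * -shellForce h r)) r := by
    intro r hr
    refine ((hasDerivAt_posPow hq (u r)).comp r (hud r hr)).congr_of_eventuallyEq ?_
    filter_upwards [lt_mem_nhds hr] with s hs
    exact hhu s (le_of_lt hs)
  have hwu : ∀ r, 0 ≤ r → w r * u r = q * h r := by
    intro r hr
    rw [hhu r hr, hw]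
    simp only [mul_assoc]
    congr 1
    rcases le_or_gt (u r) 0 with h1 | h1
    · rw [posPow_of_nonpos (by linarith) h1, posPow_of_nonpos (by linarith) h1, zero_mul]
    · rw [posPow_of_nonneg h1.le, posPow_of_nonneg h1.le]
      nth_rewrite 2 [← Real.rpow_one (u r)]
      rw [← Real.rpow_add h1, sub_add_cancel]
  set ψ : ℝ → ℝ := fun r => u r - (q - 1) / 2 * (r * (a * shellForce h r)) with hψ
  have hψc : Continuous ψ := by fun_prop
  have hψ0 : ψ 0 = b := by simp [hψ, hu]
  have hmassψ : ∀ r, 0 ≤ r → ∫ s in (0 : ℝ)..r, s ^ 2 * (w s * ψ s) =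
      (q - 1) / 2 * (r ^ 3 * h r) + (3 - q) / 2 * (r ^ 2 * shellForce h r) := by
    intro r hr
    refine eq_of_hasDerivAt_eq_of_eq_zero
      (f := fun r => ∫ s in (0 : ℝ)..r, s ^ 2 * (w s * ψ s))
      (g := fun r => (q - 1) / 2 * (r ^ 3 * h r) + (3 - q) / 2 * (r ^ 2 * shellForce h r))
      (f' := fun r => r ^ 2 * (w r * ψ r)) ?_ (by fun_prop) (by simp)
      (fun r _ => ((by fun_prop : Continuous fun s => s ^ 2 * (w s * ψ s))).integral_hasStrictDerivAt
        0 r |>.hasDerivAt) (fun r hr => ?_) hr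
    · exact intervalIntegral.continuous_primitive
        (fun a b => Continuous.intervalIntegrable (by fun_prop) _ _) 0
    · have h1 := (((hasDerivAt_id r).pow 3).mul (hhd r hr)).const_mul ((q - 1) / 2)
      have h2 := (((hasDerivAt_id r).pow 2).mul (hasDerivAt_shellForce hh hr.ne')).const_mul
        ((3 - q) / 2)
      refine (h1.add h2).congr_deriv ?_
      have h3 := hwu r hr.le
      simp only [hψ, id, Pi.pow_apply]
      rw [mul_sub (w r), h3]
      push_cast
      field_simp
      ring
  have hψeq : ∀ r, 0 ≤ r → ψ r = ψ 0 + a * shellPot (fun s => w s * ψ s) r := by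
    intro r hr
    have hwψ : Continuous fun s => w s * ψ s := by fun_prop
    have hc := continuous_shellPot hwψ
    refine eq_of_hasDerivAt_eq_of_eq_zero (f := ψ)
      (g := fun r => ψ 0 + a * shellPot (fun s => w s * ψ s) r)
      (f' := fun r => a * -shellForce (fun s => w s * ψ s) r) hψc (by fun_prop) (by simp)
      (fun r hr => ?_)
      (fun r hr => ((hasDerivAt_shellPot hwψ hr.ne').const_mul a).const_add _) hr
    have h1 := (hud r hr).sub
      (((hasDerivAt_id r).mul ((hasDerivAt_shellForce hh hr.ne').const_mul a)).const_mul
        ((q - 1) / 2))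
    refine h1.congr_deriv ?_
    have h2 := hmassψ r hr.le
    rw [← sq_mul_shellForce (f := fun s => w s * ψ s)] at h2
    have h3 : shellForce (fun s => w s * ψ s) r =
        (q - 1) / 2 * (r * h r) + (3 - q) / 2 * shellForce h r := by
      have : r ^ 2 ≠ 0 := by positivity
      refine mul_left_cancel₀ this ?_
      rw [h2]
      ring
    rw [h3]
    simp only [id]
    field_simp
    ring
  set c := η 0 / b with hc
  have hV := eq_zero_of_eq_shellPot (w := w) (V := fun r => η r - c * ψ r) hwc (by fun_prop)
    (a := a) (R := R) fun r hr => by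
      have h1 := shellPot_sub_const_mul (f := fun s => w s * η s) (g := fun s => w s * ψ s)
        (by fun_prop) (by fun_prop) c r
      have h2 : (fun s => w s * (η s - c * ψ s)) = fun s => w s * η s - c * (w s * ψ s) := by
        ext s; ring
      simp only [h2]
      rw [h1, hη r hr, hψeq r hr.1, hψ0, hc]
      field_simp
      ring
  have hηψ : ∀ r ∈ Set.Icc 0 R, η r = c * ψ r := fun r hr => sub_eq_zero.1 (hV r hr)
  have hmass2 : c * ((3 - q) / 2 * (R ^ 2 * shellForce h R)) = 0 := by
    have h1 := hmassψ R hR.le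
    rw [hhR, mul_zero, mul_zero, zero_add] at h1
    rw [← h1, ← intervalIntegral.integral_const_mul]
    refine Eq.trans ?_ hmass
    refine intervalIntegral.integral_congr (μ := volume) fun s hs => ?_
    rw [Set.uIcc_of_le hR.le] at hs
    change c * (s ^ 2 * (w s * ψ s)) = s ^ 2 * (w s * η s)
    rw [hηψ s hs]
    ring
  have h0 : 0 < h 0 := by
    rw [hhu 0 le_rfl, shellPot_zero, mul_zero, zero_add]
    exact posPow_pos hb
  have hF : 0 < shellForce h R := mul_pos hR (shellForce_div_pos hh hnn h0 hR.le)
  have hc0 : c = 0 := by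
    rcases mul_eq_zero.1 hmass2 with h1 | h1
    · exact h1
    · exfalso
      have h3 : (3 - q) / 2 ≠ 0 := by
        rw [Ne, div_eq_zero_iff, not_or]
        exact ⟨fun h => hq3 (by linarith), two_ne_zero⟩
      exact (mul_ne_zero h3 (by positivity)) h1
  intro r hr
  rw [hηψ r hr, hc0, zero_mul]

end RadialKernel

section NonradialKernel

lemma norm_add_eq_norm_neg_sub (x y : Space) : ‖x + y‖ = ‖-x - y‖ := by
  rw [← norm_neg, neg_add, sub_eq_add_neg]

lemma integrable_invDist_mul {f : Space → ℝ} (hf : Continuous f) (hfc : HasCompactSupport f)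
    (x : Space) : Integrable fun y => ‖x - y‖⁻¹ * f y := by
  suffices LocallyIntegrable (fun y => ‖x - y‖⁻¹) from
    this.integrable_smul_right_of_hasCompactSupport hf hfc
  rw [locallyIntegrable_iff]
  intro k hk
  obtain ⟨S, hS⟩ := hk.isBounded.subset_closedBall 0
  refine (integrableOn_invDist (R := max S ‖x‖) ?_).mono_set
    (hS.trans (Metric.closedBall_subset_closedBall (le_max_left _ _)))
  simp

lemma integrable_evenKernel_mul {f : Space → ℝ} (hf : Continuous f) (hfc : HasCompactSupport f)
    (x : Space) : Integrable fun y => evenKernel x y * f y := by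
  refine (((integrable_invDist_mul hf hfc x).add
    (integrable_invDist_mul hf hfc (-x))).div_const 2).congr
    (Filter.Eventually.of_forall fun y => ?_)
  simp only [evenKernel, norm_add_eq_norm_neg_sub, Pi.add_apply]
  ring

lemma integral_evenKernel_mul {f : Space → ℝ} (hf : Continuous f) (hfc : HasCompactSupport f)
    (heven : ∀ y, f (-y) = f y) (x : Space) :
    ∫ y, evenKernel x y * f y = ∫ y, f y / ‖x - y‖ := by
  have h1 : ∫ y, ‖-x - y‖⁻¹ * f y = ∫ y, ‖x - y‖⁻¹ * f y := by
    rw [← integral_neg_eq_self]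
    refine integral_congr_ae (Filter.Eventually.of_forall fun y => ?_)
    simp only [heven]
    rw [← norm_neg, neg_sub, neg_sub_neg]
  have h2 : ∀ y, evenKernel x y * f y = (‖x - y‖⁻¹ * f y + ‖-x - y‖⁻¹ * f y) / 2 := fun y => by
    simp only [evenKernel, norm_add_eq_norm_neg_sub]
    ring
  simp_rw [h2]
  rw [integral_div, integral_add (integrable_invDist_mul hf hfc x)
    (integrable_invDist_mul hf hfc (-x)), h1]
  simp only [div_eq_inv_mul]
  ring

lemma inv_sqrt_le_inv_add_inv {a b m : ℝ} (ha : 0 < a) (hb : 0 < b)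
    (h : a ^ 2 + b ^ 2 = 2 * m) : (√m)⁻¹ ≤ (a⁻¹ + b⁻¹) / 2 := by
  have hm : 0 < m := by nlinarith [sq_pos_of_pos ha, sq_pos_of_pos hb]
  have h1 : 2 * (a * b) / (a + b) ≤ √m := by
    rw [div_le_iff₀ (by positivity)]
    have h2 : a * b ≤ √m ^ 2 := by
      rw [Real.sq_sqrt hm.le]
      nlinarith [sq_nonneg (a - b)]
    have h3 : 0 < √m := Real.sqrt_pos.2 hm
    have h4 : √(a * b) ≤ √m := Real.sqrt_le_sqrt (by nlinarith [sq_nonneg (a - b)])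
    have h5 : √(a * b) * √(a * b) = a * b := Real.mul_self_sqrt (by positivity)
    have h6 : 2 * √(a * b) ≤ a + b := by
      nlinarith [sq_nonneg (a - b), Real.sqrt_nonneg (a * b), mul_pos ha hb]
    nlinarith [Real.sqrt_nonneg (a * b)]
  calc (√m)⁻¹ ≤ (2 * (a * b) / (a + b))⁻¹ := inv_anti₀ (by positivity) h1
    _ = (a⁻¹ + b⁻¹) / 2 := by
      field_simp
      ring

lemma evenKernel_sub_nonneg {x y : Space} (h1 : y ≠ x) (h2 : y ≠ -x) :
    0 ≤ evenKernel x y - (√(‖x‖ ^ 2 + ‖y‖ ^ 2))⁻¹ := by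
  rw [sub_nonneg, evenKernel]
  refine inv_sqrt_le_inv_add_inv (norm_pos_iff.2 (sub_ne_zero.2 h1.symm))
    (norm_pos_iff.2 fun h => h2 (eq_neg_of_add_eq_zero_right h)) ?_
  have := parallelogram_law_with_norm ℝ x y
  linarith

lemma inv_sub_inv_sqrt_le {m M : ℝ} (hm : 0 ≤ m) (hmM : m ≤ M) (hM : 0 < M) :
    M⁻¹ - (√(M ^ 2 + m ^ 2))⁻¹ ≤ 3 / 10 * (m / M ^ 2) := by
  have h1 : 0 < M - 3 / 10 * m := by linarith
  have h2 : √(M ^ 2 + m ^ 2) ≤ M ^ 2 / (M - 3 / 10 * m) := by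
    rw [Real.sqrt_le_left (by positivity), div_pow, le_div_iff₀ (by positivity)]
    have h3 : 0 ≤ m * (M - m) * (3 * (M - m) ^ 2 + 2 * M * m) := by
      have := sub_nonneg.2 hmM
      positivity
    have h4 := mul_nonneg hm (pow_nonneg (sub_nonneg.2 hmM) 3)
    have h5 : 0 ≤ m ^ 2 * (M - m) ^ 2 := by positivity
    have h6 : 0 ≤ m ^ 3 * (M - m) := mul_nonneg (by positivity) (sub_nonneg.2 hmM)
    have h7 : 0 ≤ m ^ 4 := by positivity
    nlinarith
  have h3 : (M ^ 2 / (M - 3 / 10 * m))⁻¹ ≤ (√(M ^ 2 + m ^ 2))⁻¹ :=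
    inv_anti₀ (Real.sqrt_pos.2 (by positivity)) h2
  have h4 : (M ^ 2 / (M - 3 / 10 * m))⁻¹ = M⁻¹ - 3 / 10 * (m / M ^ 2) := by
    field_simp
  linarith

lemma max_inv_sub_inv_sqrt_le {r s : ℝ} (hr : 0 < r) (hs : 0 ≤ s) :
    (max r s)⁻¹ - (√(r ^ 2 + s ^ 2))⁻¹ ≤ 3 / 10 * (min r s / max r s ^ 2) := by
  rcases le_total s r with h | h
  · rw [max_eq_left h, min_eq_right h]
    exact inv_sub_inv_sqrt_le hs h hr
  · rw [max_eq_right h, min_eq_left h, add_comm]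
    exact inv_sub_inv_sqrt_le hr.le h (hr.trans_le h)

variable {h w : ℝ → ℝ} {R : ℝ}

lemma shellForce_moment_identity (hh : Continuous h) (hw : Continuous w)
    (hhd : ∀ r, 0 < r → HasDerivAt h (-(w r * (sphereArea * shellForce h r))) r)
    (hhR : h R = 0) {r : ℝ} (hr : 0 < r) (hrR : r ≤ R) :
    sphereArea * ((∫ s in (0 : ℝ)..r, s ^ 3 * (w s * shellForce h s)) / r ^ 2 +
      r * ∫ s in r..R, w s * shellForce h s) = 3 * shellForce h r := by
  have hFc := continuous_shellForce hh
  have h1 : sphereArea * ∫ s in (0 : ℝ)..r, s ^ 3 * (w s * shellForce h s) =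
      3 * (r ^ 2 * shellForce h r) - r ^ 3 * h r := by
    rw [← intervalIntegral.integral_const_mul]
    refine eq_of_hasDerivAt_eq_of_eq_zero
      (f := fun r => ∫ s in (0 : ℝ)..r, sphereArea * (s ^ 3 * (w s * shellForce h s)))
      (g := fun r => 3 * (r ^ 2 * shellForce h r) - r ^ 3 * h r)
      (f' := fun r => sphereArea * (r ^ 3 * (w r * shellForce h r))) ?_ (by fun_prop) (by simp)
      (fun r _ => ((by fun_prop : Continuous fun s => sphereArea *
        (s ^ 3 * (w s * shellForce h s)))).integral_hasStrictDerivAt 0 r |>.hasDerivAt)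
      (fun r hr => ?_) hr.le
    · exact intervalIntegral.continuous_primitive
        (fun a b => Continuous.intervalIntegrable (by fun_prop) _ _) 0
    · have h1 := ((hasDerivAt_id r).pow 3).mul (hhd r hr)
      have h2 := (((hasDerivAt_id r).pow 2).mul (hasDerivAt_shellForce hh hr.ne')).const_mul 3
      refine (h2.sub h1).congr_deriv ?_
      simp only [id, Pi.pow_apply]
      push_cast
      field_simp
      ring
  have h2 : sphereArea * ∫ s in r..R, w s * shellForce h s = h r := by
    have h3 := intervalIntegral.integral_eq_sub_of_hasDerivAt (a := r) (b := R) (f := h)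
      (f' := fun r => -(w r * (sphereArea * shellForce h r))) (fun s hs => hhd s ?_)
      (Continuous.intervalIntegrable (by fun_prop) _ _)
    · rw [hhR, zero_sub, intervalIntegral.integral_neg, neg_inj] at h3
      rw [← h3, ← intervalIntegral.integral_const_mul]
      congr 1
      ext s
      ring
    · rw [Set.uIcc_of_le hrR] at hs
      exact hr.trans_le hs.1
  calc _ = (sphereArea * ∫ s in (0 : ℝ)..r, s ^ 3 * (w s * shellForce h s)) / r ^ 2 +
        r * (sphereArea * ∫ s in r..R, w s * shellForce h s) := by ring
    _ = 3 * shellForce h r := by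
      rw [h1, h2]
      field_simp
      ring

lemma hasCompactSupport_of_norm {f : Space → ℝ} (hf : ∀ y, R ≤ ‖y‖ → f y = 0) :
    HasCompactSupport f :=
  HasCompactSupport.intro (isCompact_closedBall (0 : Space) R) fun y hy =>
    hf y (not_le.1 (by simpa using hy)).le

lemma integral_evenKernel_sub_mul_le (hh : Continuous h) (hnn : ∀ s, 0 ≤ h s) (hw : Continuous w)
    (hw0 : ∀ s, 0 ≤ w s) (hwR : ∀ s, R ≤ s → w s = 0)
    (hhd : ∀ r, 0 < r → HasDerivAt h (-(w r * (sphereArea * shellForce h r))) r)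
    (hhR : h R = 0) {x : Space} (hx : 0 < ‖x‖) (hxR : ‖x‖ ≤ R) :
    ∫ y, (evenKernel x y - (√(‖x‖ ^ 2 + ‖y‖ ^ 2))⁻¹) * (w ‖y‖ * shellForce h ‖y‖) ≤
      9 / 10 * shellForce h ‖x‖ := by
  have hFc := continuous_shellForce hh
  set r := ‖x‖ with hr
  set f : ℝ → ℝ := fun s => w s * shellForce h s with hf
  have hfc : Continuous f := by fun_prop
  have hfR : ∀ s, R ≤ s → f s = 0 := fun s hs => by simp [hf, hwR s hs]
  have hf0 : ∀ s, 0 ≤ s → 0 ≤ f s := fun s hs => mul_nonneg (hw0 s) (shellForce_nonneg hnn hs)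
  have hsupp : ∀ D : Space → ℝ, HasCompactSupport fun y => D y * f ‖y‖ := fun D =>
    hasCompactSupport_of_norm (R := R) fun y hy => by rw [hfR _ hy, mul_zero]
  have hfs : HasCompactSupport fun y : Space => f ‖y‖ :=
    hasCompactSupport_of_norm (R := R) fun y hy => hfR _ hy
  have hmax : ∀ y : Space, max r ‖y‖ ≠ 0 := fun y => (hx.trans_le (le_max_left _ _)).ne'
  have hc1 : Continuous fun y : Space => (√(r ^ 2 + ‖y‖ ^ 2))⁻¹ :=
    Continuous.inv₀ (by fun_prop) fun y => (Real.sqrt_pos.2 (by positivity)).ne'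
  have hc2 : Continuous fun y : Space => (max r ‖y‖)⁻¹ :=
    Continuous.inv₀ (by fun_prop) hmax
  have hc3 : Continuous fun y : Space => min r ‖y‖ / max r ‖y‖ ^ 2 :=
    Continuous.div (by fun_prop) (by fun_prop) fun y => pow_ne_zero 2 (hmax y)
  have hi1 : Integrable fun y : Space => (√(r ^ 2 + ‖y‖ ^ 2))⁻¹ * f ‖y‖ :=
    (hc1.mul (by fun_prop)).integrable_of_hasCompactSupport (hsupp _)
  have hi2 : Integrable fun y : Space => (max r ‖y‖)⁻¹ * f ‖y‖ :=
    (hc2.mul (by fun_prop)).integrable_of_hasCompactSupport (hsupp _)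
  have hi3 : Integrable fun y : Space => min r ‖y‖ / max r ‖y‖ ^ 2 * f ‖y‖ :=
    (hc3.mul (by fun_prop)).integrable_of_hasCompactSupport (hsupp _)
  have hR : 0 ≤ R := hx.le.trans hxR
  calc ∫ y, (evenKernel x y - (√(r ^ 2 + ‖y‖ ^ 2))⁻¹) * f ‖y‖
      = (∫ y, evenKernel x y * f ‖y‖) - ∫ y : Space, (√(r ^ 2 + ‖y‖ ^ 2))⁻¹ * f ‖y‖ := by
        rw [← integral_sub (integrable_evenKernel_mul (by fun_prop) hfs x) hi1]
        simp only [sub_mul]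
    _ = (∫ y : Space, (max r ‖y‖)⁻¹ * f ‖y‖) - ∫ y : Space, (√(r ^ 2 + ‖y‖ ^ 2))⁻¹ * f ‖y‖ := by
        rw [integral_evenKernel_mul (by fun_prop) hfs (by simp),
          integral_radial_div_dist hfc.measurable]
        simp only [div_eq_inv_mul, ← hr]
    _ ≤ 3 / 10 * ∫ y : Space, min r ‖y‖ / max r ‖y‖ ^ 2 * f ‖y‖ := by
        rw [← integral_sub hi2 hi1, ← integral_const_mul]
        refine integral_mono (hi2.sub hi1) (hi3.const_mul _) fun y => ?_
        simp only
        rw [← sub_mul, ← mul_assoc (3 / 10 : ℝ)]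
        exact mul_le_mul_of_nonneg_right (max_inv_sub_inv_sqrt_le hx (norm_nonneg y))
          (hf0 _ (norm_nonneg y))
    _ = 3 / 10 * (sphereArea * ((∫ s in (0 : ℝ)..r, s ^ 3 * (w s * shellForce h s)) / r ^ 2 +
          r * ∫ s in r..R, w s * shellForce h s)) := by
        congr 1
        rw [integral_norm_eq_interval (f := fun s => min r s / max r s ^ 2 * f s) hR
          fun s hs => by rw [hfR s hs.le, mul_zero]]
        congr 1
        have hcs : Continuous fun s : ℝ => s ^ 2 * (min r s / max r s ^ 2 * f s) :=
          (continuous_pow 2).mul ((Continuous.div (by fun_prop) (by fun_prop)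
            fun s => pow_ne_zero 2 (hx.trans_le (le_max_left _ _)).ne').mul hfc)
        rw [← intervalIntegral.integral_add_adjacent_intervals (b := r)
          (hcs.intervalIntegrable _ _) (hcs.intervalIntegrable _ _)]
        congr 1
        · rw [← intervalIntegral.integral_div]
          refine intervalIntegral.integral_congr fun s hs => ?_
          rw [Set.uIcc_of_le hx.le] at hs
          simp only [max_eq_left hs.2, min_eq_right hs.2, hf]
          field_simp
        · rw [← intervalIntegral.integral_const_mul]
          refine intervalIntegral.integral_congr fun s hs => ?_
          rw [Set.uIcc_of_le hxR] at hs
          have : 0 < s := hx.trans_le hs.1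
          simp only [max_eq_right hs.1, min_eq_left hs.1, hf]
          field_simp
    _ = 9 / 10 * shellForce h r := by
        rw [shellForce_moment_identity hh hw hhd hhR hx hxR]
        ring

/-- Solutions of the linearised equation are invariant under isometries. -/
theorem linearized_isometry_invariant (hh : Continuous h) (hnn : ∀ s, 0 ≤ h s) (h0 : 0 < h 0)
    (hw : Continuous w) (hw0 : ∀ s, 0 ≤ w s) (hwR : ∀ s, R ≤ s → w s = 0) (hR : 0 ≤ R)
    (hhd : ∀ r, 0 < r → HasDerivAt h (-(w r * (sphereArea * shellForce h r))) r)
    (hhR : h R = 0) {v : Space → ℝ} (hvc : Continuous v) {d : ℝ}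
    (hv : ∀ x, ‖x‖ ≤ R → v x = (∫ y, evenKernel x y * (w ‖y‖ * v y)) + d) {L : ℝ} (hL : 0 ≤ L)
    (hLip : ∀ x, ‖x‖ ≤ R → |v x - v 0| ≤ L * ‖x‖) (A : Space ≃ₗᵢ[ℝ] Space) {x : Space}
    (hx : ‖x‖ ≤ R) : v (A x) = v x := by
  have hFc := continuous_shellForce hh
  set D : Space → ℝ := fun y => v y - v (A y) with hD
  have hDc : Continuous D := by fun_prop
  have hsupp : ∀ g : Space → ℝ, HasCompactSupport fun y => w ‖y‖ * g y := fun g =>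
    hasCompactSupport_of_norm (R := R) fun y hy => by rw [hwR _ hy, zero_mul]
  have hkernel : ∀ x y, evenKernel (A x) (A y) = evenKernel x y := fun x y => by
    simp only [evenKernel, ← map_sub, ← map_add, A.norm_map]
  have hrep : ∀ x, 0 < ‖x‖ → ‖x‖ ≤ R →
      D x = ∫ y, (evenKernel x y - (√(‖x‖ ^ 2 + ‖y‖ ^ 2))⁻¹) * (w ‖y‖ * D y) ∧
      ∀ g : Space → ℝ, Continuous g →
        Integrable fun y => (evenKernel x y - (√(‖x‖ ^ 2 + ‖y‖ ^ 2))⁻¹) * (w ‖y‖ * g y) := by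
    intro x hx0 hx
    set c : Space → ℝ := fun y => (√(‖x‖ ^ 2 + ‖y‖ ^ 2))⁻¹ with hc
    have hcc : Continuous c :=
      Continuous.inv₀ (by fun_prop) fun y => (Real.sqrt_pos.2 (by positivity)).ne'
    have hcA : ∀ y, c (A y) = c y := fun y => by simp only [hc, A.norm_map]
    have hi : ∀ g : Space → ℝ, Continuous g → Integrable fun y => evenKernel x y * (w ‖y‖ * g y) :=
      fun g hg => integrable_evenKernel_mul (by fun_prop) (hsupp g) x
    have hi' : ∀ g : Space → ℝ, Continuous g → Integrable fun y => c y * (w ‖y‖ * g y) :=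
      fun g hg => (hcc.mul (by fun_prop)).integrable_of_hasCompactSupport ((hsupp g).mul_left)
    have hA : ∀ f : Space → ℝ, ∫ y, f (A y) = ∫ y, f y := fun f =>
      A.measurePreserving.integral_comp A.toHomeomorph.measurableEmbedding f
    have h1 : v (A x) = (∫ y, evenKernel x y * (w ‖y‖ * v (A y))) + d := by
      rw [hv (A x) (by rwa [A.norm_map]), ← hA]
      simp only [hkernel, A.norm_map]
    have h2 : ∫ y, c y * (w ‖y‖ * v (A y)) = ∫ y, c y * (w ‖y‖ * v y) := by
      rw [← hA fun y => c y * (w ‖y‖ * v y)]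
      simp only [hcA, A.norm_map]
    have e1 : ∫ y, evenKernel x y * (w ‖y‖ * D y) =
        (∫ y, evenKernel x y * (w ‖y‖ * v y)) - ∫ y, evenKernel x y * (w ‖y‖ * v (A y)) := by
      rw [← integral_sub (hi v hvc) (hi (fun y => v (A y)) (by fun_prop))]
      simp only [hD, mul_sub]
    have e2 : ∫ y, c y * (w ‖y‖ * D y) = 0 := by
      rw [← sub_eq_zero.2 h2.symm, ← integral_sub (hi' v hvc) (hi' (fun y => v (A y)) (by fun_prop))]
      simp only [hD, mul_sub]
    constructor
    · simp only [sub_mul]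
      rw [integral_sub (hi D hDc) (hi' D hDc), e1, e2]
      simp only [hD]
      rw [hv x hx, h1]
      ring
    · intro g hg
      simp only [sub_mul]
      exact (hi g hg).sub (hi' g hg)
  have hstep : ∀ Λ : ℝ, 0 ≤ Λ → (∀ y, ‖y‖ ≤ R → |D y| ≤ Λ * shellForce h ‖y‖) →
      ∀ y, ‖y‖ ≤ R → |D y| ≤ 9 / 10 * Λ * shellForce h ‖y‖ := by
    intro Λ hΛ0 hΛ x hx
    rcases (norm_nonneg x).eq_or_lt with hx0 | hx0
    · have : x = 0 := norm_eq_zero.1 hx0.symm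
      simp [this, hD]
    obtain ⟨h1, h2⟩ := hrep x hx0 hx
    rw [h1, ← Real.norm_eq_abs]
    have hg := h2 (fun y => Λ * shellForce h ‖y‖) (by fun_prop)
    calc ‖∫ y, (evenKernel x y - (√(‖x‖ ^ 2 + ‖y‖ ^ 2))⁻¹) * (w ‖y‖ * D y)‖
        ≤ ∫ y, (evenKernel x y - (√(‖x‖ ^ 2 + ‖y‖ ^ 2))⁻¹) * (w ‖y‖ * (Λ * shellForce h ‖y‖)) := by
          refine norm_integral_le_of_norm_le hg ?_
          filter_upwards [compl_mem_ae_iff.2 (measure_singleton x),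
            compl_mem_ae_iff.2 (measure_singleton (-x))] with y hy1 hy2
          rw [norm_mul, norm_mul, Real.norm_of_nonneg (evenKernel_sub_nonneg hy1 hy2),
            Real.norm_of_nonneg (hw0 _), Real.norm_eq_abs]
          refine mul_le_mul_of_nonneg_left ?_ (evenKernel_sub_nonneg hy1 hy2)
          rcases le_or_gt ‖y‖ R with hy | hy
          · exact mul_le_mul_of_nonneg_left (hΛ y hy) (hw0 _)
          · rw [hwR _ hy.le, zero_mul, zero_mul]
      _ = Λ * ∫ y, (evenKernel x y - (√(‖x‖ ^ 2 + ‖y‖ ^ 2))⁻¹) * (w ‖y‖ * shellForce h ‖y‖) := by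
          rw [← integral_const_mul]
          congr 1
          ext y
          ring
      _ ≤ Λ * (9 / 10 * shellForce h ‖x‖) := mul_le_mul_of_nonneg_left
          (integral_evenKernel_sub_mul_le hh hnn hw hw0 hwR hhd hhR hx0 hx) hΛ0
      _ = 9 / 10 * Λ * shellForce h ‖x‖ := by ring
  have hbase : ∃ Λ : ℝ, 0 ≤ Λ ∧ ∀ y, ‖y‖ ≤ R → |D y| ≤ Λ * shellForce h ‖y‖ := by
    obtain ⟨r₀, hr₀, hmin⟩ := isCompact_Icc.exists_isMinOn (Set.nonempty_Icc.2 hR)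
      (continuous_shellForce_div hh).continuousOn
    have hpos := shellForce_div_pos hh hnn h0 hr₀.1
    set m := ∫ t in (0 : ℝ)..1, t ^ 2 * h (r₀ * t)
    refine ⟨2 * L / m, by positivity, fun y hy => ?_⟩
    have h1 : m ≤ ∫ t in (0 : ℝ)..1, t ^ 2 * h (‖y‖ * t) := hmin ⟨norm_nonneg y, hy⟩
    have h2 : |D y| ≤ 2 * L * ‖y‖ := by
      have h3 := hLip y hy
      have h4 := hLip (A y) (by rwa [A.norm_map])
      rw [A.norm_map] at h4
      calc |D y| = |(v y - v 0) - (v (A y) - v 0)| := by simp only [hD]; congr 1; ring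
        _ ≤ |v y - v 0| + |v (A y) - v 0| := abs_sub _ _
        _ ≤ 2 * L * ‖y‖ := by linarith
    refine h2.trans ?_
    rw [shellForce, div_mul_eq_mul_div, le_div_iff₀ hpos, mul_assoc (2 * L)]
    exact mul_le_mul_of_nonneg_left (mul_le_mul_of_nonneg_left h1 (norm_nonneg y)) (by positivity)
  obtain ⟨Λ, hΛ0, hΛ⟩ := hbase
  have hiter : ∀ n : ℕ, ∀ y, ‖y‖ ≤ R → |D y| ≤ (9 / 10) ^ n * Λ * shellForce h ‖y‖ := by
    intro n
    induction n with
    | zero => simpa using hΛ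
    | succ n ih =>
      intro y hy
      have := hstep _ (by positivity) ih y hy
      rwa [pow_succ', mul_assoc (9 / 10 : ℝ)]
  have hlim : Filter.Tendsto (fun n : ℕ => (9 / 10 : ℝ) ^ n * Λ * shellForce h ‖x‖) Filter.atTop
      (nhds (0 * Λ * shellForce h ‖x‖)) :=
    ((tendsto_pow_atTop_nhds_zero_of_lt_one (by norm_num) (by norm_num)).mul_const _).mul_const _
  have h1 := ge_of_tendsto' hlim fun n => hiter n x hx
  rw [zero_mul, zero_mul] at h1
  have h2 := abs_nonpos_iff.1 h1
  exact (sub_eq_zero.1 h2).symm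

end NonradialKernel

section Linearized

/-- The linearised Lane–Emden equation with mass constraint has trivial kernel. -/
theorem linearized_kernel_trivial {q : ℝ} (hq : 1 < q) (hq3 : q ≠ 3) {h : ℝ → ℝ}
    (hh : Continuous h) (hnn : ∀ s, 0 ≤ h s) {b : ℝ} (hb : 0 < b)
    (hhu : ∀ s, 0 ≤ s → h s = posPow q (sphereArea * shellPot h s + b)) {R : ℝ} (hR : 0 < R)
    (hu : ∀ s, R ≤ s → sphereArea * shellPot h s + b ≤ 0) {v : Space → ℝ} (hvc : Continuous v)
    {d : ℝ}
    (hv : ∀ x, ‖x‖ ≤ R → v x = (∫ y, evenKernel x y *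
      (q * posPow (q - 1) (sphereArea * shellPot h ‖y‖ + b) * v y)) + d)
    {L : ℝ} (hL : 0 ≤ L) (hLip : ∀ x, ‖x‖ ≤ R → |v x - v 0| ≤ L * ‖x‖)
    (hmass : ∫ y : Space, q * posPow (q - 1) (sphereArea * shellPot h ‖y‖ + b) * v y = 0) :
    ∀ x, ‖x‖ ≤ R → v x = 0 := by
  have hSc := continuous_shellPot hh
  have hpc : Continuous (posPow (q - 1)) := continuous_posPow (by linarith)
  set w : ℝ → ℝ := fun s => q * posPow (q - 1) (sphereArea * shellPot h s + b) with hw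
  have hwc : Continuous w := by fun_prop
  have hw0 : ∀ s, 0 ≤ w s := fun s => mul_nonneg (by linarith) (posPow_nonneg _ _)
  have hwR : ∀ s, R ≤ s → w s = 0 := fun s hs => by
    simp only [hw]
    rw [posPow_of_nonpos (by linarith) (hu s hs), mul_zero]
  have h0 : 0 < h 0 := by
    rw [hhu 0 le_rfl, shellPot_zero, mul_zero, zero_add]
    exact posPow_pos hb
  have hhR : h R = 0 := by rw [hhu R hR.le, posPow_of_nonpos (by linarith) (hu R le_rfl)]
  have hhd : ∀ r, 0 < r → HasDerivAt h (-(w r * (sphereArea * shellForce h r))) r := by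
    intro r hr
    have h1 := ((hasDerivAt_shellPot hh hr.ne').const_mul sphereArea).add_const b
    refine (((hasDerivAt_posPow hq _).comp r h1).congr_of_eventuallyEq ?_).congr_deriv ?_
    · filter_upwards [lt_mem_nhds hr] with s hs
      exact hhu s (le_of_lt hs)
    · simp only [hw]
      ring
  set e : Space := EuclideanSpace.single 0 1
  have he : ‖e‖ = 1 := by simp [e]
  set η : ℝ → ℝ := fun s => v (s • e) with hη
  have hηc : Continuous η := by fun_prop
  have hηv : ∀ y, ‖y‖ ≤ R → v y = η ‖y‖ := by
    intro y hy
    obtain ⟨A, hA⟩ := exists_isometry_map_eq (x := y) (y := ‖y‖ • e)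
      (by rw [norm_smul, he, norm_norm, mul_one])
    rw [← linearized_isometry_invariant hh hnn h0 hwc hw0 hwR hR.le hhd hhR hvc hv hL hLip A hy, hA]
  set f : ℝ → ℝ := fun s => w s * η s with hf
  have hfc : Continuous f := by fun_prop
  have hfR : ∀ s, R ≤ s → f s = 0 := fun s hs => by simp only [hf]; rw [hwR s hs, zero_mul]
  have hwv : ∀ y : Space, w ‖y‖ * v y = f ‖y‖ := by
    intro y
    rcases le_or_gt ‖y‖ R with hy | hy
    · rw [hηv y hy]
    · rw [hfR _ hy.le, hwR _ hy.le, zero_mul]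
  have hveq : ∀ x, ‖x‖ ≤ R →
      v x = sphereArea * ((∫ s in (0 : ℝ)..R, s * f s) + shellPot f ‖x‖) + d := by
    intro x hx
    have e1 : (fun y => evenKernel x y * (q * posPow (q - 1) (sphereArea * shellPot h ‖y‖ + b) *
        v y)) = fun y => evenKernel x y * f ‖y‖ := funext fun y => congrArg _ (hwv y)
    rw [hv x hx, e1]
    rw [integral_evenKernel_mul (f := fun y => f ‖y‖) (by fun_prop)
      (hasCompactSupport_of_norm (R := R) fun y hy => hfR _ hy) (by simp),
      integral_radial_div_dist_eq hfc hR.le fun s hs => hfR s hs.le]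
  have hηeq : ∀ r ∈ Set.Icc 0 R, η r = η 0 + sphereArea * shellPot f r := by
    intro r hr
    have hn : ‖r • e‖ = r := by rw [norm_smul, he, mul_one, Real.norm_of_nonneg hr.1]
    have h1 := hveq (r • e) (by rw [hn]; exact hr.2)
    have h2 := hveq ((0 : ℝ) • e) (by simpa using hR.le)
    rw [hn] at h1
    rw [zero_smul, norm_zero, shellPot_zero] at h2
    simp only [hη, zero_smul]
    rw [h1, h2]
    ring
  have hηmass : ∫ s in (0 : ℝ)..R, s ^ 2 * f s = 0 := by
    rw [show (fun y : Space => q * posPow (q - 1) (sphereArea * shellPot h ‖y‖ + b) * v y) =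
      fun y => f ‖y‖ from funext hwv] at hmass
    rw [integral_norm_eq_interval hR.le fun s hs => hfR s hs.le] at hmass
    exact (mul_eq_zero.1 hmass).resolve_left sphereArea_pos.ne'
  have hz := radial_kernel_trivial hq hq3 hh hnn hb hhu hR hhR hηc hηeq hηmass
  intro x hx
  rw [hηv x hx]
  exact hz _ ⟨norm_nonneg x, hx⟩

end Linearized

section Ball

/-- The radial retraction of space onto a closed ball. -/
noncomputable def ballRetract {R : ℝ} (hR : 0 < R) (y : Space) :
    Metric.closedBall (0 : Space) R :=
  ⟨(R / max R ‖y‖) • y, by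
    have h1 : 0 < max R ‖y‖ := hR.trans_le (le_max_left _ _)
    rw [mem_closedBall_zero_iff, norm_smul, Real.norm_of_nonneg (by positivity),
      div_mul_eq_mul_div, div_le_iff₀ h1]
    exact mul_le_mul_of_nonneg_left (le_max_right _ _) hR.le⟩

variable {R : ℝ} (hR : 0 < R)

lemma continuous_ballRetract : Continuous (ballRetract hR) := by
  refine Continuous.subtype_mk (Continuous.smul (Continuous.div (by fun_prop) (by fun_prop)
    fun y => (hR.trans_le (le_max_left _ _)).ne') continuous_id) _

lemma ballRetract_of_mem {y : Space} (hy : ‖y‖ ≤ R) : (ballRetract hR y : Space) = y := by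
  simp only [ballRetract]
  rw [max_eq_left hy, div_self hR.ne', one_smul]

@[simp] lemma ballRetract_coe (y : Metric.closedBall (0 : Space) R) : ballRetract hR y = y :=
  Subtype.ext (ballRetract_of_mem hR (mem_closedBall_zero_iff.1 y.2))

lemma norm_ballRetract {y : Space} (hy : R ≤ ‖y‖) : ‖(ballRetract hR y : Space)‖ = R := by
  simp only [ballRetract]
  have h1 : 0 < ‖y‖ := hR.trans_le hy
  rw [max_eq_right hy, norm_smul, Real.norm_of_nonneg (by positivity)]
  field_simp

lemma ballRetract_neg (y : Space) : (ballRetract hR (-y) : Space) = -ballRetract hR y := by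
  simp [ballRetract]

lemma integral_closedBall_eq {F : Space → ℝ} (hF : ∀ y, R < ‖y‖ → F y = 0) :
    ∫ y : Metric.closedBall (0 : Space) R, F y ∂(volume.comap Subtype.val) = ∫ y, F y := by
  rw [integral_subtype_comap Metric.isClosed_closedBall.measurableSet,
    setIntegral_eq_integral_of_forall_compl_eq_zero fun y hy => hF y (by simpa using hy)]

/-- The centrifugal potential of a continuous rotation profile is continuous. -/
lemma continuous_centrifugal {ω : ℝ → ℝ} (hω : ContinuousOn ω (Set.Ici 0)) :
    Continuous fun x : Space => ∫ s in (0 : ℝ)..cylRad x, ω s ^ 2 * s := by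
  have hc : Continuous fun x : Space => cylRad x := by unfold cylRad; fun_prop
  have hm : Continuous fun s : ℝ => ω (max s 0) ^ 2 * s :=
    ((hω.comp_continuous (by fun_prop) fun s => Set.mem_Ici.2 (le_max_right _ _)).pow 2).mul
      continuous_id
  have h1 : Continuous fun r : ℝ => ∫ s in (0 : ℝ)..r, ω (max s 0) ^ 2 * s :=
    intervalIntegral.continuous_primitive (fun a b => hm.intervalIntegrable _ _) 0
  refine (h1.comp hc).congr fun x => intervalIntegral.integral_congr fun s hs => ?_
  rw [Set.uIcc_of_le (show (0 : ℝ) ≤ cylRad x from Real.sqrt_nonneg _)] at hs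
  simp only [max_eq_left hs.1]

end Ball

section Assembly

/-- Solutions of the potential formulation on a ball, near a radial Lane–Emden potential. -/
theorem exists_potential_curve {q : ℝ} (hq : 1 < q) (hq3 : q ≠ 3) {h : ℝ → ℝ}
    (hh : Continuous h) (hnn : ∀ s, 0 ≤ h s) {b : ℝ} (hb : 0 < b)
    (hhu : ∀ s, 0 ≤ s → h s = posPow q (sphereArea * shellPot h s + b)) {R : ℝ} (hR : 0 < R)
    (hu : ∀ s, R ≤ s → sphereArea * shellPot h s + b < 0) {J : Space → ℝ} (hJ : Continuous J)
    (hJ0 : J 0 = 0) :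
    ∃ κmax, 0 < κmax ∧ ∃ u : ℝ → C(Metric.closedBall (0 : Space) R, ℝ),
      (∀ x, u 0 x = sphereArea * shellPot h ‖(x : Space)‖ + b) ∧
      ContinuousOn u {κ | |κ| < κmax} ∧ ∀ κ, |κ| < κmax →
        (∃ c, ∀ x, u κ x = (∫ y : Metric.closedBall (0 : Space) R,
          evenKernel x y * posPow q (u κ y) ∂(volume.comap Subtype.val)) + c + κ ^ 2 * J x) ∧
        ∫ y, posPow q (u κ y) ∂(volume.comap Subtype.val) = ∫ y : Space, h ‖y‖ := by
  have hSc := continuous_shellPot hh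
  set K := Metric.closedBall (0 : Space) R with hK
  set μ : Measure K := volume.comap Subtype.val with hμ
  have : CompactSpace K := isCompact_iff_compactSpace.1 (isCompact_closedBall (0 : Space) R)
  have : IsFiniteMeasure μ := ⟨by
    rw [hμ, comap_subtype_coe_apply Metric.isClosed_closedBall.measurableSet, Set.image_univ,
      Subtype.range_coe]
    exact measure_closedBall_lt_top⟩
  have hk := lipschitzKernel_evenKernel R
  have hhz : ∀ s, R ≤ s → h s = 0 := fun s hs => by
    rw [hhu s (hR.le.trans hs), posPow_of_nonpos (by linarith) (hu s hs).le]
  let o : K := ⟨0, Metric.mem_closedBall_self hR.le⟩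
  let u₀ : C(K, ℝ) := ⟨fun x => sphereArea * shellPot h ‖(x : Space)‖ + b, by fun_prop⟩
  have hpc : Continuous (posPow (q - 1)) := continuous_posPow (by linarith)
  have hgu : ∀ y : K, posPow q (u₀ y) = h ‖(y : Space)‖ := fun y => (hhu _ (norm_nonneg _)).symm
  have hmass0 : ∫ y, posPow q (u₀ y) ∂μ = ∫ y : Space, h ‖y‖ := by
    simp only [hgu]
    exact integral_closedBall_eq (F := fun y => h ‖y‖) fun y hy => hhz _ hy.le
  have hu₀ : ∀ x : K, u₀ x = ∫ y : K, evenKernel x y * posPow q (u₀ y) ∂μ +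
      (b - sphereArea * ∫ s in (0 : ℝ)..R, s * h s) := by
    intro x
    have e : ∫ y : K, evenKernel x y * h ‖(y : Space)‖ ∂μ = _ :=
      integral_closedBall_eq (F := fun y : Space => evenKernel x y * h ‖y‖)
        fun y hy => by rw [hhz _ hy.le, mul_zero]
    simp only [hgu]
    rw [e, integral_evenKernel_mul (f := fun y => h ‖y‖) (by fun_prop)
      (hasCompactSupport_of_norm (R := R) fun y hy => hhz _ hy) (by simp),
      integral_radial_div_dist_eq hh hR.le fun s hs => hhz s hs.le]
    simp only [u₀, ContinuousMap.coe_mk]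
    ring
  have hker : ∀ (v : C(K, ℝ)) (d : ℝ),
      (∀ x : K, v x = ∫ y : K, evenKernel x y * (q * posPow (q - 1) (u₀ y) * v y) ∂μ + d) →
      ∫ y : K, q * posPow (q - 1) (u₀ y) * v y ∂μ = 0 → v = 0 := by
    intro v d hv hvm
    set V : Space → ℝ := fun y => v (ballRetract hR y) with hV
    have hVc : Continuous V := v.continuous.comp (continuous_ballRetract hR)
    have hVv : ∀ y : K, V y = v y := fun y => by simp [hV]
    have hwz : ∀ y : Space, R < ‖y‖ →
        q * posPow (q - 1) (sphereArea * shellPot h ‖y‖ + b) * V y = 0 := fun y hy => by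
      rw [posPow_of_nonpos (by linarith) (hu _ hy.le).le, mul_zero, zero_mul]
    have hvV : ∀ x : K, v x = (∫ y : Space, evenKernel x y *
        (q * posPow (q - 1) (sphereArea * shellPot h ‖y‖ + b) * V y)) + d := by
      intro x
      rw [hv x, ← integral_closedBall_eq (R := R) fun y hy => by rw [hwz y hy, mul_zero]]
      simp only [hVv]
      rfl
    obtain ⟨C, hC, hCl⟩ := hk.lipschitz
    let f : C(K, ℝ) := ⟨fun y => q * posPow (q - 1) (u₀ y) * v y, by fun_prop⟩
    have hlip : ∀ x : K, |v x - v o| ≤ C * ‖f‖ * ‖(x : Space)‖ := by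
      intro x
      have e1 := hk.abs_integral_sub_le x o f
      have e2 : v x - v o = ∫ y : K, evenKernel x y * f y ∂μ - ∫ y : K, evenKernel o y * f y ∂μ := by
        rw [hv x, hv o]
        exact add_sub_add_right_eq_sub _ _ _
      rw [e2]
      refine e1.trans ((mul_le_mul_of_nonneg_right (hCl x o) (norm_nonneg f)).trans_eq ?_)
      rw [Subtype.dist_eq, dist_eq_norm, sub_zero]
      ring
    have hzero := linearized_kernel_trivial hq hq3 hh hnn hb hhu hR (fun s hs => (hu s hs).le) hVc
      (d := d) (fun x hx => ?_) (L := C * ‖f‖) (by positivity) (fun x hx => ?_) ?_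
    · ext x
      rw [← hVv x]
      exact hzero x (mem_closedBall_zero_iff.1 x.2)
    · exact (hVv ⟨x, mem_closedBall_zero_iff.2 hx⟩).trans (hvV ⟨x, mem_closedBall_zero_iff.2 hx⟩)
    · have := hlip ⟨x, mem_closedBall_zero_iff.2 hx⟩
      rwa [← hVv, ← hVv] at this
    · rw [← integral_closedBall_eq hwz, ← hvm]
      simp only [hVv]
      rfl
  obtain ⟨κmax, hκ, u, h1, h2, h3⟩ := hk.exists_curve o (fun t => hasDerivAt_posPow hq t)
    (by fun_prop) u₀ (b - sphereArea * ∫ s in (0 : ℝ)..R, s * h s) hu₀ hker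
    ⟨fun x : K => J x, by fun_prop⟩ hJ0
  refine ⟨κmax, hκ, u, fun x => by rw [h1]; rfl, h2, fun κ hκ' => ⟨(h3 κ hκ').1, ?_⟩⟩
  rw [(h3 κ hκ').2, hmass0]

end Assembly

section Densities

/-- Continuation of a nonzero radial Lane–Emden solution to rotating solutions of equal mass. -/
theorem exists_rotating_curve {γ : ℝ} (hγ₁ : 1 < γ) (hγ₂ : γ < 2) (hγ₃ : γ ≠ 4 / 3) {h : ℝ → ℝ}
    (hh : Continuous h) (hnn : ∀ s, 0 ≤ h s) {b : ℝ} (hb : 0 < b)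
    (hhu : ∀ s, 0 ≤ s → h s = posPow (1 / (γ - 1)) (sphereArea * shellPot h s + b))
    {R : ℝ} (hR : 0 < R) (hu : ∀ s, R ≤ s → sphereArea * shellPot h s + b < 0)
    {ω : ℝ → ℝ} (hω : ContinuousOn ω (Set.Ici 0)) :
    ∃ κmax : ℝ, 0 < κmax ∧ ∃ ρ : ℝ → (Space → ℝ), (∀ y, ρ 0 y = h ‖y‖) ∧
      (∀ κ : ℝ, |κ| < κmax →
        Continuous (ρ κ) ∧ (∀ x, 0 ≤ ρ κ x) ∧ HasCompactSupport (ρ κ) ∧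
        (∫ x, ρ κ x) = (∫ x : Space, h ‖x‖) ∧
        ∃ k : ℝ, ∀ x : Space, 0 < ρ κ x →
          (ρ κ x) ^ (γ - 1) - pot (ρ κ) x
            - ∫ s in (0 : ℝ)..(cylRad x), κ ^ 2 * (ω s) ^ 2 * s = k) ∧
      (∀ κ : ℝ, |κ| < κmax → ∀ ε : ℝ, 0 < ε → ∃ δ : ℝ, 0 < δ ∧
        ∀ κ' : ℝ, |κ'| < κmax → |κ' - κ| < δ → ∀ x, |ρ κ' x - ρ κ x| ≤ ε) := by
  set q := 1 / (γ - 1) with hq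
  have hγ0 : 0 < γ - 1 := by linarith
  have hq1 : 1 < q := by rw [hq, lt_div_iff₀ hγ0]; linarith
  have hq3 : q ≠ 3 := fun h3 => hγ₃ (by rw [hq, div_eq_iff hγ0.ne'] at h3; linarith)
  have hg : Continuous (posPow q) := continuous_posPow (by linarith)
  have hJ := continuous_centrifugal hω
  set J : Space → ℝ := fun x => ∫ s in (0 : ℝ)..cylRad x, ω s ^ 2 * s with hJd
  have hJe : ∀ x, J (-x) = J x := fun x => by simp [hJd, cylRad]
  have _ : CompactSpace (Metric.closedBall (0 : Space) R) :=
    isCompact_iff_compactSpace.1 (isCompact_closedBall (0 : Space) R)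
  obtain ⟨κ₁, hκ₁, u, hu0, huc, hus⟩ :=
    exists_potential_curve hq1 hq3 hh hnn hb hhu hR hu hJ (by simp [hJd, cylRad])
  obtain ⟨δ₁, hδ₁, hδ⟩ := Metric.continuousOn_iff.1 huc 0 (by simpa using hκ₁)
    (-(sphereArea * shellPot h R + b)) (by linarith [hu R le_rfl])
  set ρ : ℝ → Space → ℝ := fun κ y => posPow q (u κ (ballRetract hR y)) with hρ
  have hcont : ∀ κ, Continuous (ρ κ) := fun κ =>
    hg.comp ((u κ).continuous.comp (continuous_ballRetract hR))
  have hzero : ∀ κ, |κ| < min κ₁ δ₁ → ∀ y : Space, R ≤ ‖y‖ → ρ κ y = 0 := by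
    intro κ hκ y hy
    refine posPow_of_nonpos (by linarith) ?_
    have h1 := hδ κ (hκ.trans_le (min_le_left _ _))
      (by simpa [Real.dist_eq] using hκ.trans_le (min_le_right _ _))
    have h2 := (ContinuousMap.dist_apply_le_dist (ballRetract hR y)).trans h1.le
    rw [hu0, norm_ballRetract hR hy, Real.dist_eq] at h2
    linarith [le_abs_self (u κ (ballRetract hR y) - (sphereArea * shellPot h R + b))]
  refine ⟨min κ₁ δ₁, lt_min hκ₁ hδ₁, ρ, fun y => ?_, fun κ hκ => ?_, fun κ hκ ε hε => ?_⟩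
  · simp only [hρ, hu0]
    rcases le_or_gt ‖y‖ R with hy | hy
    · rw [ballRetract_of_mem hR hy, hhu _ (norm_nonneg y)]
    · rw [norm_ballRetract hR hy.le, hhu _ (norm_nonneg y),
        posPow_of_nonpos (by linarith) (hu R le_rfl).le,
        posPow_of_nonpos (by linarith) (hu _ hy.le).le]
  · have hz := hzero κ hκ
    have hcs : HasCompactSupport (ρ κ) := hasCompactSupport_of_norm (R := R) hz
    obtain ⟨⟨c, hc⟩, hm⟩ := hus κ (hκ.trans_le (min_le_left _ _))
    have heven : ∀ y, ρ κ (-y) = ρ κ y := by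
      intro y
      simp only [hρ]
      congr 1
      rw [hc, hc, ballRetract_neg, hJe]
      congr 3
      funext z
      rw [show evenKernel (-(ballRetract hR y : Space)) z = evenKernel (ballRetract hR y) z by
        simp only [evenKernel, norm_add_eq_norm_neg_sub, neg_neg]
        rw [add_comm]]
    refine ⟨hcont κ, fun x => posPow_nonneg _ _, hcs, ?_, c, fun x hx => ?_⟩
    · rw [← hm, ← integral_closedBall_eq fun y hy => hz y hy.le]
      simp only [hρ, ballRetract_coe]
    · have hxR : ‖x‖ < R := by
        by_contra! hcon
        exact hx.ne' (hz x hcon)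
      have hpos : 0 < u κ (ballRetract hR x) := by
        by_contra! hcon
        exact hx.ne' (posPow_of_nonpos (by linarith) hcon)
      have e1 : ρ κ x ^ (γ - 1) = u κ (ballRetract hR x) := by
        simp only [hρ]
        rw [posPow_of_nonneg hpos.le, ← Real.rpow_mul hpos.le, hq, one_div,
          inv_mul_cancel₀ hγ0.ne', Real.rpow_one]
      have e2 : pot (ρ κ) x = ∫ y : Metric.closedBall (0 : Space) R,
          evenKernel x y * posPow q (u κ y) ∂(volume.comap Subtype.val) := by
        rw [pot, ← integral_evenKernel_mul (hcont κ) hcs heven,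
          ← integral_closedBall_eq (R := R) fun y hy => by rw [hz y hy.le, mul_zero]]
        simp only [hρ, ballRetract_coe]
      have e3 : ∫ s in (0 : ℝ)..(cylRad x), κ ^ 2 * (ω s) ^ 2 * s = κ ^ 2 * J x := by
        simp only [hJd, mul_assoc, intervalIntegral.integral_const_mul]
      rw [e1, e2, e3, hc, ballRetract_of_mem hR hxR.le]
      ring
  · have hgc : ContinuousOn (fun κ => (ContinuousMap.mk _ hg).comp (u κ)) {κ | |κ| < κ₁} :=
      (ContinuousMap.continuous_postcomp _).comp_continuousOn huc
    obtain ⟨δ, hδ', hd⟩ := Metric.continuousOn_iff.1 hgc κ (hκ.trans_le (min_le_left _ _)) ε hε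
    refine ⟨δ, hδ', fun κ' hκ' hdist x => ?_⟩
    exact (ContinuousMap.dist_apply_le_dist (ballRetract hR x)).trans
      (hd κ' (hκ'.trans_le (min_le_left _ _)) hdist).le

end Densities

/-- Strauss–Wu mass-controlled local curve: for `6/5 < γ < 2`, `γ ≠ 4/3`, any Lane–Emden
solution `ρ₀` can be continued to a continuous-in-`κ` family of compactly supported
rotating star solutions with rotation profile `κ ω₀(r)` and the *same total mass* as `ρ₀`,
for all sufficiently small `κ`. -/
theorem strauss_wu_mass_controlled_local_curve
    (γ : ℝ) (hγ₁ : 6/5 < γ) (hγ₂ : γ < 2) (hγ₃ : γ ≠ 4/3)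
    (ρ₀ : EuclideanSpace ℝ (Fin 3) → ℝ)
    (hρ₀cont : Continuous ρ₀) (hρ₀nonneg : ∀ x, 0 ≤ ρ₀ x)
    (hρ₀supp : HasCompactSupport ρ₀)
    (hρ₀radial : ∀ x y : EuclideanSpace ℝ (Fin 3), ‖x‖ = ‖y‖ → ρ₀ x = ρ₀ y)
    (hρ₀LaneEmden : ∃ k : ℝ, ∀ x : EuclideanSpace ℝ (Fin 3),
      0 < ρ₀ x → ρ₀ x ^ (γ - 1) - pot ρ₀ x = k)
    (ω₀ : ℝ → ℝ) (hω₀ : ContDiffOn ℝ (⊤ : ℕ∞) ω₀ (Set.Ici 0)) :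
    ∃ κmax : ℝ, 0 < κmax ∧
      ∃ ρ : ℝ → (EuclideanSpace ℝ (Fin 3) → ℝ),
        ρ 0 = ρ₀ ∧
        (∀ κ : ℝ, |κ| < κmax →
          Continuous (ρ κ) ∧ (∀ x, 0 ≤ ρ κ x) ∧ HasCompactSupport (ρ κ) ∧
          (∫ x, ρ κ x) = (∫ x, ρ₀ x) ∧
          ∃ k : ℝ, ∀ x : EuclideanSpace ℝ (Fin 3), 0 < ρ κ x →
            (ρ κ x) ^ (γ - 1) - pot (ρ κ) x
              - ∫ s in (0:ℝ)..(cylRad x), κ^2 * (ω₀ s)^2 * s = k) ∧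
        -- continuity of `κ ↦ ρ κ` into `C(ℝ³)` with the supremum norm
        (∀ κ : ℝ, |κ| < κmax → ∀ ε : ℝ, 0 < ε → ∃ δ : ℝ, 0 < δ ∧
          ∀ κ' : ℝ, |κ'| < κmax → |κ' - κ| < δ →
            ∀ x : EuclideanSpace ℝ (Fin 3), |ρ κ' x - ρ κ x| ≤ ε) := by
  by_cases hne : ∃ x, 0 < ρ₀ x
  swap
  · refine ⟨1, one_pos, fun _ => ρ₀, rfl, fun κ _ => ⟨hρ₀cont, hρ₀nonneg, hρ₀supp, rfl, 0,
      fun x hx => absurd ⟨x, hx⟩ hne⟩, fun κ _ ε hε => ⟨1, one_pos, fun κ' _ _ x => ?_⟩⟩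
    simpa using hε.le
  have hγ : 1 < γ := by linarith
  obtain ⟨k, hk⟩ := hρ₀LaneEmden
  set e : Space := EuclideanSpace.single 0 1 with he
  have he1 : ‖e‖ = 1 := by simp [he]
  have hen : ∀ s : ℝ, 0 ≤ s → ‖s • e‖ = s := fun s hs => by
    rw [norm_smul, he1, mul_one, Real.norm_of_nonneg hs]
  set h : ℝ → ℝ := fun s => ρ₀ (s • e) with hh
  have hhc : Continuous h := by fun_prop
  have hρh : ∀ y, ρ₀ y = h ‖y‖ := fun y => hρ₀radial _ _ (hen _ (norm_nonneg y)).symm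
  obtain ⟨S, hS0, hS⟩ : ∃ S, 0 ≤ S ∧ ∀ s, S < s → h s = 0 := by
    obtain ⟨S, hS⟩ := hρ₀supp.isCompact.isBounded.subset_closedBall (0 : Space)
    refine ⟨max S 0, le_max_right _ _, fun s hs => ?_⟩
    by_contra hcon
    have h1 := hS (subset_tsupport ρ₀ hcon)
    rw [mem_closedBall_zero_iff, hen s ((le_max_right S 0).trans hs.le)] at h1
    exact absurd (h1.trans (le_max_left S 0)) (not_le.2 hs)
  set b := k + sphereArea * ∫ s in (0 : ℝ)..S, s * h s with hbd
  have hLE : ∀ s, 0 ≤ s → 0 < h s → h s ^ (γ - 1) = sphereArea * shellPot h s + b := by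
    intro s hs hpos
    have h1 := hk (s • e) hpos
    have h2 : pot ρ₀ (s • e) =
        sphereArea * ((∫ s in (0 : ℝ)..S, s * h s) + shellPot h ‖s • e‖) := by
      simp only [pot]
      simp only [hρh]
      exact integral_radial_div_dist_eq hhc hS0 hS (s • e)
    rw [h2, hen s hs] at h1
    change h s ^ (γ - 1) - _ = k at h1
    linarith
  obtain ⟨x₁, hx₁⟩ := hne
  obtain ⟨R₀, hR₀, hpos, -, hneg, hhu⟩ := exists_radius_of_laneEmden hγ hhc
    (fun s => hρ₀nonneg _) hS ⟨‖x₁‖, norm_nonneg _, hρh x₁ ▸ hx₁⟩ sphereArea_pos hLE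
  have hb : 0 < b := by
    by_contra! hcon
    have h1 := hpos 0 le_rfl hR₀
    rw [hhu 0 le_rfl, shellPot_zero, mul_zero, zero_add,
      posPow_of_nonpos (by rw [one_div, inv_pos]; linarith) hcon] at h1
    exact lt_irrefl _ h1
  obtain ⟨κmax, hκ, ρ, h1, h2, h3⟩ := exists_rotating_curve hγ hγ₂ hγ₃ hhc
    (fun s => hρ₀nonneg _) hb hhu (R := R₀ + 1) (by linarith)
    (fun s hs => hneg s (by linarith)) hω₀.continuousOn
  refine ⟨κmax, hκ, ρ, funext fun y => (h1 y).trans (hρh y).symm, fun κ hκ' => ?_, h3⟩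
  simp only [hρh]
  exact h2 κ hκ'
end

section
/- (Global implicit function theorem) Let X be a Banach space and U an open subset of X × ℝ. Let F : U → X be continuously Fréchet differentiable. Let (ξ₀, κ₀) ∈ U with F(ξ₀, κ₀) = 0. Assume: (a) the partial derivative ∂F/∂ξ(ξ₀, κ₀) is an isomorphism of X; (b) the map (ξ, κ) ↦ F(ξ, κ) − ξ is a compact map from U to X (it maps bounded subsets of U to relatively compact subsets of X and is continuous); and (c) for every (ξ, κ) ∈ U, the bounded operator ∂F/∂ξ(ξ, κ) − I on X is compact. Let S be the closure in X × ℝ of the solution set {(ξ, κ) ∈ U : F(ξ, κ) = 0}, and let K be the connected component of S containing (ξ₀, κ₀). Then at least one of the following holds: (i) K is unbounded in X × ℝ; (ii) K \ {(ξ₀, κ₀)} is connected; (iii) K ∩ ∂U ≠ ∅. -/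
open Filter Topology

section FiniteDimensional

open MeasureTheory Set

/-- The determinant of an `n × n` matrix `A` is a fixed linear combination of the values
`det (1 + tⱼ A)` at any family of `n + 1` distinct points `tⱼ`. -/
theorem Matrix.exists_det_eq_sum_det_one_add_smul {n : Type*} [Fintype n] [DecidableEq n]
    {ι : Type*} [Fintype ι] [DecidableEq ι] (hι : Fintype.card ι = Fintype.card n + 1)
    {t : ι → ℝ} (ht : Function.Injective t) :
    ∃ c : ι → ℝ, ∀ A : Matrix n n ℝ, A.det = ∑ j, c j * (1 + t j • A).det := by
  refine ⟨fun j => (∏ i ∈ Finset.univ.erase j, (t j - t i))⁻¹, fun A => ?_⟩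
  set P : Polynomial ℝ :=
    ((Polynomial.X : Polynomial ℝ) • A.map Polynomial.C +
      (1 : Matrix n n ℝ).map Polynomial.C).det with hP
  have hdeg : P.degree < (Finset.univ : Finset ι).card := by
    refine Polynomial.degree_lt_iff_coeff_zero _ _ |>.2 fun m hm => ?_
    refine Polynomial.coeff_eq_zero_of_natDegree_lt
      ((Polynomial.natDegree_det_X_add_C_le A 1).trans_lt ?_)
    rw [Finset.card_univ] at hm
    omega
  have h := Lagrange.coeff_eq_sum (ht.injOn (s := ((Finset.univ : Finset ι) : Set ι))) hdeg
  rw [Finset.card_univ, hι, Nat.add_sub_cancel, hP, Polynomial.coeff_det_X_add_C_card] at h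
  rw [h]
  refine Finset.sum_congr rfl fun j _ => ?_
  have : P.eval (t j) = (1 + t j • A).det := by
    rw [hP, ← Polynomial.coe_evalRingHom, RingHom.map_det]
    congr 1
    ext a b
    by_cases hab : a = b <;> simp [hab] <;> ring
  rw [← hP, this, div_eq_inv_mul]

variable {E : Type*} [NormedAddCommGroup E] [NormedSpace ℝ E] [FiniteDimensional ℝ E]

theorem ContinuousLinearMap.exists_det_eq_sum_det_id_add_smul
    {ι : Type*} [Fintype ι] [DecidableEq ι] (hι : Fintype.card ι = Module.finrank ℝ E + 1)
    {t : ι → ℝ} (ht : Function.Injective t) :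
    ∃ c : ι → ℝ, ∀ A : E →L[ℝ] E,
      A.det = ∑ j, c j * (ContinuousLinearMap.id ℝ E + t j • A).det := by
  let b := Module.finBasis ℝ E
  obtain ⟨c, hc⟩ := Matrix.exists_det_eq_sum_det_one_add_smul
    (n := Fin (Module.finrank ℝ E)) (by simpa using hι) ht
  have hdet : ∀ A : E →L[ℝ] E, A.det = (LinearMap.toMatrix b b (A : E →ₗ[ℝ] E)).det :=
    fun A => (LinearMap.det_toMatrix b _).symm
  refine ⟨c, fun A => ?_⟩
  rw [hdet A, hc]
  refine Finset.sum_congr rfl fun j _ => ?_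
  rw [hdet]
  congr 2
  simp

/-- The Jacobian of a compactly supported perturbation of the identity that is close enough to the
identity integrates over a large ball to the volume of the ball. -/
theorem exists_forall_setIntegral_det_id_add_smul_fderiv [MeasurableSpace E] [BorelSpace E]
    (μ : Measure E) [μ.IsAddHaarMeasure] {k : E → E} (hk : ContDiff ℝ 1 k)
    (hsupp : HasCompactSupport k) {B : Set E} (hB : MeasurableSet B) (hkB : tsupport k ⊆ B) :
    ∃ δ > 0, ∀ s : ℝ, |s| < δ →
      ∫ x in B, (ContinuousLinearMap.id ℝ E + s • fderiv ℝ k x).det ∂μ = μ.real B := by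
  obtain ⟨C, hC⟩ := hk.lipschitzWith_of_hasCompactSupport hsupp one_ne_zero
  have hdet : ∀ᶠ L : E →L[ℝ] E in 𝓝 (ContinuousLinearMap.id ℝ E), 0 < L.det := by
    refine continuousAt_const.eventually_lt ContinuousLinearMap.continuous_det.continuousAt ?_
    simp [ContinuousLinearMap.det]
  obtain ⟨ε, hε, hεdet⟩ := Metric.eventually_nhds_iff.1 hdet
  refine ⟨min ε 1 / (C + 1), by positivity, fun s hs => ?_⟩
  rw [lt_div_iff₀ (by positivity)] at hs
  have hs1 : |s| * C < 1 := by nlinarith [abs_nonneg s, min_le_right ε 1]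
  have hs2 : |s| * C < ε := by nlinarith [abs_nonneg s, min_le_left ε 1]
  set h : E → E := fun x => x + s • k x with hh
  have hfix : ∀ x, x ∉ B → h x = x := fun x hx => by
    simp [hh, image_eq_zero_of_notMem_tsupport fun h' => hx (hkB h')]
  have hinj : Function.Injective h := by
    intro x y hxy
    have h1 : x - y = s • (k y - k x) := by
      simp only [hh] at hxy
      rw [smul_sub, sub_eq_sub_iff_add_eq_add, hxy, add_comm]
    have h2 : ‖x - y‖ ≤ |s| * C * ‖x - y‖ := by
      calc ‖x - y‖ = |s| * ‖k y - k x‖ := by rw [h1, norm_smul, Real.norm_eq_abs]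
        _ ≤ |s| * (C * ‖y - x‖) := by gcongr; exact hC.norm_sub_le y x
        _ = |s| * C * ‖x - y‖ := by rw [norm_sub_rev]; ring
    have h3 : ‖x - y‖ = 0 := by nlinarith [norm_nonneg (x - y)]
    exact sub_eq_zero.1 (norm_eq_zero.1 h3)
  have hsurj : Function.Surjective h := by
    intro y
    have hcontr : ContractingWith (Real.nnabs s * C) fun x => y - s • k x := by
      refine ⟨by rw [← NNReal.coe_lt_coe]; simpa using hs1,
        LipschitzWith.of_dist_le_mul fun a b => ?_⟩
      rw [dist_sub_left, dist_smul₀]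
      rw [NNReal.coe_mul, Real.coe_nnabs, Real.norm_eq_abs, mul_assoc]
      exact mul_le_mul_of_nonneg_left (hC.dist_le_mul a b) (abs_nonneg s)
    refine ⟨hcontr.fixedPoint, ?_⟩
    have := hcontr.fixedPoint_isFixedPt
    simp only [Function.IsFixedPt] at this
    simp only [hh]
    nth_rewrite 1 [← this]
    simp
  have himage : h '' B = B := by
    ext y
    constructor
    · rintro ⟨x, hx, rfl⟩
      by_contra hy
      exact hy ((hinj (hfix _ hy)).symm ▸ hx)
    · intro hy
      obtain ⟨x, rfl⟩ := hsurj y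
      by_contra hx
      have : x ∉ B := fun hxB => hx ⟨x, hxB, rfl⟩
      exact this (hfix x this ▸ hy)
  have hderiv : ∀ x ∈ B, HasFDerivWithinAt h
      (ContinuousLinearMap.id ℝ E + s • fderiv ℝ k x) B x := fun x _ =>
    ((hasFDerivAt_id x).add
      ((hk.differentiable one_ne_zero x).hasFDerivAt.const_smul s)).hasFDerivWithinAt
  have := integral_image_eq_integral_abs_det_fderiv_smul μ hB hderiv hinj.injOn (fun _ => (1 : ℝ))
  rw [himage] at this
  simp only [integral_const, smul_eq_mul, mul_one, measureReal_restrict_apply_univ] at this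
  rw [this]
  refine integral_congr_ae (ae_of_all _ fun x => ?_)
  refine (abs_of_pos (hεdet ?_)).symm
  rw [dist_eq_norm, add_sub_cancel_left, norm_smul, Real.norm_eq_abs]
  refine lt_of_le_of_lt ?_ hs2
  gcongr
  exact norm_fderiv_le_of_lipschitz ℝ hC

theorem integral_det_fderiv_eq_zero_of_hasCompactSupport [Nontrivial E] [MeasurableSpace E]
    [BorelSpace E] (μ : Measure E) [μ.IsAddHaarMeasure] {k : E → E} (hk : ContDiff ℝ 1 k)
    (hsupp : HasCompactSupport k) :
    ∫ x, (fderiv ℝ k x).det ∂μ = 0 := by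
  have hB := (isClosed_tsupport k).measurableSet
  obtain ⟨δ, hδ, h⟩ := exists_forall_setIntegral_det_id_add_smul_fderiv μ hk hsupp hB subset_rfl
  set n := Module.finrank ℝ E with hn
  have hnpos : 0 < n := Module.finrank_pos
  let t : Fin (n + 1) → ℝ := fun j => δ * (j / (n + 1))
  have ht : Function.Injective t := fun i j hij => by
    have : (i : ℝ) = j := by
      have h1 := mul_left_cancel₀ hδ.ne' hij
      field_simp at h1
      exact h1
    exact Fin.ext (by exact_mod_cast this)
  have htδ : ∀ j, |t j| < δ := fun j => by
    have h1 : (j : ℝ) / (n + 1) < 1 := by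
      rw [div_lt_one (by positivity)]
      exact_mod_cast j.2
    rw [abs_of_nonneg (by positivity)]
    simp only [t]
    nlinarith
  obtain ⟨c, hc⟩ := ContinuousLinearMap.exists_det_eq_sum_det_id_add_smul (E := E)
    (ι := Fin (n + 1)) (by simp [hn]) ht
  have hsum : ∑ j, c j = 0 := by
    have h0 : (0 : E →L[ℝ] E).det = 0 := by
      rw [ContinuousLinearMap.det, ContinuousLinearMap.toLinearMap_zero, LinearMap.det_zero]
      exact zero_pow hnpos.ne'
    have := hc 0
    simp only [smul_zero, add_zero, h0] at this
    simpa [ContinuousLinearMap.det] using this.symm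
  have hcont : Continuous (fderiv ℝ k) := hk.continuous_fderiv one_ne_zero
  have hint : ∀ j, IntegrableOn
      (fun x => (ContinuousLinearMap.id ℝ E + t j • fderiv ℝ k x).det) (tsupport k) μ := fun j =>
    (ContinuousLinearMap.continuous_det.comp
      (continuous_const.add (hcont.const_smul (t j)))).continuousOn.integrableOn_compact hsupp
  rw [← setIntegral_eq_integral_of_forall_compl_eq_zero (s := tsupport k)]
  · simp_rw [hc (fderiv ℝ k _)]
    rw [integral_finsetSum _ fun j _ => (hint j).const_mul (c j)]
    simp_rw [integral_const_mul, h _ (htδ _), ← Finset.sum_mul, hsum, zero_mul]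
  · intro x hx
    have : fderiv ℝ k x = 0 := image_eq_zero_of_notMem_tsupport fun h' =>
      hx (tsupport_fderiv_subset ℝ h')
    rw [this, ContinuousLinearMap.det, ContinuousLinearMap.toLinearMap_zero, LinearMap.det_zero]
    exact zero_pow hnpos.ne'

theorem HasCompactSupport.exists_pos_le_norm_of_sub_const {Y F : Type*} [NormedAddCommGroup Y]
    [NormedAddCommGroup F] {Ψ : Y → F} (hΨ : Continuous Ψ) {c : F} (hc : c ≠ 0)
    (hsupp : HasCompactSupport fun x => Ψ x - c) {W : Set Y} (hW : IsOpen W)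
    (hzero : ∀ x, Ψ x = 0 → x ∈ W) :
    ∃ δ > 0, ∀ x, x ∉ W → δ ≤ ‖Ψ x‖ := by
  have hcl : IsClosed (Ψ '' (tsupport (fun x => Ψ x - c) ∩ Wᶜ) ∪ {c}) :=
    ((hsupp.inter_right hW.isClosed_compl).image hΨ).isClosed.union isClosed_singleton
  have h0 : (0 : F) ∈ (Ψ '' (tsupport (fun x => Ψ x - c) ∩ Wᶜ) ∪ {c})ᶜ := by
    rintro (⟨x, hx, hx0⟩ | h)
    · exact hx.2 (hzero x hx0)
    · exact hc h.symm
  obtain ⟨δ, hδ, hball⟩ := Metric.isOpen_iff.1 hcl.isOpen_compl 0 h0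
  refine ⟨δ, hδ, fun x hx => ?_⟩
  by_contra! hlt
  refine hball (mem_ball_zero_iff.2 hlt) ?_
  by_cases hxs : x ∈ tsupport fun x => Ψ x - c
  · exact Or.inl ⟨x, ⟨hxs, hx⟩, rfl⟩
  · exact Or.inr (sub_eq_zero.1 (image_eq_zero_of_notMem_tsupport (f := fun x => Ψ x - c) hxs))

/-- A `C¹` self-map of `ℝⁿ` which is constant near infinity cannot have the origin as its only
zero while being the identity near the origin. -/
theorem false_of_contDiff_of_eventually_eq_id {ι : Type*} [Fintype ι] [Nonempty ι]
    {Ψ : (ι → ℝ) → ι → ℝ} (hΨ : ContDiff ℝ 1 Ψ) {c : ι → ℝ} (hc : c ≠ 0)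
    (hsupp : HasCompactSupport fun x => Ψ x - c) (hid : ∀ᶠ x in 𝓝 0, Ψ x = x)
    (hzero : ∀ x, Ψ x = 0 → x = 0) : False := by
  classical
  obtain ⟨r, hr, hball⟩ := Metric.eventually_nhds_iff_ball.1 hid
  obtain ⟨δ, hδ, hδle⟩ := hsupp.exists_pos_le_norm_of_sub_const hΨ.continuous hc
    (Metric.isOpen_ball (x := (0 : ι → ℝ)) (ε := r)) fun x hx => by
      rw [hzero x hx]; exact Metric.mem_ball_self hr
  let b : ℝ → ℝ := fun t => max 0 (δ - |t|)
  have hb : Continuous b := by fun_prop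
  have hb0 : ∀ t, 0 ≤ b t := fun t => le_max_left _ _
  let σ : ℝ → ℝ := fun t => ∫ u in (0 : ℝ)..t, b u
  have hσ : ∀ t, HasDerivAt σ (b t) t := fun t => (hb.integral_hasStrictDerivAt 0 t).hasDerivAt
  have hσ1 : ContDiff ℝ 1 σ := by
    rw [contDiff_one_iff_deriv]
    refine ⟨fun t => (hσ t).differentiableAt, ?_⟩
    rwa [show deriv σ = b from funext fun t => (hσ t).deriv]
  let k : (ι → ℝ) → ι → ℝ := fun x i => σ (Ψ x i) - σ (c i)
  have hk : ContDiff ℝ 1 k :=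
    contDiff_pi.2 fun i => (hσ1.comp (contDiff_pi.1 hΨ i)).sub contDiff_const
  have hksupp : HasCompactSupport k := by
    refine HasCompactSupport.intro hsupp fun x hx => ?_
    have : Ψ x = c :=
      sub_eq_zero.1 (image_eq_zero_of_notMem_tsupport (f := fun x => Ψ x - c) hx)
    ext i
    simp [k, this]
  have hderiv : ∀ x, (fderiv ℝ k x).det = (∏ i, b (Ψ x i)) * (fderiv ℝ Ψ x).det := by
    intro x
    have hΨx := (hΨ.differentiable one_ne_zero x).hasFDerivAt
    have h1 : HasFDerivAt k ((ContinuousLinearMap.pi fun i =>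
        b (Ψ x i) • ContinuousLinearMap.proj (R := ℝ) (φ := fun _ : ι => ℝ) i) ∘L
          fderiv ℝ Ψ x) x := by
      refine hasFDerivAt_pi'' fun i => ?_
      have := (hσ (Ψ x i)).comp_hasFDerivAt x ((hasFDerivAt_pi'.1 hΨx) i)
      refine (this.sub_const (σ (c i))).congr_fderiv ?_
      ext v
      simp
    rw [h1.fderiv]
    have h2 : (ContinuousLinearMap.pi fun i =>
        b (Ψ x i) • ContinuousLinearMap.proj (R := ℝ) (φ := fun _ : ι => ℝ) i).det =
          ∏ i, b (Ψ x i) := by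
      rw [ContinuousLinearMap.det, ← LinearMap.det_toMatrix', ← Matrix.det_diagonal]
      congr 1
      ext i j
      simp [LinearMap.toMatrix'_apply, Matrix.diagonal_apply, Pi.single_apply]
    rw [← h2, ContinuousLinearMap.det, ContinuousLinearMap.det, ContinuousLinearMap.det,
      ← LinearMap.det_comp]
    rfl
  have hpos : 0 < ∫ x, (fderiv ℝ k x).det := by
    have hcont : Continuous fun x => (fderiv ℝ k x).det :=
      ContinuousLinearMap.continuous_det.comp (hk.continuous_fderiv one_ne_zero)
    have hfid : ∀ x ∈ Metric.ball (0 : ι → ℝ) r, (fderiv ℝ Ψ x).det = 1 := fun x hx => by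
      have : Ψ =ᶠ[𝓝 x] id := by
        filter_upwards [Metric.isOpen_ball.mem_nhds hx] with y hy using hball y hy
      rw [this.fderiv_eq, fderiv_id, ContinuousLinearMap.det]
      exact LinearMap.det_id
    refine hcont.integral_pos_of_hasCompactSupport_nonneg_nonzero (x := 0) ?_ (fun x => ?_) ?_
    · refine HasCompactSupport.intro hksupp fun x hx => ?_
      have : fderiv ℝ k x = 0 := image_eq_zero_of_notMem_tsupport fun h' =>
        hx (tsupport_fderiv_subset ℝ h')
      rw [this, ContinuousLinearMap.det, ContinuousLinearMap.toLinearMap_zero, LinearMap.det_zero]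
      simp
    · by_cases hx : x ∈ Metric.ball (0 : ι → ℝ) r
      · simp only [Pi.zero_apply, hderiv, hfid x hx, mul_one]
        exact Finset.prod_nonneg fun i _ => hb0 _
      · obtain ⟨i, hi⟩ : ∃ i, δ ≤ ‖Ψ x i‖ := by
          by_contra! h
          exact (hδle x hx).not_gt ((pi_norm_lt_iff hδ).2 h)
        have : b (Ψ x i) = 0 := by
          rw [Real.norm_eq_abs] at hi
          simp [b, hi]
        have h0 : ∏ i, b (Ψ x i) = 0 := Finset.prod_eq_zero (Finset.mem_univ i) this
        simp [hderiv, h0]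
    · have h0 := Metric.mem_ball_self (x := (0 : ι → ℝ)) hr
      rw [hderiv, hfid 0 h0, hball 0 h0, mul_one]
      exact (Finset.prod_pos fun i _ => by simp [b, hδ]).ne'
  exact hpos.ne' (integral_det_fderiv_eq_zero_of_hasCompactSupport volume hk hksupp)

/-- A continuous self-map of a finite-dimensional space which is constant near infinity cannot have
`q` as its only zero while being the translation by `-q` near `q`. -/
theorem false_of_continuous_of_eventually_eq_sub [Nontrivial E] {Ψ : E → E} (hΨ : Continuous Ψ)
    {c q : E} (hc : c ≠ 0) (hsupp : HasCompactSupport fun x => Ψ x - c)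
    (hid : ∀ᶠ x in 𝓝 q, Ψ x = x - q) (hzero : ∀ x, Ψ x = 0 → x = q) : False := by
  obtain ⟨r, hr, hball⟩ := Metric.eventually_nhds_iff_ball.1 hid
  obtain ⟨δ, hδ, hδle⟩ := hsupp.exists_pos_le_norm_of_sub_const hΨ hc
    (Metric.isOpen_ball (x := q) (ε := r / 2)) fun x hx => by
      rw [hzero x hx]; exact Metric.mem_ball_self (by positivity)
  have hsmooth : ContDiffOn ℝ 1 (fun x => Ψ x - c) (Metric.ball q r) := by
    have : ContDiffOn ℝ 1 (fun x : E => x - q - c) (Metric.ball q r) := by fun_prop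
    exact this.congr fun x hx => by rw [hball x hx]
  obtain ⟨g, hg, hgdist, hgeq, hgsupp⟩ :=
    Continuous.exists_contDiff_approx_and_eqOn (f := fun x => Ψ x - c) (ε := fun _ => δ) 1
      (hΨ.sub continuous_const)
      continuous_const (fun _ => hδ) (Metric.isClosed_closedBall (x := q) (ε := r / 2))
      (Metric.isOpen_ball.mem_nhdsSet.2
        (Metric.closedBall_subset_ball (half_lt_self hr))) hsmooth
  have hgid : ∀ x ∈ Metric.closedBall q (r / 2), g x + c = x - q := fun x hx => by
    rw [hgeq hx, sub_add_cancel (Ψ x) c,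
      hball x (Metric.closedBall_subset_ball (half_lt_self hr) hx)]
  let e : E ≃L[ℝ] (Fin (Module.finrank ℝ E) → ℝ) :=
    ContinuousLinearEquiv.ofFinrankEq (by simp)
  have : Nonempty (Fin (Module.finrank ℝ E)) := Fin.pos_iff_nonempty.1 Module.finrank_pos
  have ht : Tendsto (fun y => e.symm y + q) (𝓝 0) (𝓝 q) :=
    (by fun_prop : Continuous fun y => e.symm y + q).tendsto' 0 q (by simp)
  refine false_of_contDiff_of_eventually_eq_id (Ψ := fun y => e (g (e.symm y + q) + c))
    (c := e c) ?_ (by simpa using hc) ?_ ?_ fun y hy => ?_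
  · have : ContDiff ℝ 1 g := hg
    fun_prop
  · have hgc : HasCompactSupport g := hsupp.mono' (hgsupp.trans (subset_tsupport _))
    have h1 : HasCompactSupport fun y => g (e.symm y + q) :=
      hgc.comp_homeomorph (e.symm.toHomeomorph.trans (Homeomorph.addRight q))
    have h2 := h1.comp_left (g := e) (map_zero e)
    refine h2.mono fun y hy => ?_
    simpa using hy
  · filter_upwards [ht (Metric.closedBall_mem_nhds q (half_pos hr))] with y hy
    rw [hgid _ hy]
    simp
  · have hy' : g (e.symm y + q) + c = 0 := e.map_eq_zero_iff.1 hy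
    have hmem : e.symm y + q ∈ Metric.ball q (r / 2) := by
      by_contra h
      have h1 := hδle _ h
      have h2 := hgdist (e.symm y + q)
      rw [dist_eq_norm] at h2
      have h3 : g (e.symm y + q) - (Ψ (e.symm y + q) - c) = -Ψ (e.symm y + q) := by
        rw [eq_neg_of_add_eq_zero_left hy']
        abel
      rw [h3, norm_neg] at h2
      exact h1.not_gt h2
    rw [hgid _ (Metric.ball_subset_closedBall hmem)] at hy'
    simpa using hy'

end FiniteDimensional

section LeraySchauder

/-- A compact perturbation of the identity is bounded away from zero on a closed bounded set
containing none of its zeros. -/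
theorem exists_pos_le_norm_fst_add {X : Type*} [NormedAddCommGroup X]
    {G : X × ℝ → X} {A D : Set (X × ℝ)}
    (hA : IsClosed A) (hD : IsOpen D) (hAD : A ⊆ D) (hb : Bornology.IsBounded D)
    (hG : ContinuousOn G D) (hGc : IsCompact (closure (G '' D))) (hzero : ∀ p ∈ A, p.1 + G p ≠ 0) :
    ∃ ε > 0, ∀ p ∈ A, ε ≤ ‖p.1 + G p‖ := by
  by_contra! h
  choose p hpA hp using fun n : ℕ => h (1 / (n + 1)) Nat.one_div_pos_of_nat
  have hlim : Tendsto (fun n => (p n).1 + G (p n)) atTop (𝓝 0) :=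
    squeeze_zero_norm (fun n => (hp n).le) tendsto_one_div_add_atTop_nhds_zero_nat
  have hcomp := hGc.prod (hb.image_snd.isCompact_closure)
  obtain ⟨⟨y, κ⟩, -, φ, hφ, hyκ⟩ := hcomp.tendsto_subseq (x := fun n => (G (p n), (p n).2))
    fun n => ⟨subset_closure ⟨p n, hAD (hpA n), rfl⟩, subset_closure ⟨p n, hAD (hpA n), rfl⟩⟩
  have hy : Tendsto (fun n => G (p (φ n))) atTop (𝓝 y) := (continuous_fst.tendsto _).comp hyκ
  have hκ : Tendsto (fun n => (p (φ n)).2) atTop (𝓝 κ) := (continuous_snd.tendsto _).comp hyκ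
  have hξ : Tendsto (fun n => (p (φ n)).1) atTop (𝓝 (-y)) := by
    simpa using (hlim.comp hφ.tendsto_atTop).sub hy
  have hpφ : Tendsto (fun n => p (φ n)) atTop (𝓝 (-y, κ)) := hξ.prodMk_nhds hκ
  have hmem : (-y, κ) ∈ A := hA.mem_of_tendsto hpφ (Eventually.of_forall fun n => hpA _)
  have hGy : G (-y, κ) = y := tendsto_nhds_unique
    ((hG.continuousAt (hD.mem_nhds (hAD hmem))).tendsto.comp hpφ) hy
  exact hzero _ hmem (by simp [hGy])

variable {X : Type*} [NormedAddCommGroup X] [NormedSpace ℝ X]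

/-- **Schauder approximation**: the identity of a compact set is uniformly approximated by
continuous maps with values in finite-dimensional subspaces. -/
theorem IsCompact.exists_finiteDimensional_approx {C : Set X} (hC : IsCompact C) {ε : ℝ}
    (hε : 0 < ε) :
    ∃ (V : Submodule ℝ X) (P : X → X), FiniteDimensional ℝ V ∧ (∀ y, P y ∈ V) ∧
      ContinuousOn P C ∧ ∀ y ∈ C, ‖P y - y‖ < ε := by
  obtain ⟨t, -, ht, hCt⟩ := hC.finite_cover_balls hε
  lift t to Finset X using ht
  let w : X → X → ℝ := fun i y => max 0 (ε - dist y i)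
  have hw : ∀ i, Continuous (w i) := fun i => by fun_prop
  have hw0 : ∀ i y, 0 ≤ w i y := fun i y => le_max_left _ _
  have hpos : ∀ y ∈ C, ∃ i ∈ t, 0 < w i y := fun y hy => by
    obtain ⟨i, hi, hyi⟩ := Set.mem_iUnion₂.1 (hCt hy)
    exact ⟨i, hi, lt_max_of_lt_right (sub_pos.2 hyi)⟩
  have hsum : ∀ y ∈ C, 0 < ∑ i ∈ t, w i y := fun y hy =>
    Finset.sum_pos' (fun i _ => hw0 i y) (hpos y hy)
  refine ⟨Submodule.span ℝ t, fun y => (∑ i ∈ t, w i y)⁻¹ • ∑ i ∈ t, w i y • i,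
    inferInstance, fun y => ?_, ?_, fun y hy => ?_⟩
  · exact Submodule.smul_mem _ _ (Submodule.sum_mem _ fun i hi =>
      Submodule.smul_mem _ _ (Submodule.subset_span hi))
  · refine ContinuousOn.smul (ContinuousOn.inv₀ ?_ fun y hy => (hsum y hy).ne') ?_
    · exact (continuous_finsetSum _ fun i _ => hw i).continuousOn
    · exact (continuous_finsetSum _ fun i _ => (hw i).smul continuous_const).continuousOn
  · have h1 : (∑ i ∈ t, w i y)⁻¹ • ∑ i ∈ t, w i y • i - y =
        (∑ i ∈ t, w i y)⁻¹ • ∑ i ∈ t, w i y • (i - y) := by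
      simp_rw [smul_sub, Finset.sum_sub_distrib, ← Finset.sum_smul, smul_sub]
      rw [inv_smul_smul₀ (hsum y hy).ne']
    rw [h1, norm_smul, norm_inv, Real.norm_of_nonneg (hsum y hy).le,
      inv_mul_lt_iff₀ (hsum y hy), Finset.sum_mul]
    refine (norm_sum_le _ _).trans_lt ?_
    have hle : ∀ i, 0 < w i y → ‖w i y • (i - y)‖ < w i y * ε := fun i hi => by
      rw [norm_smul, Real.norm_of_nonneg hi.le, ← dist_eq_norm, dist_comm]
      have : 0 < ε - dist y i := by simpa [w] using hi
      exact mul_lt_mul_of_pos_left (sub_pos.1 this) hi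
    obtain ⟨i, hi, hi0⟩ := hpos y hy
    refine Finset.sum_lt_sum (fun j _ => ?_) ⟨i, hi, hle i hi0⟩
    rcases (hw0 j y).eq_or_lt with h | h
    · simp [← h]
    · exact (hle j h).le

/-- The degree-theoretic core: for a compact perturbation of the identity `p ↦ p.1 + G p` there is
no compactly supported cutoff `ρ` along its zero set that crosses the level `1 / 2` at exactly
one point, transversally. -/
theorem false_of_cutoff_crossing_once {G : X × ℝ → X} {ρ : X × ℝ → ℝ} {q : X × ℝ} {a : ℝ}
    (ha : a ≠ 0) (hρ : Continuous ρ) (hb : Bornology.IsBounded {p | ρ p ≠ 0})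
    (hG : ContinuousOn G {p | ρ p ≠ 0}) (hGc : IsCompact (closure (G '' {p | ρ p ≠ 0})))
    (hq : ∀ᶠ p in 𝓝 q, G p = -q.1 ∧ ρ p = 1 / 2 + a * (p.2 - q.2))
    (hzero : ∀ p, ρ p = 1 / 2 → p.1 + G p = 0 → p = q) : False := by
  have hD : IsOpen {p | ρ p ≠ 0} := isOpen_ne_fun hρ continuous_const
  have hρq : ρ q = 1 / 2 := by simpa using hq.self_of_nhds.2
  have hGq : G q = -q.1 := hq.self_of_nhds.1
  have hq' : ∀ᶠ p in 𝓝 q, G p = -q.1 ∧ ρ p = 1 / 2 + a * (p.2 - q.2) ∧ 1 / 4 < ρ p := by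
    have : ∀ᶠ p in 𝓝 q, 1 / 4 < ρ p :=
      continuousAt_const.eventually_lt hρ.continuousAt (by rw [hρq]; norm_num)
    filter_upwards [hq, this] with p h1 h2 using ⟨h1.1, h1.2, h2⟩
  obtain ⟨r, hr, hball⟩ := Metric.eventually_nhds_iff_ball.1 hq'
  obtain ⟨ε, hε, hεle⟩ := exists_pos_le_norm_fst_add (A := {p | ρ p = 1 / 2} \ Metric.ball q r)
    ((isClosed_eq hρ continuous_const).sdiff Metric.isOpen_ball) hD
    (fun p hp => by simp [show ρ p = 1 / 2 from hp.1]) hb hG hGc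
    fun p hp h0 => hp.2 (hzero p hp.1 h0 ▸ Metric.mem_ball_self hr)
  obtain ⟨V, P, hV, hPV, hP, hPε⟩ := hGc.exists_finiteDimensional_approx (half_pos hε)
  have hC : ∀ p, ρ p ≠ 0 → G p ∈ closure (G '' {p | ρ p ≠ 0}) :=
    fun p hp => subset_closure ⟨p, hp, rfl⟩
  have hqC : -q.1 ∈ closure (G '' {p | ρ p ≠ 0}) := hGq ▸ hC q (by rw [hρq]; norm_num)
  let V' : Submodule ℝ X := V ⊔ Submodule.span ℝ {q.1}
  have hq1 : q.1 ∈ V' := Submodule.mem_sup_right (Submodule.mem_span_singleton_self _)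
  let Q : X → V' := fun y => ⟨P y - P (-q.1) - q.1,
    sub_mem (sub_mem (Submodule.mem_sup_left (hPV _)) (Submodule.mem_sup_left (hPV _))) hq1⟩
  have hQ : ContinuousOn Q (closure (G '' {p | ρ p ≠ 0})) :=
    continuousOn_iff_continuous_domRestrict.2 (Continuous.subtype_mk
      (continuousOn_iff_continuous_domRestrict.1
        ((hP.sub continuousOn_const).sub continuousOn_const)) _)
  have hQε : ∀ y ∈ closure (G '' {p | ρ p ≠ 0}), ‖(Q y : X) - y‖ < ε := fun y hy => by
    have h1 : (Q y : X) - y = (P y - y) - (P (-q.1) - -q.1) := by simp only [Q]; abel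
    rw [h1]
    exact (norm_sub_le _ _).trans_lt (by linarith [hPε y hy, hPε _ hqC])
  have hQq : Q (-q.1) = -⟨q.1, hq1⟩ := by ext; simp [Q]
  let j : V' × ℝ → X × ℝ := fun x => ((x.1 : X), x.2)
  have hj : Continuous j := by fun_prop
  let ζ : ℝ → ℝ := fun s => max 0 (min 1 (8 * s - 1))
  have hζ : Continuous ζ := by fun_prop
  have hζ1 : ∀ s, 1 / 4 < s → ζ s = 1 := fun s hs => by
    simp only [ζ]; rw [min_eq_left (by linarith)]; norm_num
  have hζ0 : ∀ s, s ≤ 1 / 8 → ζ s = 0 := fun s hs => by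
    simp only [ζ]; exact max_eq_left ((min_le_right _ _).trans (by linarith))
  let Ψ : V' × ℝ → V' × ℝ := fun x =>
    (ζ (ρ (j x)) • (x.1 + Q (G (j x))), a⁻¹ * (ρ (j x) - 1 / 2))
  have hΨ : Continuous Ψ := by
    refine Continuous.prodMk (continuous_iff_continuousAt.2 fun x => ?_) (by fun_prop)
    rcases lt_or_ge (ρ (j x)) (1 / 8) with hx | hx
    · have : (fun x : V' × ℝ => ζ (ρ (j x)) • (x.1 + Q (G (j x)))) =ᶠ[𝓝 x] fun _ => 0 := by
        filter_upwards [((hρ.comp hj).continuousAt.eventually_lt continuousAt_const hx)] with y hy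
        rw [hζ0 (ρ (j y)) (le_of_lt hy), zero_smul]
      exact continuousAt_const.congr this.symm
    · have hne : ρ (j x) ≠ 0 := by linarith
      have h1 : ContinuousAt (fun p => Q (G p)) (j x) :=
        (hQ.comp hG fun p hp => hC p hp).continuousAt (hD.mem_nhds hne)
      have h2 : ContinuousAt (fun x => Q (G (j x))) x := h1.comp hj.continuousAt
      exact (hζ.comp (hρ.comp hj)).continuousAt.smul (continuousAt_fst.add h2)
  refine false_of_continuous_of_eventually_eq_sub (q := (⟨q.1, hq1⟩, q.2)) hΨ
    (c := (0, a⁻¹ * (0 - 1 / 2))) ?_ ?_ ?_ fun x hx => ?_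
  · simp [ha]
  · obtain ⟨R, hR⟩ := hb.subset_closedBall 0
    refine HasCompactSupport.intro (isCompact_closedBall (0 : V' × ℝ) R) fun x hx => ?_
    have h0 : ρ (j x) = 0 := by
      by_contra hne
      refine hx ?_
      have := hR hne
      simpa [Prod.norm_def, j] using this
    simp [Ψ, h0, hζ0]
  · have htend : Tendsto j (𝓝 (⟨q.1, hq1⟩, q.2)) (𝓝 q) := hj.tendsto' _ _ rfl
    filter_upwards [htend (Metric.ball_mem_nhds q hr)] with x hx
    obtain ⟨h1, h2, h3⟩ := hball _ hx
    refine Prod.ext ?_ ?_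
    · simp only [Ψ]
      rw [hζ1 _ h3, one_smul, h1, hQq, Prod.fst_sub, sub_eq_add_neg]
    · simp only [Ψ]
      rw [h2, add_sub_cancel_left, inv_mul_cancel_left₀ ha]
      rfl
  · have h2 : ρ (j x) = 1 / 2 := by
      have : a⁻¹ * (ρ (j x) - 1 / 2) = 0 := congrArg Prod.snd hx
      rcases mul_eq_zero.1 this with h | h
      · exact absurd h (inv_ne_zero ha)
      · exact sub_eq_zero.1 h
    have h1 : x.1 + Q (G (j x)) = 0 := by
      have : ζ (ρ (j x)) • (x.1 + Q (G (j x))) = 0 := congrArg Prod.fst hx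
      rwa [hζ1 _ (by rw [h2]; norm_num), one_smul] at this
    by_cases hx' : j x ∈ Metric.ball q r
    · obtain ⟨h3, h4, -⟩ := hball _ hx'
      rw [h3, hQq, ← sub_eq_add_neg, sub_eq_zero] at h1
      refine Prod.ext h1 ?_
      have h5 : a * ((j x).2 - q.2) = 0 := by linarith
      rcases mul_eq_zero.1 h5 with h | h
      · exact absurd h ha
      · exact sub_eq_zero.1 h
    · exfalso
      have h3 := hεle _ ⟨h2, hx'⟩
      have h4 := hQε _ (hC (j x) (by rw [h2]; norm_num))
      have h5 : (j x).1 + G (j x) = -((Q (G (j x)) : X) - G (j x)) := by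
        have : (j x).1 = -(Q (G (j x)) : X) :=
          congrArg Subtype.val (eq_neg_of_add_eq_zero_left h1)
        rw [this]; abel
      rw [h5, norm_neg] at h3
      exact h3.not_gt h4

end LeraySchauder

section Separation

/-- A component of a compact set that misses a closed set `Y` can be separated from `Y`
by a splitting of the compact set into two disjoint compact pieces. -/
theorem IsCompact.exists_isCompact_union_eq_of_disjoint_connectedComponentIn {α : Type*}
    [TopologicalSpace α] [T2Space α] {Z Y : Set α} (hZ : IsCompact Z) (hY : IsClosed Y) {x : α}
    (hx : x ∈ Z) (hxY : Disjoint (connectedComponentIn Z x) Y) :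
    ∃ N N' : Set α, IsCompact N ∧ IsCompact N' ∧ Disjoint N N' ∧ N ∪ N' = Z ∧ x ∈ N ∧
      Disjoint N Y := by
  have : CompactSpace Z := isCompact_iff_compactSpace.1 hZ
  let x' : Z := ⟨x, hx⟩
  have hcomp : connectedComponent x' ⊆ ((↑) ⁻¹' Y : Set Z)ᶜ := fun z hz hzY =>
    Set.disjoint_left.1 hxY
      (by rw [connectedComponentIn_eq_image hx]; exact ⟨z, hz, rfl⟩) hzY
  rw [connectedComponent_eq_iInter_isClopen] at hcomp
  have hdir : Directed (· ⊇ ·) fun s : { s : Set Z // IsClopen s ∧ x' ∈ s } => s.1 :=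
    fun s t => ⟨⟨s.1 ∩ t.1, s.2.1.inter t.2.1, s.2.2, t.2.2⟩,
      Set.inter_subset_left, Set.inter_subset_right⟩
  have : Nonempty { s : Set Z // IsClopen s ∧ x' ∈ s } := ⟨⟨Set.univ, isClopen_univ, trivial⟩⟩
  obtain ⟨⟨s, hs, hxs⟩, hsY⟩ := exists_subset_nhds_of_compactSpace hdir (fun s => s.2.1.isClosed)
    fun z hz => (hY.preimage continuous_subtype_val).isOpen_compl.mem_nhds (hcomp hz)
  refine ⟨(↑) '' s, (↑) '' sᶜ, hs.isClosed.isCompact.image continuous_subtype_val,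
    hs.compl.isClosed.isCompact.image continuous_subtype_val,
    (Set.disjoint_image_iff Subtype.val_injective).2 disjoint_compl_right, ?_, ⟨x', hxs, rfl⟩, ?_⟩
  · rw [← Set.image_union, Set.union_compl_self, Set.image_univ, Subtype.range_coe]
  · rw [Set.disjoint_left]
    rintro _ ⟨z, hz, rfl⟩ hzY
    exact hsY hz hzY

/-- If a connected set with a point `x` deleted is separated by `u` and `v` and its part close
to `x` lies in `u`, then all of it lies in `u`. -/
theorem IsPreconnected.diff_singleton_subset_of_separated {α : Type*} [TopologicalSpace α]
    [T1Space α] {Q u v W : Set α} {x : α} (hQ : IsPreconnected Q) (hx : x ∈ Q) (hu : IsOpen u)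
    (hv : IsOpen v) (hW : IsOpen W) (hxW : x ∈ W) (huv : Q \ {x} ⊆ u ∪ v)
    (hdisj : ∀ y ∈ Q \ {x}, y ∈ u → y ∉ v) (hQW : ∀ y ∈ Q \ {x}, y ∈ W → y ∈ u) :
    Q \ {x} ⊆ u := by
  intro y hy
  refine (huv hy).resolve_right fun hyv => ?_
  have hcover : Q ⊆ (u ∪ W) ∪ v \ {x} := fun z hz => by
    by_cases hzx : z = x
    · exact Or.inl (Or.inr (hzx ▸ hxW))
    · exact (huv ⟨hz, hzx⟩).imp Or.inl fun h => ⟨h, hzx⟩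
  obtain ⟨z, hzQ, hzu, hzv, hzx⟩ := hQ (u ∪ W) (v \ {x}) (hu.union hW)
    (hv.sdiff isClosed_singleton) hcover ⟨x, hx, Or.inr hxW⟩ ⟨y, hy.1, hyv, hy.2⟩
  exact hdisj z ⟨hzQ, hzx⟩ (hzu.elim id (hQW z ⟨hzQ, hzx⟩)) hzv

end Separation

section HalfBranch

variable {X : Type*} [NormedAddCommGroup X] [NormedSpace ℝ X]

/-- The zero set of a compact perturbation of the identity in a bounded open set `Ω` cannot
consist of a compact set `N ⊆ Ω`, a closed set `N'` and a single branch over a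
parameter interval `[a, d]` which leads from `N'` to `N`. -/
theorem false_of_single_branch {G : X × ℝ → X} {Ω N N' : Set (X × ℝ)} {x ξ : X} {r a b c d : ℝ}
    (hΩ : IsOpen Ω) (hb : Bornology.IsBounded Ω) (hG : ContinuousOn G Ω)
    (hGc : IsCompact (closure (G '' Ω))) (hab : a < b) (hbc : b < c) (hcd : c < d)
    (hbox : Metric.closedBall x r ×ˢ Set.Icc a d ⊆ Ω)
    (hLip : ∀ κ ∈ Set.Icc a d, ∀ y ∈ Metric.closedBall x r, ∀ z ∈ Metric.closedBall x r,
      ‖G (y, κ) - G (z, κ)‖ ≤ 1 / 2 * ‖y - z‖)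
    (hξ : ξ ∈ Metric.ball x r) (hGξ : G (ξ, (b + c) / 2) = -ξ)
    (hN : IsClosed N) (hNΩ : N ⊆ Ω) (hN' : IsClosed N') (hNN' : Disjoint N N')
    (hNbox : Disjoint N (Metric.closedBall x r ×ˢ Set.Icc a c))
    (hN'box : Disjoint N' (Metric.closedBall x r ×ˢ Set.Icc b d))
    (hcover : ∀ p ∈ Ω, p.1 + G p = 0 →
      p ∈ N ∨ p ∈ N' ∨ p ∈ Metric.closedBall x r ×ˢ Set.Icc a d) : False := by
  have hbd : Metric.closedBall x r ×ˢ Set.Icc b d ⊆ Ω :=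
    (Set.prod_mono_right (Set.Icc_subset_Icc_left hab.le)).trans hbox
  have hclosed : ∀ s t : ℝ, IsClosed (Metric.closedBall x r ×ˢ Set.Icc s t) :=
    fun s t => Metric.isClosed_closedBall.prod isClosed_Icc
  set q : X × ℝ := (ξ, (b + c) / 2) with hq
  obtain ⟨u, hu0, hu1, hu⟩ := exists_continuous_zero_one_of_isClosed
    (s := N' ∪ Ωᶜ) (t := N ∪ Metric.closedBall x r ×ˢ Set.Icc b d)
    (hN'.union hΩ.isClosed_compl) (hN.union (hclosed b d)) (by
      rw [Set.disjoint_union_left, Set.disjoint_union_right, Set.disjoint_union_right]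
      exact ⟨⟨hNN'.symm, hN'box⟩, Set.disjoint_compl_left_iff_subset.2 hNΩ,
        Set.disjoint_compl_left_iff_subset.2 hbd⟩)
  obtain ⟨w, hw0, hw1, hw⟩ := exists_continuous_zero_one_of_isClosed (hclosed a c) hN hNbox.symm
  have hqbox : q ∈ Metric.ball x r ×ˢ Set.Ioo b c :=
    ⟨hξ, by simp only [hq]; linarith, by simp only [hq]; linarith⟩
  have hopen : IsOpen (Metric.ball x r ×ˢ Set.Ioo b c) := Metric.isOpen_ball.prod isOpen_Ioo
  obtain ⟨s, hs, hsbox⟩ := Metric.nhds_basis_closedBall.mem_iff.1 (hopen.mem_nhds hqbox)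
  obtain ⟨η, hη0, hη1, hη⟩ := exists_continuous_zero_one_of_isClosed hopen.isClosed_compl
    Metric.isClosed_closedBall (Set.disjoint_compl_left_iff_subset.2 hsbox)
  let ramp : ℝ → ℝ := fun κ => max 0 (min 1 ((κ - b) / (c - b)))
  have hramp0 : ∀ κ ≤ b, ramp κ = 0 := fun κ hκ => max_eq_left ((min_le_right _ _).trans
    (div_nonpos_of_nonpos_of_nonneg (by linarith) (by linarith)))
  have hramp1 : ∀ κ ≥ c, ramp κ = 1 := fun κ hκ => by
    have : 1 ≤ (κ - b) / (c - b) := (one_le_div (by linarith)).2 (by linarith)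
    simp [ramp, min_eq_left this]
  have hramp : ∀ κ ∈ Set.Icc b c, ramp κ = (κ - b) / (c - b) := fun κ hκ => by
    have h1 : (κ - b) / (c - b) ≤ 1 := (div_le_one (by linarith)).2 (by linarith [hκ.2])
    have h2 : 0 ≤ (κ - b) / (c - b) := div_nonneg (by linarith [hκ.1]) (by linarith)
    simp [ramp, min_eq_right h1, max_eq_right h2]
  let ρ : X × ℝ → ℝ := fun p => u p * max (ramp p.2) (w p)
  have hρΩ : {p | ρ p ≠ 0} ⊆ Ω := fun p hp => by
    by_contra h
    exact hp (by simp [ρ, hu0 (Or.inr h)])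
  have hρbox : ∀ p ∈ Metric.closedBall x r ×ˢ Set.Icc b c, ρ p = (p.2 - b) / (c - b) := by
    intro p hp
    have h1 : u p = 1 := hu1 (Or.inr ⟨hp.1, hp.2.1, hp.2.2.trans hcd.le⟩)
    have h2 : w p = 0 := hw0 ⟨hp.1, hab.le.trans hp.2.1, hp.2.2⟩
    have h3 : 0 ≤ (p.2 - b) / (c - b) := div_nonneg (by linarith [hp.2.1]) (by linarith)
    simp [ρ, h1, h2, hramp _ hp.2, h3]
  let H : X × ℝ → X := fun p => (1 - η p) • G p + η p • (-ξ)
  have hball : Metric.ball x r ×ˢ Set.Ioo b c ⊆ Metric.closedBall x r ×ˢ Set.Icc b c :=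
    Set.prod_mono Metric.ball_subset_closedBall Set.Ioo_subset_Icc_self
  have hlevel : ∀ p ∈ Metric.closedBall x r ×ˢ Set.Icc b c, ρ p = 1 / 2 →
      p.1 + H p = 0 → p = q := by
    rintro ⟨y, κ⟩ hp hρp hHp
    rw [hρbox _ hp, div_eq_iff (by linarith)] at hρp
    obtain rfl : κ = (b + c) / 2 := by simp only at hρp; linarith
    have h1 := hLip _ ⟨hab.le.trans hp.2.1, hp.2.2.trans hcd.le⟩ y hp.1 ξ
      (Metric.ball_subset_closedBall hξ)
    have h2 : y - ξ = -((1 - η (y, (b + c) / 2)) • (G (y, (b + c) / 2) - G q)) := by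
      rw [← sub_eq_zero, ← hHp, hGξ]
      simp only [H]
      module
    have h3 : ‖y - ξ‖ ≤ 1 / 2 * ‖y - ξ‖ := by
      conv_lhs => rw [h2]
      rw [norm_neg, norm_smul]
      refine (mul_le_of_le_one_left (norm_nonneg _) ?_).trans h1
      rw [Real.norm_of_nonneg (sub_nonneg.2 (hη _).2)]
      linarith [(hη (y, (b + c) / 2)).1]
    have h4 : y - ξ = 0 := norm_le_zero_iff.1 (by linarith)
    rw [sub_eq_zero.1 h4]
  refine false_of_cutoff_crossing_once (G := H) (ρ := ρ) (q := q) (a := (c - b)⁻¹)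
    (inv_ne_zero (by linarith)) (by fun_prop) (hb.subset hρΩ) ?_ ?_ ?_ fun p hρp hHp => ?_
  · exact (ContinuousOn.smul (by fun_prop) (hG.mono hρΩ)).add (by fun_prop)
  · have hcont : Continuous fun z : ℝ × X => (1 - z.1) • z.2 + z.1 • (-ξ) := by fun_prop
    refine ((isCompact_Icc (a := (0 : ℝ)) (b := 1)).prod hGc |>.image hcont).closure_of_subset ?_
    rintro _ ⟨p, hp, rfl⟩
    exact ⟨(η p, G p), ⟨hη p, subset_closure ⟨p, hρΩ hp, rfl⟩⟩, rfl⟩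
  · filter_upwards [Metric.closedBall_mem_nhds q hs] with p hp
    refine ⟨by simp [H, hη1 hp, hq], ?_⟩
    rw [hρbox _ (hball (hsbox hp))]
    have : c - b ≠ 0 := by linarith
    field_simp
    simp only [hq]
    ring
  · by_cases hbox' : p ∈ Metric.closedBall x r ×ˢ Set.Icc b c
    · exact hlevel p hbox' hρp hHp
    exfalso
    have hη : η p = 0 := hη0 fun h => hbox' (hball h)
    have hGp : p.1 + G p = 0 := by simpa [H, hη] using hHp
    rcases hcover p (hρΩ (by simp [hρp])) hGp with h | h | ⟨h, h'⟩
    · have : ramp p.2 ≤ 1 := max_le zero_le_one (min_le_left _ _)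
      simp [ρ, hu1 (Or.inl h), hw1 h, this] at hρp
    · simp [ρ, hu0 (Or.inl h)] at hρp
    · rcases lt_or_ge p.2 b with hκ | hκ
      · have : w p = 0 := hw0 ⟨h, h'.1, hκ.le.trans hbc.le⟩
        simp [ρ, hramp0 _ hκ.le, this] at hρp
      · have hκc : c < p.2 := lt_of_not_ge fun h2 => hbox' ⟨h, hκ, h2⟩
        have : u p = 1 := hu1 (Or.inr ⟨h, hκ, h'.2⟩)
        simp [ρ, hramp1 _ hκc.le, this, (hw p).2] at hρp

end HalfBranch

section GlobalContinuation

variable {X : Type*} [NormedAddCommGroup X]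

theorem add_eq_zero_of_mem_closure_zeros {U : Set (X × ℝ)} (hU : IsOpen U) {G : X × ℝ → X}
    (hG : ContinuousOn G U) {p : X × ℝ} (hp : p ∈ closure {p ∈ U | p.1 + G p = 0}) (hpU : p ∈ U) :
    p.1 + G p = 0 := by
  by_contra hne
  have hcont : ContinuousAt (fun p => p.1 + G p) p :=
    continuousAt_fst.add (hG.continuousAt (hU.mem_nhds hpU))
  obtain ⟨y, hy, hy'⟩ := ((mem_closure_iff_frequently.1 hp).and_eventually
    (hcont.eventually_ne hne)).exists
  exact hy' hy.2

theorem isCompact_closure_zeros_inter_closedBall {U : Set (X × ℝ)} {G : X × ℝ → X}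
    (hGc : ∀ s ⊆ U, Bornology.IsBounded s → IsCompact (closure (G '' s))) (R : ℝ) :
    IsCompact (closure {p ∈ U | p.1 + G p = 0} ∩ Metric.closedBall 0 R) := by
  set B : Set (X × ℝ) := Metric.ball 0 (R + 1)
  have hB : Bornology.IsBounded (U ∩ B) := Metric.isBounded_ball.subset Set.inter_subset_right
  have hcomp := (hGc _ Set.inter_subset_left hB).neg.prod hB.image_snd.isCompact_closure
  have hsub : {p ∈ U | p.1 + G p = 0} ∩ B ⊆
      (-closure (G '' (U ∩ B))) ×ˢ closure (Prod.snd '' (U ∩ B)) := by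
    rintro p ⟨⟨hpU, hp⟩, hpB⟩
    refine ⟨subset_closure ⟨p, ⟨hpU, hpB⟩, ?_⟩, subset_closure ⟨p, ⟨hpU, hpB⟩, rfl⟩⟩
    exact eq_neg_of_add_eq_zero_right hp
  refine (hcomp.closure_of_subset hsub).of_isClosed_subset
    (isClosed_closure.inter Metric.isClosed_closedBall) fun p hp => ?_
  exact Metric.isOpen_ball.closure_inter
    ⟨hp.1, Metric.closedBall_subset_ball (lt_add_one R) hp.2⟩

/-- If `G` is a contraction in its first variable, the zeros of `p ↦ p.1 + G p` close to a given
zero form the graph of a continuous function of the parameter. -/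
theorem exists_local_branch [CompleteSpace X] {G : X × ℝ → X} {V : Set (X × ℝ)} {p₀ : X × ℝ}
    (hV : V ∈ 𝓝 p₀) (hG : ContinuousOn G V) (hp₀ : p₀.1 + G p₀ = 0)
    (hLip : ∀ p ∈ V, ∀ q ∈ V, p.2 = q.2 → ‖G p - G q‖ ≤ 1 / 2 * ‖p.1 - q.1‖) :
    ∃ r > 0, ∃ δ > 0, ∃ φ : ℝ → X,
      Metric.closedBall p₀.1 r ×ˢ Set.Icc (p₀.2 - δ) (p₀.2 + δ) ⊆ V ∧
      ContinuousOn φ (Set.Icc (p₀.2 - δ) (p₀.2 + δ)) ∧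
      ∀ κ ∈ Set.Icc (p₀.2 - δ) (p₀.2 + δ), φ κ ∈ Metric.ball p₀.1 r ∧
        ∀ y ∈ Metric.closedBall p₀.1 r, y + G (y, κ) = 0 ↔ y = φ κ := by
  obtain ⟨r, hr, hrV⟩ := Metric.nhds_basis_closedBall.mem_iff.1 hV
  have hr' : ∀ y ∈ Metric.closedBall p₀.1 r, ∀ κ ∈ Metric.closedBall p₀.2 r, (y, κ) ∈ V :=
    fun y hy κ hκ => hrV (by rw [← closedBall_prod_same]; exact ⟨hy, hκ⟩)
  have hcont : ContinuousAt (fun κ : ℝ => G (p₀.1, κ)) p₀.2 :=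
    ContinuousAt.comp (f := fun κ : ℝ => (p₀.1, κ)) (hG.continuousAt hV) (by fun_prop)
  have hev : ∀ᶠ κ in 𝓝 p₀.2, ‖G (p₀.1, κ) - G p₀‖ < r / 4 := by
    simpa [dist_eq_norm] using hcont.eventually (Metric.ball_mem_nhds _ (by linarith : 0 < r / 4))
  obtain ⟨δ, hδ, hδ'⟩ := Metric.nhds_basis_closedBall.mem_iff.1
    (hev.and (Metric.closedBall_mem_nhds p₀.2 hr))
  rw [Real.closedBall_eq_Icc] at hδ'
  have hfix : ∀ κ ∈ Set.Icc (p₀.2 - δ) (p₀.2 + δ), ∃ z ∈ Metric.ball p₀.1 r,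
      ∀ y ∈ Metric.closedBall p₀.1 r, y + G (y, κ) = 0 ↔ y = z := by
    intro κ hκ
    obtain ⟨h1, h2⟩ := hδ' hκ
    have hL : ∀ y ∈ Metric.closedBall p₀.1 r, ∀ z ∈ Metric.closedBall p₀.1 r,
        ‖G (y, κ) - G (z, κ)‖ ≤ 1 / 2 * ‖y - z‖ :=
      fun y hy z hz => hLip _ (hr' y hy κ h2) _ (hr' z hz κ h2) rfl
    have hmaps : ∀ y ∈ Metric.closedBall p₀.1 r, -G (y, κ) ∈ Metric.ball p₀.1 r := by
      intro y hy
      have h3 := hL y hy _ (Metric.mem_closedBall_self hr.le)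
      rw [mem_closedBall_iff_norm] at hy
      rw [mem_ball_iff_norm, eq_neg_of_add_eq_zero_left hp₀, ← norm_neg]
      have h4 : -(-G (y, κ) - -G p₀) =
          (G (y, κ) - G (p₀.1, κ)) + (G (p₀.1, κ) - G p₀) := by abel
      rw [h4]
      exact (norm_add_le _ _).trans_lt (by linarith)
    have hmaps' : Set.MapsTo (fun y => -G (y, κ)) (Metric.closedBall p₀.1 r)
        (Metric.closedBall p₀.1 r) := fun y hy => Metric.ball_subset_closedBall (hmaps y hy)
    have hcontr : ContractingWith (1 / 2) (hmaps'.restrict _ _ _) := by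
      refine ⟨by rw [← NNReal.coe_lt_coe]; norm_num, LipschitzWith.of_dist_le_mul fun y z => ?_⟩
      have := hL y y.2 z z.2
      simpa [Subtype.dist_eq, dist_eq_norm, neg_add_eq_sub, norm_sub_rev] using this
    obtain ⟨z, hz, hzfix, -⟩ := hcontr.exists_fixedPoint' Metric.isClosed_closedBall.isComplete
      hmaps' (Metric.mem_closedBall_self hr.le) (edist_ne_top _ _)
    have hzG : G (z, κ) = -z := neg_eq_iff_eq_neg.1 hzfix
    refine ⟨z, by simpa [hzG] using hmaps z hz, fun y hy => ⟨fun h => ?_, ?_⟩⟩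
    · have h3 := hL y hy z hz
      have h4 : G (y, κ) - G (z, κ) = -(y - z) := by
        rw [eq_neg_of_add_eq_zero_right h, hzG]; abel
      rw [h4, norm_neg] at h3
      exact sub_eq_zero.1 (norm_le_zero_iff.1 (by linarith))
    · rintro rfl
      rw [hzG, add_neg_cancel]
  choose! φ hφ hφ' using hfix
  have hbox : Metric.closedBall p₀.1 r ×ˢ Set.Icc (p₀.2 - δ) (p₀.2 + δ) ⊆ V :=
    fun p hp => hr' p.1 hp.1 p.2 (hδ' hp.2).2
  have hφz : ∀ κ ∈ Set.Icc (p₀.2 - δ) (p₀.2 + δ), G (φ κ, κ) = -φ κ := fun κ hκ =>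
    eq_neg_of_add_eq_zero_right ((hφ' κ hκ _ (Metric.ball_subset_closedBall (hφ κ hκ))).2 rfl)
  have hφV : ∀ κ ∈ Set.Icc (p₀.2 - δ) (p₀.2 + δ), ∀ κ' ∈ Set.Icc (p₀.2 - δ) (p₀.2 + δ),
      (φ κ, κ') ∈ V := fun κ hκ κ' hκ' => hbox ⟨Metric.ball_subset_closedBall (hφ κ hκ), hκ'⟩
  refine ⟨r, hr, δ, hδ, φ, hbox, fun κ hκ => ?_, fun κ hκ => ⟨hφ κ hκ, hφ' κ hκ⟩⟩
  have hlim : Tendsto (fun κ' => 2 * ‖G (φ κ, κ') - G (φ κ, κ)‖)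
      (𝓝[Set.Icc (p₀.2 - δ) (p₀.2 + δ)] κ) (𝓝 0) := by
    have h1 : ContinuousWithinAt (fun κ' => G (φ κ, κ')) (Set.Icc (p₀.2 - δ) (p₀.2 + δ)) κ :=
      ContinuousWithinAt.comp (t := V) (hG _ (hφV κ hκ κ hκ)) (by fun_prop) (hφV κ hκ)
    simpa using ((h1.tendsto.sub_const (G (φ κ, κ))).norm.const_mul 2)
  refine tendsto_iff_norm_sub_tendsto_zero.2 (squeeze_zero' (Eventually.of_forall fun _ =>
    norm_nonneg _) ?_ hlim)
  filter_upwards [self_mem_nhdsWithin] with κ' hκ'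
  have h1 := hLip _ (hφV κ' hκ' κ' hκ') _ (hφV κ hκ κ' hκ') rfl
  have h2 : φ κ' - φ κ =
      -((G (φ κ', κ') - G (φ κ, κ')) + (G (φ κ, κ') - G (φ κ, κ))) := by
    rw [hφz κ hκ, hφz κ' hκ']; abel
  have h3 : ‖φ κ' - φ κ‖ ≤ ‖G (φ κ', κ') - G (φ κ, κ')‖ + ‖G (φ κ, κ') - G (φ κ, κ)‖ := by
    conv_lhs => rw [h2, norm_neg]
    exact norm_add_le _ _
  simp only at h1
  linarith

variable [NormedSpace ℝ X]

/-- The global implicit function theorem for a compact perturbation `p ↦ p.1 + G p` of the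
identity whose compact part is a contraction in its first variable close to the given zero. -/
theorem global_continuation_of_contraction [CompleteSpace X] {U : Set (X × ℝ)} (hU : IsOpen U)
    {G : X × ℝ → X} (hG : ContinuousOn G U)
    (hGc : ∀ s ⊆ U, Bornology.IsBounded s → IsCompact (closure (G '' s)))
    {p₀ : X × ℝ} (hp₀U : p₀ ∈ U) (hp₀ : p₀.1 + G p₀ = 0) {V : Set (X × ℝ)} (hV : V ∈ 𝓝 p₀)
    (hLip : ∀ p ∈ V, ∀ q ∈ V, p.2 = q.2 → ‖G p - G q‖ ≤ 1 / 2 * ‖p.1 - q.1‖) :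
    ¬ Bornology.IsBounded (connectedComponentIn (closure {p ∈ U | p.1 + G p = 0}) p₀) ∨
      IsConnected (connectedComponentIn (closure {p ∈ U | p.1 + G p = 0}) p₀ \ {p₀}) ∨
      (connectedComponentIn (closure {p ∈ U | p.1 + G p = 0}) p₀ ∩ frontier U).Nonempty := by
  set S : Set (X × ℝ) := closure {p ∈ U | p.1 + G p = 0} with hS
  set K : Set (X × ℝ) := connectedComponentIn S p₀ with hK
  by_contra! ⟨hKb, hKc, hKU⟩
  obtain ⟨r, hr, δ, hδ, φ, hbox, hφc, hφ⟩ := exists_local_branch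
    (inter_mem hV (hU.mem_nhds hp₀U)) (hG.mono Set.inter_subset_right) hp₀
    fun p hp q hq => hLip p hp.1 q hq.1
  set I : Set ℝ := Set.Icc (p₀.2 - δ) (p₀.2 + δ) with hI
  set B : Set (X × ℝ) := Metric.closedBall p₀.1 r ×ˢ I with hB
  have hBU : B ⊆ U := fun p hp => (hbox hp).2
  have hSU : ∀ p ∈ S, p ∈ U → p.1 + G p = 0 :=
    fun p hp hpU => add_eq_zero_of_mem_closure_zeros hU hG hp hpU
  have hSB : ∀ p ∈ S, p ∈ B → p = (φ p.2, p.2) := fun p hp hpB =>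
    Prod.ext (((hφ p.2 hpB.2).2 p.1 hpB.1).1 (hSU p hp (hBU hpB))) rfl
  have hφB : ∀ κ ∈ I, (φ κ, κ) ∈ B := fun κ hκ =>
    ⟨Metric.ball_subset_closedBall (hφ κ hκ).1, hκ⟩
  have hφ0 : ∀ κ ∈ I, φ κ + G (φ κ, κ) = 0 := fun κ hκ =>
    ((hφ κ hκ).2 _ (hφB κ hκ).1).2 rfl
  have hφS : ∀ κ ∈ I, (φ κ, κ) ∈ S := fun κ hκ => subset_closure ⟨hBU (hφB κ hκ), hφ0 κ hκ⟩
  have hκ₀ : p₀.2 ∈ I := ⟨by linarith, by linarith⟩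
  have hp₀S : p₀ ∈ S := subset_closure ⟨hp₀U, hp₀⟩
  have hp₀φ : p₀ = (φ p₀.2, p₀.2) := hSB p₀ hp₀S ⟨Metric.mem_closedBall_self hr.le, hκ₀⟩
  have hbranch : ∀ J ⊆ I, J.OrdConnected → IsPreconnected ((fun κ => (φ κ, κ)) '' J) :=
    fun J hJ hJc => hJc.isPreconnected.image _ ((hφc.mono hJ).prodMk continuousOn_id)
  have hφK : ∀ κ ∈ I, (φ κ, κ) ∈ K := fun κ hκ =>
    (hbranch I subset_rfl Set.ordConnected_Icc).subset_connectedComponentIn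
      ⟨p₀.2, hκ₀, hp₀φ.symm⟩ (by rintro _ ⟨κ', hκ', rfl⟩; exact hφS κ' hκ') ⟨κ, hκ, rfl⟩
  have hφne : ∀ κ ∈ I, κ ≠ p₀.2 → (φ κ, κ) ∈ K \ {p₀} := fun κ hκ hne =>
    ⟨hφK κ hκ, fun h => hne (congrArg Prod.snd h)⟩
  have hKS : K ⊆ S := connectedComponentIn_subset _ _
  have hp₀K : p₀ ∈ K := mem_connectedComponentIn hp₀S
  have hleft : Set.Ico (p₀.2 - δ) p₀.2 ⊆ I := fun κ hκ => ⟨hκ.1, by linarith [hκ.2]⟩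
  have hright : Set.Ioc p₀.2 (p₀.2 + δ) ⊆ I := fun κ hκ => ⟨by linarith [hκ.1], hκ.2⟩
  -- the two half-branches emanating from `p₀` cannot be separated in `K \ {p₀}`
  have hsep : ∀ u v : Set (X × ℝ), IsOpen u → IsOpen v → K \ {p₀} ⊆ u ∪ v →
      (∀ y ∈ K \ {p₀}, y ∈ u → y ∉ v) → (∀ κ ∈ Set.Ioc p₀.2 (p₀.2 + δ), (φ κ, κ) ∈ u) →
      (φ (p₀.2 - δ), p₀.2 - δ) ∈ v → False := by
    intro u v hu hv huv hdisj hur hev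
    obtain ⟨R, hR⟩ := (hKb.union (Bornology.IsBounded.prod Metric.isBounded_closedBall
      (Metric.isBounded_Icc _ _)) : Bornology.IsBounded (K ∪ B)).subset_ball 0
    set W : Set (X × ℝ) := Metric.ball p₀.1 r ×ˢ Set.Ioo (p₀.2 - δ) p₀.2
    set Z : Set (X × ℝ) := (S ∩ Metric.closedBall 0 R) \ W with hZ
    set e : X × ℝ := (φ (p₀.2 - δ), p₀.2 - δ) with he
    have heI : p₀.2 - δ ∈ I := ⟨le_rfl, by linarith⟩
    have hZS : Z ⊆ S := fun p hp => hp.1.1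
    have hZB : ∀ p ∈ Z, p ∈ B → p.2 ≤ p₀.2 → p = e ∨ p = p₀ := by
      intro p hp hpB hle
      have h1 := hSB p (hZS hp) hpB
      rcases hle.eq_or_lt with h | h
      · right; rw [h1, hp₀φ, h]
      rcases hpB.2.1.eq_or_lt with h' | h'
      · left; rw [h1, ← h']
      · refine absurd ⟨?_, h', h⟩ hp.2
        rw [congrArg Prod.fst h1]
        exact (hφ _ hpB.2).1
    have hZc : IsCompact Z :=
      (isCompact_closure_zeros_inter_closedBall hGc R).diff
        (Metric.isOpen_ball.prod isOpen_Ioo)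
    have hp₀Z : p₀ ∈ Z :=
      ⟨⟨hp₀S, Metric.ball_subset_closedBall (hR (Or.inl hp₀K))⟩, fun h => h.2.2.ne rfl⟩
    have hQK : connectedComponentIn Z p₀ ⊆ K := connectedComponentIn_mono _ hZS
    have hQu : connectedComponentIn Z p₀ \ {p₀} ⊆ u := by
      refine isPreconnected_connectedComponentIn.diff_singleton_subset_of_separated
        (mem_connectedComponentIn hp₀Z) hu hv
        (Metric.isOpen_ball.prod isOpen_Ioo : IsOpen (Metric.ball p₀.1 r ×ˢ
          Set.Ioo (p₀.2 - δ) (p₀.2 + δ))) ⟨Metric.mem_ball_self hr, by simpa, by simpa⟩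
        ((Set.sdiff_subset_sdiff_left hQK).trans huv) (fun y hy => hdisj y ⟨hQK hy.1, hy.2⟩) ?_
      rintro y ⟨hyQ, hyp⟩ hyW
      have hyZ : y ∈ Z := connectedComponentIn_subset _ _ hyQ
      have hyB : y ∈ B := ⟨Metric.ball_subset_closedBall hyW.1, Set.Ioo_subset_Icc_self hyW.2⟩
      rcases le_or_gt y.2 p₀.2 with h | h
      · rcases hZB y hyZ hyB h with rfl | rfl
        · exact absurd hyW.2.1 (lt_irrefl _)
        · exact absurd rfl hyp
      · rw [hSB y (hZS hyZ) hyB]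
        exact hur _ ⟨h, hyW.2.2.le⟩
    have heQ : e ∉ connectedComponentIn Z p₀ := fun h => by
      have hne : e ∈ K \ {p₀} := hφne _ heI (by linarith)
      exact hdisj e hne (hQu ⟨h, hne.2⟩) hev
    obtain ⟨N, N', hN, hN', hNN', hNZ, hp₀N, hNY⟩ :=
      hZc.exists_isCompact_union_eq_of_disjoint_connectedComponentIn
      (Y := {e} ∪ (frontier U ∪ (Metric.ball 0 R)ᶜ))
      (isClosed_singleton.union (isClosed_frontier.union Metric.isOpen_ball.isClosed_compl))
      hp₀Z (by
        rw [Set.disjoint_left]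
        rintro p hp (rfl | h | h)
        · exact heQ hp
        · exact (Set.eq_empty_iff_forall_notMem.1 hKU) p ⟨hQK hp, h⟩
        · exact h (hR (Or.inl (hQK hp))))
    have hNZ' : N ⊆ Z := hNZ ▸ Set.subset_union_left
    have hNY' : ∀ p ∈ N, p ≠ e ∧ p ∉ frontier U ∧ p ∈ Metric.ball 0 R := fun p hp => by
      have := Set.disjoint_left.1 hNY hp
      simpa [not_or] using this
    have hl : Set.Icc (p₀.2 - δ) p₀.2 ⊆ I := Set.Icc_subset_Icc_right (by linarith)
    have hlB : Metric.closedBall p₀.1 r ×ˢ Set.Icc (p₀.2 - δ) p₀.2 ⊆ B := Set.prod_mono_right hl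
    have hmid : p₀.2 - δ / 2 ∈ I := ⟨by linarith, by linarith⟩
    refine false_of_single_branch (Ω := U ∩ Metric.ball 0 R) (N := N) (N' := N') (x := p₀.1)
      (ξ := φ (p₀.2 - δ / 2)) (r := r) (a := p₀.2 - δ) (b := p₀.2 - 2 * δ / 3)
      (c := p₀.2 - δ / 3) (d := p₀.2) (hU.inter Metric.isOpen_ball)
      (Metric.isBounded_ball.subset Set.inter_subset_right) (hG.mono Set.inter_subset_left)
      (hGc _ Set.inter_subset_left (Metric.isBounded_ball.subset Set.inter_subset_right))
      (by linarith) (by linarith) (by linarith) ?_ ?_ ?_ ?_ hN.isClosed ?_ hN'.isClosed hNN' ?_ ?_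
      ?_
    · exact fun p hp => ⟨hBU (hlB hp), hR (Or.inr (hlB hp))⟩
    · exact fun κ hκ y hy z hz => hLip _ (hbox ⟨hy, hl hκ⟩).1 _ (hbox ⟨hz, hl hκ⟩).1 rfl
    · exact (hφ _ hmid).1
    · have : (p₀.2 - 2 * δ / 3 + (p₀.2 - δ / 3)) / 2 = p₀.2 - δ / 2 := by ring
      rw [this]
      exact eq_neg_of_add_eq_zero_right (hφ0 _ hmid)
    · refine fun p hp => ⟨by_contra fun hpU => (hNY' p hp).2.1 ?_, (hNY' p hp).2.2⟩
      rw [frontier, hU.interior_eq]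
      exact ⟨closure_mono (fun q hq => hq.1) (hZS (hNZ' hp)), hpU⟩
    · refine Set.disjoint_left.2 fun p hp hpB => ?_
      have hle : p.2 ≤ p₀.2 - δ / 3 := hpB.2.2
      rcases hZB p (hNZ' hp) (hlB ⟨hpB.1, hpB.2.1, by linarith⟩) (by linarith) with h | rfl
      · exact (hNY' p hp).1 h
      · linarith
    · refine Set.disjoint_left.2 fun p hp hpB => ?_
      have hle : p₀.2 - 2 * δ / 3 ≤ p.2 := hpB.2.1
      rcases hZB p (hNZ ▸ Or.inr hp) (hlB ⟨hpB.1, by linarith, hpB.2.2⟩) hpB.2.2 with h | rfl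
      · have : p.2 = p₀.2 - δ := congrArg Prod.snd h
        linarith
      · exact Set.disjoint_left.1 hNN' hp₀N hp
    · rintro p ⟨hpU, hpR⟩ hp
      by_cases hpW : p ∈ W
      · exact Or.inr (Or.inr ⟨Metric.ball_subset_closedBall hpW.1, Set.Ioo_subset_Icc_self hpW.2⟩)
      · have : p ∈ N ∪ N' := hNZ ▸
          ⟨⟨subset_closure ⟨hpU, hp⟩, Metric.ball_subset_closedBall hpR⟩, hpW⟩
        exact this.imp id Or.inl
  have hsplit : ∀ J ⊆ I, J.OrdConnected → p₀.2 ∉ J → ∀ u v : Set (X × ℝ), IsOpen u → IsOpen v →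
      K \ {p₀} ⊆ u ∪ v → (K \ {p₀}) ∩ (u ∩ v) = ∅ →
      (fun κ => (φ κ, κ)) '' J ⊆ u ∨ (fun κ => (φ κ, κ)) '' J ⊆ v := by
    intro J hJ hJc hJ₀ u v hu hv huv hdisj
    have hsub : (fun κ => (φ κ, κ)) '' J ⊆ K \ {p₀} := Set.image_subset_iff.2 fun κ hκ =>
      hφne κ (hJ hκ) fun h => hJ₀ (h ▸ hκ)
    exact isPreconnected_iff_subset_of_disjoint.1 (hbranch J hJ hJc) u v hu hv (hsub.trans huv)
      (Set.subset_empty_iff.1 (hdisj ▸ Set.inter_subset_inter_left _ hsub))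
  have heL : p₀.2 - δ ∈ Set.Ico (p₀.2 - δ) p₀.2 := ⟨le_rfl, by linarith⟩
  refine hKc ⟨⟨_, hφne _ (hleft heL) (by linarith)⟩, isPreconnected_iff_subset_of_disjoint.2
    fun u v hu hv huv hdisj => ?_⟩
  have hdisj' : ∀ y ∈ K \ {p₀}, y ∈ u → y ∉ v := fun y hy hyu hyv =>
    Set.eq_empty_iff_forall_notMem.1 hdisj y ⟨hy, hyu, hyv⟩
  -- if both half-branches lie in the same piece, the other piece is empty
  have hsame : ∀ u v : Set (X × ℝ), IsOpen u → IsOpen v → K \ {p₀} ⊆ u ∪ v →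
      (∀ y ∈ K \ {p₀}, y ∈ u → y ∉ v) →
      (fun κ => (φ κ, κ)) '' Set.Ioc p₀.2 (p₀.2 + δ) ⊆ u →
      (fun κ => (φ κ, κ)) '' Set.Ico (p₀.2 - δ) p₀.2 ⊆ u → K \ {p₀} ⊆ u := by
    intro u v hu hv huv hdisj hr' hl'
    refine isPreconnected_connectedComponentIn.diff_singleton_subset_of_separated hp₀K hu hv
      (Metric.isOpen_ball.prod isOpen_Ioo : IsOpen (Metric.ball p₀.1 r ×ˢ
        Set.Ioo (p₀.2 - δ) (p₀.2 + δ))) ⟨Metric.mem_ball_self hr, by simpa, by simpa⟩ huv hdisj ?_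
    rintro y ⟨hyK, hyp⟩ hyW
    have hy := hSB y (hKS hyK)
      ⟨Metric.ball_subset_closedBall hyW.1, Set.Ioo_subset_Icc_self hyW.2⟩
    rcases lt_trichotomy y.2 p₀.2 with h | h | h
    · exact hl' ⟨y.2, ⟨hyW.2.1.le, h⟩, hy.symm⟩
    · exact absurd (by rw [Set.mem_singleton_iff, hy, hp₀φ, h]) hyp
    · exact hr' ⟨y.2, ⟨h, hyW.2.2.le⟩, hy.symm⟩
  have hsplit_right := hsplit (Set.Ioc p₀.2 (p₀.2 + δ)) hright Set.ordConnected_Ioc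
    (fun h => h.1.ne rfl) u v hu hv huv hdisj
  have hsplit_left := hsplit (Set.Ico (p₀.2 - δ) p₀.2) hleft Set.ordConnected_Ico
    (fun h => h.2.ne rfl) u v hu hv huv hdisj
  rcases hsplit_right, hsplit_left with ⟨h1 | h1, h2 | h2⟩
  · exact Or.inl (hsame u v hu hv huv hdisj' h1 h2)
  · exact (hsep u v hu hv huv hdisj' (fun κ hκ => h1 ⟨κ, hκ, rfl⟩) (h2 ⟨_, heL, rfl⟩)).elim
  · exact (hsep v u hv hu (Set.union_comm u v ▸ huv) (fun y hy h h' => hdisj' y hy h' h)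
      (fun κ hκ => h1 ⟨κ, hκ, rfl⟩) (h2 ⟨_, heL, rfl⟩)).elim
  · exact Or.inr (hsame v u hv hu (Set.union_comm u v ▸ huv)
      (fun y hy h h' => hdisj' y hy h' h) h1 h2)

end GlobalContinuation

/-- Global implicit function theorem (Rabinowitz, Kielhöfer, Alexander–Yorke): for a `C¹`
compact perturbation of the identity `F` on an open set `U ⊆ X × ℝ` with an isomorphic
partial derivative at a zero `(ξ₀, κ₀)`, the connected component `K` of the closure of
the zero set containing `(ξ₀, κ₀)` is either unbounded, or `K \ {(ξ₀,κ₀)}` is connected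
(a loop), or `K` meets `∂U`. -/
theorem global_implicit_function_theorem
    {X : Type*} [NormedAddCommGroup X] [NormedSpace ℝ X] [CompleteSpace X]
    (U : Set (X × ℝ)) (hU : IsOpen U)
    (F : X × ℝ → X) (hF : ContDiffOn ℝ 1 F U)
    (ξ₀ : X) (κ₀ : ℝ) (hmem : (ξ₀, κ₀) ∈ U) (hzero : F (ξ₀, κ₀) = 0)
    -- (a) `∂F/∂ξ(ξ₀, κ₀)` is an isomorphism of `X`
    (ha : ∃ T : X ≃L[ℝ] X, (T : X →L[ℝ] X) =
      (fderiv ℝ F (ξ₀, κ₀)).comp (ContinuousLinearMap.inl ℝ X ℝ))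
    -- (b) `(ξ, κ) ↦ F(ξ, κ) − ξ` is a compact map from `U` to `X`
    (hb₁ : ContinuousOn (fun p : X × ℝ => F p - p.1) U)
    (hb₂ : ∀ s : Set (X × ℝ), s ⊆ U → Bornology.IsBounded s →
      IsCompact (closure ((fun p : X × ℝ => F p - p.1) '' s)))
    -- (c) `∂F/∂ξ(ξ, κ) − I` is a compact operator on `X` for every `(ξ, κ) ∈ U`
    (hc : ∀ p ∈ U, IsCompactOperator
      ((fderiv ℝ F p).comp (ContinuousLinearMap.inl ℝ X ℝ) - ContinuousLinearMap.id ℝ X))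
    (S : Set (X × ℝ)) (hS : S = closure {p ∈ U | F p = 0})
    (K : Set (X × ℝ)) (hK : K = connectedComponentIn S (ξ₀, κ₀)) :
    ¬ Bornology.IsBounded K ∨
      IsConnected (K \ {(ξ₀, κ₀)}) ∨
      (K ∩ frontier U).Nonempty := by
  obtain ⟨T, hT⟩ := ha
  let G : X × ℝ → X := fun p => T.symm (F p) - p.1
  have hF₀ : HasStrictFDerivAt F (fderiv ℝ F (ξ₀, κ₀)) (ξ₀, κ₀) :=
    (hF.contDiffAt (hU.mem_nhds hmem)).hasStrictFDerivAt one_ne_zero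
  have hG₀ : HasStrictFDerivAt G ((T.symm : X →L[ℝ] X).comp (fderiv ℝ F (ξ₀, κ₀)) -
      ContinuousLinearMap.fst ℝ X ℝ) (ξ₀, κ₀) :=
    (T.symm.hasStrictFDerivAt.comp _ hF₀).sub hasStrictFDerivAt_fst
  obtain ⟨V, hV, hVG⟩ := hG₀.approximates_deriv_on_nhds (c := 1 / 2)
    (Or.inr (by rw [← NNReal.coe_lt_coe]; norm_num))
  have hG : ContinuousOn G U :=
    (T.symm.continuous.comp_continuousOn hF.continuousOn).sub continuousOn_fst
  have hGc : ∀ s ⊆ U, Bornology.IsBounded s → IsCompact (closure (G '' s)) := by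
    intro s hs hsb
    have h := (hb₂ s hs hsb).prod
      ((hc _ hmem).isCompact_closure_image_of_bounded hsb.image_fst)
    have hcont : Continuous fun y : X × X => T.symm (y.1 - y.2) := by fun_prop
    refine (h.image hcont).closure_of_subset ?_
    rintro _ ⟨p, hp, rfl⟩
    refine ⟨_, Set.mk_mem_prod (subset_closure (Set.mem_image_of_mem _ hp))
      (subset_closure (Set.mem_image_of_mem _ (Set.mem_image_of_mem Prod.fst hp))), ?_⟩
    simp [G, ← hT]
  have hzeros : {p ∈ U | F p = 0} = {p ∈ U | p.1 + G p = 0} := by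
    ext p
    simp [G]
  subst hK hS
  rw [hzeros]
  refine global_continuation_of_contraction hU hG hGc hmem (by simp [G, hzero]) hV ?_
  rintro ⟨y, κ⟩ hy ⟨z, κ'⟩ hz rfl
  have h := hVG _ hy _ hz
  have hTy : ∀ x, T.symm (fderiv ℝ F (ξ₀, κ₀) (x, 0)) = x := fun x => by
    rw [T.symm_apply_eq]
    exact (DFunLike.congr_fun hT x).symm
  simpa [hTy, Prod.norm_def] using h
end
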